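/- arXiv:2004.04155 — 4 statements merged into one kernel-verified Lean document; each statement's English description precedes it below -/
import Mathlib

section
/- Let T : A → B be a bounded linear operator between C*-algebras. The following are equivalent: (i) T is orthogonality preserving; (ii) T is orthogonality preserving on the set of self-adjoint elements of A; (iii) T is orthogonality preserving on the set of positive elements of A. -/
/-- Two elements `a, b` of a C*-algebra are orthogonal if `a b* = 0` and `b* a = 0`. -/
def IsOrthogonal {A : Type*} [NonUnitalCStarAlgebra A] (a b : A) : Prop :=
  a * star b = 0 ∧ star b * a = 0

/-- hat function -/
noncomputable def opHat (y : ℝ) : ℝ := max 0 (1 - |y|)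

lemma opHat_nonneg (y : ℝ) : 0 ≤ opHat y := le_max_left _ _

lemma opHat_eq_zero {y : ℝ} (h : 1 ≤ |y|) : opHat y = 0 := by
  unfold opHat; exact max_eq_left (by linarith)

lemma opHat_continuous : Continuous opHat := by
  unfold opHat; fun_prop

lemma opHat_sum (y : ℝ) (K : ℤ) (hy : |y| + 2 ≤ K) :
    ∑ i ∈ Finset.Icc (-K) K, opHat (y - i) = 1 := by
  have h1 := Int.floor_le y
  have h2 := Int.lt_floor_add_one y
  obtain ⟨h3, h4⟩ := abs_le.mp (le_refl |y|)
  set m := ⌊y⌋ with hm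
  have hmK : m ≤ K - 2 := by
    have : (m : ℝ) ≤ ((K - 2 : ℤ) : ℝ) := by push_cast; linarith
    exact_mod_cast this
  have hmK' : -K < m := by
    have : ((-K : ℤ) : ℝ) < (m : ℝ) := by push_cast; linarith
    exact_mod_cast this
  have hsub : ({m, m + 1} : Finset ℤ) ⊆ Finset.Icc (-K) K := by
    intro i hi
    simp only [Finset.mem_insert, Finset.mem_singleton] at hi
    rw [Finset.mem_Icc]; omega
  rw [← Finset.sum_subset hsub, Finset.sum_pair (by omega)]
  · unfold opHat
    rw [abs_of_nonneg (by linarith : (0:ℝ) ≤ y - m)]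
    push_cast
    rw [abs_of_nonpos (by linarith : y - ((m:ℝ) + 1) ≤ 0), max_eq_right (by linarith),
      max_eq_right (by linarith)]
    ring
  · intro i _ hi
    simp only [Finset.mem_insert, Finset.mem_singleton, not_or] at hi
    apply opHat_eq_zero
    rcases lt_or_gt_of_ne hi.1 with h | h
    · have : (i : ℝ) + 1 ≤ m := by exact_mod_cast h
      rw [abs_of_nonneg (by linarith)]; linarith
    · have : (m : ℝ) + 2 ≤ i := by
        have : m + 2 ≤ i := by omega
        exact_mod_cast this
      rw [abs_of_nonpos (by linarith)]; linarith

/-- local sign -/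
def opSgn (m : ℤ) : ℝ := if m % 3 = 1 then 1 else if m % 3 = 2 then -1 else 0

lemma opSgn_abs (m : ℤ) : |opSgn m| ≤ 1 := by
  unfold opSgn; split_ifs <;> simp

lemma opSgn_sum (i j : ℤ) (h : |i - j| ≤ 1) (t : ℝ) :
    ∑ r ∈ Finset.range 3, (if (i - r) % 3 = 0 then t else 0) * opSgn (j - r)
      = t * (j - i) := by
  have hd : j = i - 1 ∨ j = i ∨ j = i + 1 := by
    rw [abs_le] at h; omega
  have hi : i % 3 = 0 ∨ i % 3 = 1 ∨ i % 3 = 2 := by omega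
  simp only [Finset.sum_range_succ, Finset.sum_range_zero, opSgn]
  rcases hd with rfl | rfl | rfl <;> rcases hi with hi | hi | hi <;>
    simp (disch := omega) only [if_pos, if_neg] <;> push_cast <;> ring

set_option linter.unusedSectionVars false
section comm
variable {X E : Type*} [TopologicalSpace X] [CompactSpace X] [NormedAddCommGroup E]
  [NormedSpace ℝ E]

/-- hats composed with f -/
noncomputable def opPsi (f : C(X, ℝ)) (N : ℕ) (i : ℤ) : C(X, ℝ) :=
  ⟨fun x => opHat (N * f x - i), by have := opHat_continuous; fun_prop⟩

lemma opPsi_apply (f : C(X, ℝ)) (N : ℕ) (i : ℤ) (x : X) :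
    opPsi f N i x = opHat (N * f x - i) := rfl

/-- combination -/
noncomputable def opP (f : C(X, ℝ)) (N : ℕ) (K : ℤ) (c : ℤ → ℝ) : C(X, ℝ) :=
  ∑ i ∈ Finset.Icc (-K) K, c i • opPsi f N i

lemma opP_near (f : C(X, ℝ)) (N : ℕ) (K : ℤ) (hK : N * ‖f‖ + 2 ≤ K) (c : ℤ → ℝ)
    (g : C(X, ℝ)) (ε : ℝ) (hε : 0 ≤ ε)
    (h : ∀ x, ∀ i ∈ Finset.Icc (-K) K, |N * f x - i| < 1 → |c i - g x| ≤ ε) :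
    ‖opP f N K c - g‖ ≤ ε := by
  rw [ContinuousMap.norm_le _ hε]
  intro x
  have hs := opHat_sum (N * f x) K (by
    rw [abs_mul, Nat.abs_cast]
    have := f.norm_coe_le_norm x
    rw [Real.norm_eq_abs] at this
    have : (N : ℝ) * |f x| ≤ N * ‖f‖ := by gcongr
    linarith)
  have : (opP f N K c - g) x = ∑ i ∈ Finset.Icc (-K) K, (c i - g x) * opHat (N * f x - i) := by
    simp only [sub_mul, Finset.sum_sub_distrib, ← Finset.mul_sum, hs]
    simp [opP, opPsi_apply, ContinuousMap.sum_apply]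
  rw [this, Real.norm_eq_abs]
  calc _ ≤ ∑ i ∈ Finset.Icc (-K) K, |(c i - g x) * opHat (N * f x - i)| :=
        Finset.abs_sum_le_sum_abs _ _
    _ ≤ ∑ i ∈ Finset.Icc (-K) K, ε * opHat (N * f x - i) := by
        apply Finset.sum_le_sum
        intro i hi
        rw [abs_mul, abs_of_nonneg (opHat_nonneg _)]
        by_cases h1 : |N * f x - i| < 1
        · exact mul_le_mul_of_nonneg_right (h x i hi h1) (opHat_nonneg _)
        · rw [opHat_eq_zero (not_lt.mp h1)]; simp
    _ = ε := by rw [← Finset.mul_sum, hs, mul_one]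

lemma opP_norm (f : C(X, ℝ)) (N : ℕ) (K : ℤ) (hK : N * ‖f‖ + 2 ≤ K) (c : ℤ → ℝ)
    (ε : ℝ) (hε : 0 ≤ ε) (h : ∀ i ∈ Finset.Icc (-K) K, |c i| ≤ ε) :
    ‖opP f N K c‖ ≤ ε := by
  have := opP_near f N K hK c 0 ε hε (fun x i hi _ => by simpa using h i hi)
  simpa using this

lemma opPsi_mul (f : C(X, ℝ)) (N : ℕ) (i j : ℤ) (h : ¬ |i - j| ≤ 1) :
    opPsi f N i * opPsi f N j = 0 := by
  ext x
  simp only [ContinuousMap.mul_apply, opPsi_apply, ContinuousMap.zero_apply, mul_eq_zero]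
  by_contra! hc
  have h1 : |N * f x - i| < 1 := by
    by_contra h'; exact hc.1 (opHat_eq_zero (not_lt.mp h'))
  have h2 : |N * f x - j| < 1 := by
    by_contra h'; exact hc.2 (opHat_eq_zero (not_lt.mp h'))
  rw [abs_lt] at h1 h2
  apply h
  have : |i - j| < 2 := by
    rw [abs_lt]
    constructor
    · have : (-2 : ℝ) < i - j := by linarith
      exact_mod_cast this
    · have : (i - j : ℝ) < 2 := by linarith
      exact_mod_cast this
  omega

lemma opP_V (V : C(X, ℝ) →ₗ[ℝ] C(X, ℝ) →ₗ[ℝ] E) (f : C(X, ℝ)) (N : ℕ) (K : ℤ) (c d : ℤ → ℝ) :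
    V (opP f N K c) (opP f N K d) = ∑ i ∈ Finset.Icc (-K) K, ∑ j ∈ Finset.Icc (-K) K,
      (c i * d j) • V (opPsi f N i) (opPsi f N j) := by
  simp only [opP, map_sum, LinearMap.sum_apply, map_smul, LinearMap.smul_apply, Finset.smul_sum,
    smul_smul]
  rw [Finset.sum_comm]
  refine Finset.sum_congr rfl fun i _ => Finset.sum_congr rfl fun j _ => ?_
  rw [mul_comm]

lemma op_comm_sq (V : C(X, ℝ) →ₗ[ℝ] C(X, ℝ) →ₗ[ℝ] E) (C : ℝ) (hC : 0 ≤ C)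
    (hV : ∀ g h, ‖V g h‖ ≤ C * ‖g‖ * ‖h‖) (ho : ∀ g h, g * h = 0 → V g h = 0)
    (f : C(X, ℝ)) : V f f = V (f * f) 1 := by
  have key : ∀ N : ℕ, 0 < N → ‖V f f - V (f * f) 1‖ ≤
      (C * (2 * ‖f‖ + 1) + C * (2 * ‖f‖ + 1) + 3 * C * (‖f‖ + 3)) * (N : ℝ)⁻¹ := by
    intro N hN
    have hN' : (1 : ℝ) ≤ N := by exact_mod_cast hN
    have hN0 : (0 : ℝ) < N := by linarith
    have hi0 : (0 : ℝ) < (N : ℝ)⁻¹ := by positivity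
    have hi1 : (N : ℝ)⁻¹ ≤ 1 := inv_le_one_of_one_le₀ hN'
    have hNi : (N : ℝ) * (N : ℝ)⁻¹ = 1 := by field_simp
    set δ : ℝ := (N : ℝ)⁻¹ with hδ
    set K : ℤ := ⌈N * ‖f‖⌉ + 2 with hKdef
    have hK : N * ‖f‖ + 2 ≤ K := by
      have := Int.le_ceil (N * ‖f‖); rw [hKdef]; push_cast; linarith
    have hK2 : (K : ℝ) * δ ≤ ‖f‖ + 3 := by
      have h := (Int.ceil_lt_add_one (N * ‖f‖)).le
      have : (K : ℝ) ≤ N * (‖f‖ + 3) := by rw [hKdef]; push_cast; nlinarith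
      calc (K : ℝ) * δ ≤ (N * (‖f‖ + 3)) * δ := by gcongr
        _ = (N * δ) * (‖f‖ + 3) := by ring
        _ = _ := by rw [hNi, one_mul]
    have hfx : ∀ x, |f x| ≤ ‖f‖ := fun x => f.norm_coe_le_norm x
    have hloc : ∀ x, ∀ i : ℤ, |N * f x - i| < 1 → |i * δ - f x| ≤ δ := by
      intro x i h
      have : i * δ - f x = -((N * f x - i) * δ) := by
        rw [sub_mul, mul_right_comm, hNi]; ring
      rw [this, abs_neg, abs_mul, abs_of_pos hi0]
      nlinarith
    set g1 := opP f N K (fun i => i * δ) with hg1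
    set g2 := opP f N K (fun i => i * δ * (i * δ)) with hg2
    have e1 : ‖g1 - f‖ ≤ δ := opP_near f N K hK _ f δ hi0.le (fun x i _ h => hloc x i h)
    have e2 : ‖g2 - f * f‖ ≤ (2 * ‖f‖ + 1) * δ := by
      refine opP_near f N K hK _ (f * f) _ (by positivity) (fun x i _ h => ?_)
      have h1 := hloc x i h
      have : i * δ * (i * δ) - (f * f) x = (i * δ - f x) * ((i * δ - f x) + 2 * f x) := by
        simp only [ContinuousMap.mul_apply]; ring
      rw [this, abs_mul, mul_comm]
      have h2 : |(i * δ - f x) + 2 * f x| ≤ 2 * ‖f‖ + 1 := by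
        refine (abs_add_le _ _).trans ?_
        rw [abs_mul, abs_two]; have := hfx x; linarith
      gcongr
    have e3 : opP f N K (fun _ => 1) = 1 := by
      have := opP_near f N K hK (fun _ => 1) 1 0 le_rfl (fun x i _ h => by simp)
      exact sub_eq_zero.mp (norm_le_zero_iff.mp this)
    have n1 : ‖g1‖ ≤ ‖f‖ + 1 := by
      have : g1 = (g1 - f) + f := by abel
      rw [this]; refine (norm_add_le _ _).trans ?_; linarith
    have n0 : ‖(1 : C(X, ℝ))‖ ≤ 1 := by
      rw [ContinuousMap.norm_le _ zero_le_one]; intro x; simp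
    have main : V g1 g1 - V g2 1 = δ • ∑ r ∈ Finset.range 3,
        V (opP f N K (fun i => if (i - r) % 3 = 0 then i * δ else 0))
          (opP f N K (fun j => opSgn (j - r))) := by
      rw [← e3, hg1, hg2]
      simp only [opP_V]
      rw [← Finset.sum_sub_distrib, Finset.sum_comm, Finset.smul_sum]
      refine Finset.sum_congr rfl fun i _ => ?_
      rw [Finset.sum_comm, ← Finset.sum_sub_distrib, Finset.smul_sum]
      refine Finset.sum_congr rfl fun j _ => ?_
      rw [← Finset.sum_smul, ← sub_smul]
      by_cases hij : |i - j| ≤ 1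
      · rw [opSgn_sum i j hij, smul_smul]
        congr 1; ring
      · rw [ho _ _ (opPsi_mul f N i j hij)]; simp
    have mb : ‖V g1 g1 - V g2 1‖ ≤ δ * (3 * (C * (‖f‖ + 3))) := by
      rw [main, norm_smul, Real.norm_of_nonneg hi0.le]
      gcongr
      refine (norm_sum_le_of_le (Finset.range 3) (f := fun r : ℕ => V (opP f N K (fun i => if (i - r) % 3 = 0 then i * δ else 0)) (opP f N K (fun j => opSgn (j - r)))) (n := fun _ => C * (‖f‖ + 3)) ?_).trans (by simp)
      intro r _
      refine (hV _ _).trans ?_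
      have b1 : ‖opP f N K (fun i => if (i - r) % 3 = 0 then i * δ else 0)‖ ≤ ‖f‖ + 3 := by
        refine opP_norm f N K hK _ _ (by positivity) fun i hi => ?_
        split_ifs
        · rw [abs_mul, abs_of_pos hi0]
          refine le_trans ?_ hK2
          gcongr
          rw [Finset.mem_Icc] at hi
          rw [← Int.cast_abs]
          exact_mod_cast abs_le.mpr hi
        · simp; positivity
      have b2 : ‖opP f N K (fun j => opSgn (j - r))‖ ≤ 1 :=
        opP_norm f N K hK _ _ zero_le_one fun i _ => opSgn_abs _
      calc _ ≤ C * (‖f‖ + 3) * 1 := by gcongr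
        _ = _ := by ring
    have split : V f f - V (f * f) 1 =
        -(V (g1 - f) f + V g1 (g1 - f)) + V (g2 - f * f) 1 + (V g1 g1 - V g2 1) := by
      simp only [map_sub, LinearMap.sub_apply]; abel
    have c1 : ‖V (g1 - f) f‖ ≤ C * δ * ‖f‖ := (hV _ _).trans (by gcongr)
    have c2 : ‖V g1 (g1 - f)‖ ≤ C * (‖f‖ + 1) * δ := (hV _ _).trans (by gcongr)
    have c3 : ‖V (g2 - f * f) 1‖ ≤ C * ((2 * ‖f‖ + 1) * δ) * 1 := (hV _ _).trans (by gcongr)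
    rw [split]
    refine (norm_add₃_le ..).trans ?_
    rw [norm_neg]
    have := norm_add_le (V (g1 - f) f) (V g1 (g1 - f))
    linarith
  have lim : Filter.Tendsto (fun N : ℕ => (C * (2 * ‖f‖ + 1) + C * (2 * ‖f‖ + 1) + 3 * C * (‖f‖ + 3)) * (N : ℝ)⁻¹)
      Filter.atTop (nhds 0) := by
    simpa using tendsto_inv_atTop_nhds_zero_nat (𝕜 := ℝ) |>.const_mul (C * (2 * ‖f‖ + 1) + C * (2 * ‖f‖ + 1) + 3 * C * (‖f‖ + 3))
  have := ge_of_tendsto lim (Filter.eventually_atTop.mpr ⟨1, fun N hN => key N hN⟩)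
  exact sub_eq_zero.mp (norm_le_zero_iff.mp this)

lemma op_comm_one (V : C(X, ℝ) →ₗ[ℝ] C(X, ℝ) →ₗ[ℝ] E) (C : ℝ) (hC : 0 ≤ C)
    (hV : ∀ g h, ‖V g h‖ ≤ C * ‖g‖ * ‖h‖) (ho : ∀ g h, g * h = 0 → V g h = 0)
    (f : C(X, ℝ)) : V f 1 = V 1 f := by
  have h1 := op_comm_sq V C hC hV ho f
  have h2 := op_comm_sq V C hC hV ho (f + 1)
  have : (f + 1) * (f + 1) = f * f + f + f + 1 := by ring
  rw [this] at h2
  simp only [map_add, LinearMap.add_apply, h1] at h2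
  have h3 := sub_eq_zero.mpr h2
  have h4 : V 1 f - V f 1 = 0 := by rw [← h3]; abel
  exact (sub_eq_zero.mp h4).symm
end comm

section opA
open ContinuousMapZero
variable {A B : Type*} [NonUnitalCStarAlgebra A] [NonUnitalCStarAlgebra B]

/-- elements on which `e` is a unit -/
def opUnit (e : A) (he : IsSelfAdjoint e) : NonUnitalStarSubalgebra ℝ A where
  carrier := {x | e * x = x ∧ x * e = x}
  add_mem' := by
    rintro x y ⟨h1, h2⟩ ⟨h3, h4⟩
    exact ⟨by rw [mul_add, h1, h3], by rw [add_mul, h2, h4]⟩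
  zero_mem' := by simp
  mul_mem' := by
    rintro x y ⟨h1, h2⟩ ⟨h3, h4⟩
    exact ⟨by rw [← mul_assoc, h1], by rw [mul_assoc, h4]⟩
  smul_mem' := by
    rintro c x ⟨h1, h2⟩
    exact ⟨by rw [mul_smul_comm, h1], by rw [smul_mul_assoc, h2]⟩
  star_mem' := by
    rintro x ⟨h1, h2⟩
    constructor
    · have := congrArg star h2; rwa [star_mul, he.star_eq] at this
    · have := congrArg star h1; rwa [star_mul, he.star_eq] at this

lemma opUnit_closed (e : A) (he : IsSelfAdjoint e) : IsClosed (opUnit e he : Set A) := by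
  have : (opUnit e he : Set A) = {x | e * x = x} ∩ {x | x * e = x} := rfl
  rw [this]
  exact (isClosed_eq (by fun_prop) (by fun_prop)).inter (isClosed_eq (by fun_prop) (by fun_prop))

/-- annihilator -/
def opAnn (e : A) (he : IsSelfAdjoint e) : NonUnitalStarSubalgebra ℝ A where
  carrier := {x | e * x = 0 ∧ x * e = 0}
  add_mem' := by
    rintro x y ⟨h1, h2⟩ ⟨h3, h4⟩
    exact ⟨by rw [mul_add, h1, h3, add_zero], by rw [add_mul, h2, h4, add_zero]⟩
  zero_mem' := by simp
  mul_mem' := by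
    rintro x y ⟨h1, h2⟩ ⟨h3, h4⟩
    exact ⟨by rw [← mul_assoc, h1, zero_mul], by rw [mul_assoc, h4, mul_zero]⟩
  smul_mem' := by
    rintro c x ⟨h1, h2⟩
    exact ⟨by rw [mul_smul_comm, h1, smul_zero], by rw [smul_mul_assoc, h2, smul_zero]⟩
  star_mem' := by
    rintro x ⟨h1, h2⟩
    constructor
    · have := congrArg star h2; rwa [star_mul, he.star_eq, star_zero] at this
    · have := congrArg star h1; rwa [star_mul, he.star_eq, star_zero] at this

lemma opAnn_closed (e : A) (he : IsSelfAdjoint e) : IsClosed (opAnn e he : Set A) := by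
  have : (opAnn e he : Set A) = {x | e * x = 0} ∩ {x | x * e = 0} := rfl
  rw [this]
  exact (isClosed_eq (by fun_prop) (by fun_prop)).inter (isClosed_eq (by fun_prop) (by fun_prop))

lemma op_unit_cfc (e s : A) (he : IsSelfAdjoint e) (hs : IsSelfAdjoint s)
    (h : s ∈ opUnit e he) (f : C(quasispectrum ℝ s, ℝ)₀) : cfcₙHom hs f ∈ opUnit e he :=
  NonUnitalStarAlgebra.elemental.le_of_mem (opUnit_closed e he) h
    (cfcₙHom_mem_elemental hs f)

lemma op_ann_cfc (e s : A) (he : IsSelfAdjoint e) (hs : IsSelfAdjoint s)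
    (h : s ∈ opAnn e he) (f : ℝ → ℝ) : cfcₙ f s ∈ opAnn e he :=
  NonUnitalStarAlgebra.elemental.le_of_mem (opAnn_closed e he) h
    (cfcₙ_mem_elemental f s)

/-- subtract the value at zero -/
noncomputable def opZ (s : A) : C(quasispectrum ℝ s, ℝ) →ₗ[ℝ] C(quasispectrum ℝ s, ℝ)₀ where
  toFun g := ⟨g - ContinuousMap.const _ (g 0), by simp⟩
  map_add' g h := by ext x; simp; ring
  map_smul' c g := by ext x; simp; ring

lemma opZ_apply (s : A) (g : C(quasispectrum ℝ s, ℝ)) (x) : opZ s g x = g x - g 0 := rfl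

/-- the extended functional calculus with unit `e` -/
noncomputable def opPhi (e s : A) (hs : IsSelfAdjoint s) : C(quasispectrum ℝ s, ℝ) →ₗ[ℝ] A where
  toFun g := cfcₙHom hs (opZ s g) + g 0 • e
  map_add' g h := by simp [map_add, add_smul]; abel
  map_smul' c g := by simp [map_smul, mul_smul]

lemma opPhi_apply (e s : A) (hs : IsSelfAdjoint s) (g) :
    opPhi e s hs g = cfcₙHom hs (opZ s g) + g 0 • e := rfl

lemma opPhi_sa (e s : A) (he : IsSelfAdjoint e) (hs : IsSelfAdjoint s) (g) :
    IsSelfAdjoint (opPhi e s hs g) := by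
  rw [opPhi_apply]
  refine IsSelfAdjoint.add ?_ (IsSelfAdjoint.smul (by simp [IsSelfAdjoint]) he)
  rw [IsSelfAdjoint, ← map_star, star_trivial]

lemma opPhi_mul (e s : A) (he : IsSelfAdjoint e) (hs : IsSelfAdjoint s)
    (h : s ∈ opUnit e he) (f g : C(quasispectrum ℝ s, ℝ)) (hfg : f * g = 0) :
    opPhi e s hs f * opPhi e s hs g = 0 := by
  obtain ⟨-, h1⟩ := op_unit_cfc e s he hs h (opZ s f)
  obtain ⟨h2, -⟩ := op_unit_cfc e s he hs h (opZ s g)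
  have h0 : f 0 * g 0 = 0 := congrArg (fun k => k 0) hfg
  rw [opPhi_apply, opPhi_apply, add_mul, mul_add, mul_add, mul_smul_comm, h1, smul_mul_assoc, h2,
    smul_mul_smul_comm, h0, zero_smul, add_zero, ← map_mul, ← map_smul (cfcₙHom hs),
    ← map_smul (cfcₙHom hs), ← map_add, ← map_add]
  convert map_zero (cfcₙHom hs)
  ext x
  have hx : f x * g x = 0 := congrArg (fun k => k x) hfg
  simp only [ContinuousMapZero.coe_add, ContinuousMapZero.coe_mul, ContinuousMapZero.coe_smul, Pi.add_apply, Pi.mul_apply, Pi.smul_apply, opZ_apply, smul_eq_mul, ContinuousMapZero.coe_zero, Pi.zero_apply]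
  linear_combination hx - h0

lemma opPhi_norm (e s : A) (hs : IsSelfAdjoint s) (g : C(quasispectrum ℝ s, ℝ)) :
    ‖opPhi e s hs g‖ ≤ (2 + ‖e‖) * ‖g‖ := by
  rw [opPhi_apply]
  have h0 : ‖g 0‖ ≤ ‖g‖ := g.norm_coe_le_norm 0
  have h1 : ‖cfcₙHom hs (opZ s g)‖ ≤ 2 * ‖g‖ := by
    rw [norm_cfcₙHom s _ hs]
    change ‖g - ContinuousMap.const _ (g 0)‖ ≤ _
    rw [ContinuousMap.norm_le _ (by positivity)]
    intro x
    have := g.norm_coe_le_norm x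
    refine (norm_sub_le _ _).trans ?_
    simp only [ContinuousMap.const_apply]
    linarith
  refine (norm_add_le _ _).trans ?_
  rw [norm_smul]
  nlinarith [norm_nonneg e]

/-- the identity function -/
noncomputable def opId (s : A) : C(quasispectrum ℝ s, ℝ) := ⟨Subtype.val, continuous_subtype_val⟩

lemma opPhi_id (e s : A) (hs : IsSelfAdjoint s) : opPhi e s hs (opId s) = s := by
  rw [opPhi_apply]
  have h0 : opId s 0 = 0 := rfl
  rw [h0, zero_smul, add_zero]
  conv_rhs => rw [← cfcₙHom_id (R := ℝ) hs]
  congr 1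
  ext x
  rw [opZ_apply, h0, sub_zero]; rfl

lemma opPhi_id_sq (e s : A) (hs : IsSelfAdjoint s) : opPhi e s hs (opId s * opId s) = s * s := by
  rw [opPhi_apply]
  have h0 : (opId s * opId s) 0 = 0 := by
    have h0 : opId s 0 = 0 := rfl
    simp [h0]
  rw [h0, zero_smul, add_zero]
  conv_rhs => rw [← cfcₙHom_id (R := ℝ) hs, ← map_mul]
  congr 1
  ext x
  rw [opZ_apply, h0, sub_zero]; rfl

lemma opPhi_one (e s : A) (hs : IsSelfAdjoint s) : opPhi e s hs 1 = e := by
  rw [opPhi_apply]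
  have : opZ s 1 = 0 := by ext x; simp [opZ_apply]
  rw [this]; simp

lemma op_sa_main (T : A →L[ℂ] B)
    (hT : ∀ a b : A, IsSelfAdjoint a → IsSelfAdjoint b →
        IsOrthogonal a b → IsOrthogonal (T a) (T b))
    (e s : A) (he : IsSelfAdjoint e) (hs : IsSelfAdjoint s) (h : s ∈ opUnit e he) :
    T s * star (T s) = T (s * s) * star (T e) ∧ T s * star (T e) = T e * star (T s) ∧
    star (T s) * T s = star (T e) * T (s * s) ∧ star (T e) * T s = star (T s) * T e := by
  set Φ := opPhi e s hs
  have hor : ∀ f g, f * g = 0 → IsOrthogonal (T (Φ f)) (T (Φ g)) := by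
    intro f g hfg
    refine hT _ _ (opPhi_sa e s he hs f) (opPhi_sa e s he hs g) ⟨?_, ?_⟩
    · rw [(opPhi_sa e s he hs g).star_eq]; exact opPhi_mul e s he hs h f g hfg
    · rw [(opPhi_sa e s he hs g).star_eq]; exact opPhi_mul e s he hs h g f (by rw [mul_comm, hfg])
  let V1 : C(quasispectrum ℝ s, ℝ) →ₗ[ℝ] C(quasispectrum ℝ s, ℝ) →ₗ[ℝ] B :=
    LinearMap.mk₂ ℝ (fun f g => T (Φ f) * star (T (Φ g)))
      (by intro f g k; simp [add_mul]) (by intro c f g; simp [smul_mul_assoc])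
      (by intro f g k; simp [mul_add]) (by intro c f g; simp [mul_smul_comm])
  let V2 : C(quasispectrum ℝ s, ℝ) →ₗ[ℝ] C(quasispectrum ℝ s, ℝ) →ₗ[ℝ] B :=
    LinearMap.mk₂ ℝ (fun f g => star (T (Φ g)) * T (Φ f))
      (by intro f g k; simp [mul_add]) (by intro c f g; simp [mul_smul_comm])
      (by intro f g k; simp [add_mul]) (by intro c f g; simp [smul_mul_assoc])
  have hV1 : ∀ f g, V1 f g = T (Φ f) * star (T (Φ g)) := fun _ _ => rfl
  have hV2 : ∀ f g, V2 f g = star (T (Φ g)) * T (Φ f) := fun _ _ => rfl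
  set c := ‖T‖ * (2 + ‖e‖) with hc
  have hc0 : 0 ≤ c := by positivity
  have hb : ∀ f, ‖T (Φ f)‖ ≤ c * ‖f‖ := by
    intro f
    refine (T.le_opNorm _).trans ?_
    rw [hc, mul_assoc]
    gcongr
    exact opPhi_norm e s hs f
  have b1 : ∀ f g, ‖V1 f g‖ ≤ (c * c) * ‖f‖ * ‖g‖ := by
    intro f g
    rw [hV1]
    refine (norm_mul_le _ _).trans ?_
    rw [norm_star]
    calc _ ≤ (c * ‖f‖) * (c * ‖g‖) := mul_le_mul (hb f) (hb g) (norm_nonneg _) (by positivity)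
      _ = _ := by ring
  have b2 : ∀ f g, ‖V2 f g‖ ≤ (c * c) * ‖f‖ * ‖g‖ := by
    intro f g
    rw [hV2]
    refine (norm_mul_le _ _).trans ?_
    rw [norm_star]
    calc _ ≤ (c * ‖g‖) * (c * ‖f‖) := mul_le_mul (hb g) (hb f) (norm_nonneg _) (by positivity)
      _ = _ := by ring
  have o1 : ∀ f g, f * g = 0 → V1 f g = 0 := fun f g hfg => (hor f g hfg).1
  have o2 : ∀ f g, f * g = 0 → V2 f g = 0 := fun f g hfg => (hor f g hfg).2
  have r1 := op_comm_sq V1 _ (by positivity) b1 o1 (opId s)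
  have r2 := op_comm_one V1 _ (by positivity) b1 o1 (opId s)
  have r3 := op_comm_sq V2 _ (by positivity) b2 o2 (opId s)
  have r4 := op_comm_one V2 _ (by positivity) b2 o2 (opId s)
  simp only [hV1, hV2, Φ, opPhi_id, opPhi_id_sq, opPhi_one] at r1 r2 r3 r4
  exact ⟨r1, r2, r3, r4⟩

end opA

section opB
variable {A B : Type*} [NonUnitalCStarAlgebra A] [NonUnitalCStarAlgebra B]

/-- `x ↦ T(x*)*` -/
noncomputable def opS (T : A →L[ℂ] B) : A →ₗ[ℂ] B where
  toFun x := star (T (star x))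
  map_add' x y := by simp
  map_smul' c x := by simp

lemma opS_sa (T : A →L[ℂ] B) {s : A} (hs : IsSelfAdjoint s) : opS T s = star (T s) := by
  change star (T (star s)) = _
  rw [hs.star_eq]

lemma opUnit_smul (e : A) (he : IsSelfAdjoint e) (c : ℂ) {x : A} (hx : x ∈ opUnit e he) :
    c • x ∈ opUnit e he :=
  ⟨by rw [mul_smul_comm, hx.1], by rw [smul_mul_assoc, hx.2]⟩

lemma op_decomp (e : A) (he : IsSelfAdjoint e) {x : A} (hx : x ∈ opUnit e he) :
    ∃ s ∈ opUnit e he, ∃ t ∈ opUnit e he, IsSelfAdjoint s ∧ IsSelfAdjoint t ∧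
      x = s + Complex.I • t := by
  have hsx : star x ∈ opUnit e he := star_mem hx
  refine ⟨realPart x, ?_, imaginaryPart x, ?_, (realPart x).2, (imaginaryPart x).2,
    (realPart_add_I_smul_imaginaryPart x).symm⟩
  · rw [realPart_apply_coe]
    exact SMulMemClass.smul_mem _ (add_mem hx hsx)
  · rw [imaginaryPart_apply_coe]
    have := opUnit_smul e he (-Complex.I)
      (SMulMemClass.smul_mem (2⁻¹ : ℝ) (sub_mem hx hsx))
    exact this

lemma op_all (T : A →L[ℂ] B)
    (hT : ∀ a b : A, IsSelfAdjoint a → IsSelfAdjoint b →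
        IsOrthogonal a b → IsOrthogonal (T a) (T b))
    (e x : A) (he : IsSelfAdjoint e) (hx : x ∈ opUnit e he) :
    T x * opS T x = T (x * x) * star (T e) ∧ T x * star (T e) = T e * opS T x ∧
    opS T x * T x = star (T e) * T (x * x) ∧ star (T e) * T x = opS T x * T e := by
  obtain ⟨s, hs, t, ht, hsa, hta, rfl⟩ := op_decomp e he hx
  obtain ⟨s1, s2, s3, s4⟩ := op_sa_main T hT e s he hsa hs
  obtain ⟨t1, t2, t3, t4⟩ := op_sa_main T hT e t he hta ht
  obtain ⟨u1, -, u3, -⟩ := op_sa_main T hT e (s + t) he (hsa.add hta) (add_mem hs ht)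
  rw [← opS_sa T hsa] at s1 s2 s3 s4
  rw [← opS_sa T hta] at t1 t2 t3 t4
  rw [← opS_sa T (hsa.add hta)] at u1 u3
  simp only [map_add, mul_add, add_mul, s1, t1, s3, t3] at u1 u3
  have v1 : T t * opS T s + T s * opS T t = T (t * s) * star (T e) + T (s * t) * star (T e) := by
    have := sub_eq_zero.mpr u1
    rw [← sub_eq_zero, ← this]; abel
  have v3 : opS T t * T s + opS T s * T t = star (T e) * T (t * s) + star (T e) * T (s * t) := by
    have := sub_eq_zero.mpr u3
    rw [← sub_eq_zero, ← this]; abel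
  have hI : ∀ b : B, Complex.I • Complex.I • b = -b := by
    intro b; rw [smul_smul, Complex.I_mul_I, neg_one_smul]
  have v1' := congrArg (Complex.I • ·) v1
  have v3' := congrArg (Complex.I • ·) v3
  simp only [smul_add] at v1' v3'
  refine ⟨?_, ?_, ?_, ?_⟩
  · simp only [map_add, map_smul, mul_add, add_mul, mul_smul_comm, smul_mul_assoc, smul_add, hI, neg_mul, mul_neg, s1, t1]
    rw [← sub_eq_zero] at v1' ⊢
    rw [← v1']; abel
  · simp only [map_add, map_smul, mul_add, add_mul, mul_smul_comm, smul_mul_assoc, s2, t2]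
  · simp only [map_add, map_smul, mul_add, add_mul, mul_smul_comm, smul_mul_assoc, smul_add, hI, neg_mul, mul_neg, s3, t3]
    rw [← sub_eq_zero] at v3' ⊢
    rw [← v3']; abel
  · simp only [map_add, map_smul, mul_add, add_mul, mul_smul_comm, smul_mul_assoc, s4, t4]

lemma op_triple (T : A →L[ℂ] B)
    (hT : ∀ a b : A, IsSelfAdjoint a → IsSelfAdjoint b →
        IsOrthogonal a b → IsOrthogonal (T a) (T b))
    (e x y : A) (he : IsSelfAdjoint e) (hx : x ∈ opUnit e he) (hy : y ∈ opUnit e he) :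
    T x * opS T y * T x = T e * star (T e) * T (x * y * x) := by
  have p1 : ∀ u ∈ opUnit e he, ∀ v ∈ opUnit e he,
      T u * opS T v + T v * opS T u = T (u * v + v * u) * star (T e) := by
    intro u hu v hv
    have h1 := (op_all T hT e u he hu).1
    have h2 := (op_all T hT e v he hv).1
    have h3 := (op_all T hT e (u + v) he (add_mem hu hv)).1
    simp only [map_add, mul_add, add_mul, h1, h2] at h3 ⊢
    rw [← sub_eq_zero] at h3 ⊢
    rw [← h3]; abel
  have p2 : ∀ u ∈ opUnit e he, ∀ v ∈ opUnit e he,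
      opS T u * T v + opS T v * T u = star (T e) * T (u * v + v * u) := by
    intro u hu v hv
    have h1 := (op_all T hT e u he hu).2.2.1
    have h2 := (op_all T hT e v he hv).2.2.1
    have h3 := (op_all T hT e (u + v) he (add_mem hu hv)).2.2.1
    simp only [map_add, mul_add, add_mul, h1, h2] at h3 ⊢
    rw [← sub_eq_zero] at h3 ⊢
    rw [← h3]; abel
  set h := T e with hh
  have p3 : ∀ u ∈ opUnit e he, ∀ v ∈ opUnit e he,
      T u * star h * T v + T v * star h * T u = h * star h * T (u * v + v * u) := by
    intro u hu v hv
    rw [(op_all T hT e u he hu).2.1, (op_all T hT e v he hv).2.1, mul_assoc, mul_assoc, ← mul_add,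
      p2 u hu v hv, ← mul_assoc]
  have hxy : x * y + y * x ∈ opUnit e he := add_mem (mul_mem hx hy) (mul_mem hy hx)
  have hxx : x * x ∈ opUnit e he := mul_mem hx hx
  have q1 : T x * opS T y * T x = T (x * y + y * x) * star h * T x - T y * star h * T (x * x) := by
    rw [← p1 x hx y hy, add_mul, mul_assoc (T y) (opS T x), (op_all T hT e x he hx).2.2.1,
      ← mul_assoc (T y)]
    abel
  have q2 : T x * opS T y * T x = T x * star h * T (x * y + y * x) - T (x * x) * star h * T y := by
    rw [mul_assoc (T x) (star h), ← p2 x hx y hy, mul_add, ← mul_assoc, ← mul_assoc,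
      (op_all T hT e x he hx).1]
    abel
  have r1 := p3 _ hxy x hx
  have r2 := p3 _ hxx y hy
  have key : (2 : ℂ) • (T x * opS T y * T x) = (2 : ℂ) • (h * star h * T (x * y * x)) := by
    rw [two_smul]
    nth_rewrite 1 [q1]
    rw [q2]
    calc _ = (T (x * y + y * x) * star h * T x + T x * star h * T (x * y + y * x)) -
          (T (x * x) * star h * T y + T y * star h * T (x * x)) := by abel
      _ = _ := by
        rw [r1, r2, ← mul_sub, ← map_sub, ← mul_smul_comm, ← map_smul]
        congr 2
        rw [two_smul]
        noncomm_ring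
  have h2 : (2 : ℂ) ≠ 0 := two_ne_zero
  exact (smul_right_inj h2).mp key

lemma op_triple_lin (T : A →L[ℂ] B)
    (hT : ∀ a b : A, IsSelfAdjoint a → IsSelfAdjoint b →
        IsOrthogonal a b → IsOrthogonal (T a) (T b))
    (e x y z : A) (he : IsSelfAdjoint e) (hx : x ∈ opUnit e he) (hy : y ∈ opUnit e he)
    (hz : z ∈ opUnit e he) :
    T x * opS T y * T z + T z * opS T y * T x = T e * star (T e) * T (x * y * z + z * y * x) := by
  have h1 := op_triple T hT e x y he hx hy
  have h2 := op_triple T hT e z y he hz hy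
  have h3 := op_triple T hT e (x + z) y he (add_mem hx hz) hy
  simp only [map_add, mul_add, add_mul, h1, h2] at h3 ⊢
  rw [← sub_eq_zero] at h3 ⊢
  rw [← h3]; abel

lemma op_triple_norm (T : A →L[ℂ] B)
    (hT : ∀ a b : A, IsSelfAdjoint a → IsSelfAdjoint b →
        IsOrthogonal a b → IsOrthogonal (T a) (T b))
    (e x y : A) (he : IsSelfAdjoint e) (he1 : ‖e‖ ≤ 1) (hx : x ∈ opUnit e he)
    (hy : y ∈ opUnit e he) :
    ‖T x * star (T x) * T y + T y * star (T x) * T x‖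
      ≤ ‖T‖ ^ 3 * ‖x * star x * y + y * star x * x‖ := by
  have h := op_triple_lin T hT e x (star x) y he hx (star_mem hx) hy
  have hS : opS T (star x) = star (T x) := by
    change star (T (star (star x))) = _
    rw [star_star]
  rw [hS] at h
  rw [h]
  have hh : ‖T e‖ ≤ ‖T‖ := by
    refine (T.le_opNorm e).trans ?_
    nlinarith [norm_nonneg T]
  calc _ ≤ ‖T e‖ * ‖star (T e)‖ * ‖T (x * star x * y + y * star x * x)‖ := norm_mul₃_le
    _ ≤ ‖T‖ * ‖T‖ * (‖T‖ * ‖x * star x * y + y * star x * x‖) := by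
      rw [norm_star]; gcongr; exact T.le_opNorm _
    _ = _ := by ring

lemma op_orth_of_triple (p q : B) (h : p * star p * q + q * star p * p = 0) :
    IsOrthogonal p q := by
  letI := CStarAlgebra.spectralOrder B
  haveI := CStarAlgebra.spectralOrderedRing B
  have h1 : star q * q * (star p * p) = - (star (star p * q) * (star p * q)) := by
    rw [eq_neg_iff_add_eq_zero]
    have := congrArg (star q * ·) h
    simp only [mul_zero] at this
    rw [← this, star_mul, star_star]
    noncomm_ring
  have hc : Commute (star q * q) (star p * p) := by
    have := congrArg star h1
    simp only [star_neg, star_mul, star_star] at this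
    rw [Commute, SemiconjBy, h1, this]
    simp only [star_mul, star_star]
  have hp := Commute.mul_nonneg (star_mul_self_nonneg q) (star_mul_self_nonneg p) hc
  rw [h1] at hp
  have h0 : star (star p * q) * (star p * q) = 0 :=
    le_antisymm (neg_nonneg.mp hp) (star_mul_self_nonneg _)
  have h2 : star p * q = 0 := CStarRing.star_mul_self_eq_zero_iff _ |>.mp h0
  have h3 : q * star p * p = 0 := by
    rw [mul_assoc, h2, mul_zero, zero_add] at h
    exact h
  have h4 : q * star p = 0 := by
    rw [← CStarRing.mul_star_self_eq_zero_iff, star_mul, star_star, ← mul_assoc, h3, zero_mul]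
  constructor
  · have := congrArg star h4
    simpa using this
  · have := congrArg star h2
    simpa using this

lemma op_approx (a b : A) : ∃ l : Filter (A × A × A), l.NeBot ∧
    (∀ᶠ w in l, ∃ he : IsSelfAdjoint w.1, ‖w.1‖ ≤ 1 ∧ w.2.1 ∈ opUnit w.1 he ∧
      w.2.2 ∈ opUnit w.1 he) ∧
    Filter.Tendsto (fun w => w.2) l (nhds (a, b)) := by
  letI := CStarAlgebra.spectralOrder A
  haveI := CStarAlgebra.spectralOrderedRing A
  have key : ∀ ε > 0, ∃ e x y : A, ∃ he : IsSelfAdjoint e, ‖e‖ ≤ 1 ∧ x ∈ opUnit e he ∧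
      y ∈ opUnit e he ∧ ‖x - a‖ ≤ ε ∧ ‖y - b‖ ≤ ε := by
    intro ε hε
    have hl := CStarAlgebra.increasingApproximateUnit A
    haveI := hl.neBot
    set δ : ℝ := ε / (4 * (‖a‖ + ‖b‖ + 1)) with hδ
    have hD : 0 < 4 * (‖a‖ + ‖b‖ + 1) := by positivity
    have hδ0 : 0 < δ := by positivity
    have hδm : δ * (4 * (‖a‖ + ‖b‖ + 1)) = ε := by rw [hδ]; field_simp
    have t1 : ∀ c : A, ∀ᶠ p in CStarAlgebra.approximateUnit A, ‖p * c - c‖ ≤ ε / 4 ∧ ‖c * p - c‖ ≤ ε / 4 := by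
      intro c
      have h1 := (hl.tendsto_mul_right c).eventually (Metric.closedBall_mem_nhds c (by positivity : 0 < ε / 4))
      have h2 := (hl.tendsto_mul_left c).eventually (Metric.closedBall_mem_nhds c (by positivity : 0 < ε / 4))
      filter_upwards [h1, h2] with p h1 h2
      simp only [Metric.mem_closedBall, dist_eq_norm] at h1 h2
      exact ⟨h1, h2⟩
    obtain ⟨p, hpa, hpb, hp0, hp1⟩ :=
      ((t1 a).and ((t1 b).and (hl.eventually_nonneg.and hl.eventually_norm))).exists
    have hps : IsSelfAdjoint p := hp0.isSelfAdjoint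
    have hq0 : ∀ t ∈ quasispectrum ℝ p, 0 ≤ t := fun t ht => quasispectrum_nonneg_of_nonneg p hp0 t ht
    set g : ℝ → ℝ := fun t => max (t - δ) 0 with hg
    set f : ℝ → ℝ := fun t => max (min (t / δ) 1) 0 with hf
    have hgc : Continuous g := by fun_prop
    have hfc : Continuous f := by fun_prop
    have hg0 : g 0 = 0 := by simp [hg, hδ0.le]
    have hf0 : f 0 = 0 := by simp [hf]
    set e := cfcₙ f p with he_def
    set k := cfcₙ g p with hk_def
    have he : IsSelfAdjoint e := cfcₙ_predicate f p
    have hfg : ∀ t, f t * g t = g t := by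
      intro t
      simp only [hf, hg]
      rcases le_total t δ with h | h
      · rw [max_eq_right (by linarith : t - δ ≤ 0)]; simp
      · rw [min_eq_right ((one_le_div hδ0).mpr h)]; simp
    have hek : e * k = k := by
      rw [he_def, hk_def, ← cfcₙ_mul f g p hfc.continuousOn hf0 hgc.continuousOn hg0]
      simp only [hfg]
    have hke : k * e = k := by
      rw [he_def, hk_def, ← cfcₙ_mul g f p hgc.continuousOn hg0 hfc.continuousOn hf0]
      simp only [mul_comm (g _), hfg]
    have hkp : ‖k - p‖ ≤ δ := by
      have hid : cfcₙ (fun t : ℝ => t) p = p := cfcₙ_id' ℝ p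
      have : k - p = cfcₙ (fun t => g t - t) p := by
        rw [cfcₙ_sub g (fun t => t) p hgc.continuousOn hg0 continuousOn_id rfl, hid]
      rw [this]
      refine norm_cfcₙ_le fun t ht => ?_
      have := hq0 t ht
      simp only [hg]
      rw [Real.norm_eq_abs, abs_le]
      rcases le_total t δ with h | h
      · rw [max_eq_right (by linarith : t - δ ≤ 0)]; constructor <;> linarith
      · rw [max_eq_left (by linarith : 0 ≤ t - δ)]; constructor <;> linarith
    have he1 : ‖e‖ ≤ 1 := by
      refine norm_cfcₙ_le fun t ht => ?_
      simp only [hf]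
      rw [Real.norm_eq_abs, abs_of_nonneg (le_max_right _ _)]
      exact max_le (min_le_right _ _) zero_le_one
    have hk1 : ‖k‖ ≤ 1 := by
      refine norm_cfcₙ_le fun t ht => ?_
      simp only [hg]
      rw [Real.norm_eq_abs, abs_of_nonneg (le_max_right _ _)]
      have h1 : ‖t‖ ≤ ‖cfcₙ (fun t : ℝ => t) p‖ :=
        norm_apply_le_norm_cfcₙ (fun t : ℝ => t) p ht
      rw [cfcₙ_id' ℝ p] at h1
      have := le_abs_self t
      rw [Real.norm_eq_abs] at h1
      exact max_le (by linarith) zero_le_one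
    have hmem : ∀ c, k * c * k ∈ opUnit e he := fun c =>
      ⟨by rw [← mul_assoc, ← mul_assoc, hek], by rw [mul_assoc, hke]⟩
    have hest : ∀ c : A, ‖c‖ ≤ ‖a‖ + ‖b‖ → ‖p * c - c‖ ≤ ε / 4 → ‖c * p - c‖ ≤ ε / 4 →
        ‖k * c * k - c‖ ≤ ε := by
      intro c hc h1 h2
      have : k * c * k - c = k * c * (k - p) + k * (c * p - c) + (k - p) * c + (p * c - c) := by
        noncomm_ring
      rw [this]
      have a1 : ‖k * c * (k - p)‖ ≤ 1 * (‖a‖ + ‖b‖) * δ := by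
        refine norm_mul₃_le.trans ?_
        gcongr
      have a2 : ‖k * (c * p - c)‖ ≤ 1 * (ε / 4) := (norm_mul_le _ _).trans (by gcongr)
      have a3 : ‖(k - p) * c‖ ≤ δ * (‖a‖ + ‖b‖) := (norm_mul_le _ _).trans (by gcongr)
      have a4 := norm_add_le (k * c * (k - p) + k * (c * p - c) + (k - p) * c) (p * c - c)
      have a5 := norm_add₃_le (a := k * c * (k - p)) (b := k * (c * p - c)) (c := (k - p) * c)
      linarith
    exact ⟨e, k * a * k, k * b * k, he, he1, hmem a, hmem b,
      hest a (by linarith [norm_nonneg b]) hpa.1 hpa.2,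
      hest b (by linarith [norm_nonneg a]) hpb.1 hpb.2⟩
  have hpos : ∀ n : ℕ, (0 : ℝ) < ((n : ℝ) + 1)⁻¹ := fun n => by positivity
  choose e x y he h1 h2 h3 h4 h5 using fun n : ℕ => key ((n : ℝ) + 1)⁻¹ (hpos n)
  have hlim : Filter.Tendsto (fun n : ℕ => ((n : ℝ) + 1)⁻¹) Filter.atTop (nhds 0) := by
    simpa using tendsto_one_div_add_atTop_nhds_zero_nat (𝕜 := ℝ)
  refine ⟨Filter.map (fun n => (e n, x n, y n)) Filter.atTop, inferInstance, ?_, ?_⟩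
  · rw [Filter.eventually_map]
    exact Filter.Eventually.of_forall fun n => ⟨he n, h1 n, h2 n, h3 n⟩
  · rw [Filter.tendsto_map'_iff]
    refine Filter.Tendsto.prodMk_nhds ?_ ?_
    · rw [tendsto_iff_norm_sub_tendsto_zero]
      exact squeeze_zero (fun _ => norm_nonneg _) h4 hlim
    · rw [tendsto_iff_norm_sub_tendsto_zero]
      exact squeeze_zero (fun _ => norm_nonneg _) h5 hlim

lemma op_two_one (T : A →L[ℂ] B)
    (hT : ∀ a b : A, IsSelfAdjoint a → IsSelfAdjoint b →
        IsOrthogonal a b → IsOrthogonal (T a) (T b)) (a b : A) (hab : IsOrthogonal a b) :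
    IsOrthogonal (T a) (T b) := by
  apply op_orth_of_triple
  obtain ⟨l, hl, hev, hlim⟩ := op_approx a b
  have hF : Continuous (fun w : A × A =>
    ‖T w.1 * star (T w.1) * T w.2 + T w.2 * star (T w.1) * T w.1‖) := by fun_prop
  have hG : Continuous (fun w : A × A =>
    ‖T‖ ^ 3 * ‖w.1 * star w.1 * w.2 + w.2 * star w.1 * w.1‖) := by fun_prop
  have h1 := (hF.tendsto (a, b)).comp hlim
  have h2 := (hG.tendsto (a, b)).comp hlim
  have := le_of_tendsto_of_tendsto h1 h2 (by
    filter_upwards [hev] with w hw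
    obtain ⟨he, he1, hx, hy⟩ := hw
    exact op_triple_norm T hT w.1 w.2.1 w.2.2 he he1 hx hy)
  have s1 : b * star a = 0 := by simpa using congrArg star hab.1
  have s2 : star a * b = 0 := by simpa using congrArg star hab.2
  simp only [s1, mul_assoc a, s2, mul_zero, zero_mul, add_zero, norm_zero] at this
  exact norm_le_zero_iff.mp this

lemma op_three_two (T : A →L[ℂ] B)
    (hT : ∀ a b : A, (∃ c : A, a = star c * c) → (∃ d : A, b = star d * d) →
        IsOrthogonal a b → IsOrthogonal (T a) (T b)) (a b : A) (ha : IsSelfAdjoint a)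
    (hb : IsSelfAdjoint b) (hab : IsOrthogonal a b) :
    IsOrthogonal (T a) (T b) := by
  letI := CStarAlgebra.spectralOrder A
  haveI := CStarAlgebra.spectralOrderedRing A
  have hba : b ∈ opAnn a ha := by
    obtain ⟨h1, h2⟩ := hab
    rw [hb.star_eq] at h1 h2
    exact ⟨h1, h2⟩
  have hpos : ∀ x y : A, 0 ≤ x → 0 ≤ y → x * y = 0 → y * x = 0 → IsOrthogonal (T x) (T y) := by
    intro x y hx hy h1 h2
    refine hT x y (CStarAlgebra.nonneg_iff_eq_star_mul_self.mp hx)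
      (CStarAlgebra.nonneg_iff_eq_star_mul_self.mp hy) ⟨?_, ?_⟩
    · rw [hy.isSelfAdjoint.star_eq, h1]
    · rw [hy.isSelfAdjoint.star_eq, h2]
  have hann : ∀ f g : ℝ → ℝ, cfcₙ f a * cfcₙ g b = 0 ∧ cfcₙ g b * cfcₙ f a = 0 := by
    intro f g
    have h1 := op_ann_cfc a b ha hb hba g
    have hgs : IsSelfAdjoint (cfcₙ g b) := cfcₙ_predicate g b
    have h2 : a ∈ opAnn (cfcₙ g b) hgs := ⟨h1.2, h1.1⟩
    have h3 := op_ann_cfc _ a hgs ha h2 f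
    exact ⟨h3.2, h3.1⟩
  have pp : IsOrthogonal (T a⁺) (T b⁺) := hpos _ _ (CFC.posPart_nonneg a) (CFC.posPart_nonneg b)
    (hann _ _).1 (hann _ _).2
  have pn : IsOrthogonal (T a⁺) (T b⁻) := hpos _ _ (CFC.posPart_nonneg a) (CFC.negPart_nonneg b)
    (hann _ _).1 (hann _ _).2
  have np : IsOrthogonal (T a⁻) (T b⁺) := hpos _ _ (CFC.negPart_nonneg a) (CFC.posPart_nonneg b)
    (hann _ _).1 (hann _ _).2
  have nn : IsOrthogonal (T a⁻) (T b⁻) := hpos _ _ (CFC.negPart_nonneg a) (CFC.negPart_nonneg b)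
    (hann _ _).1 (hann _ _).2
  rw [← CFC.posPart_sub_negPart a ha, ← CFC.posPart_sub_negPart b hb, map_sub, map_sub]
  constructor
  · rw [star_sub, sub_mul, mul_sub, mul_sub, pp.1, pn.1, np.1, nn.1]; simp
  · rw [star_sub, sub_mul, mul_sub, mul_sub, pp.2, pn.2, np.2, nn.2]; simp

end opB

/-- A bounded linear operator between C*-algebras is orthogonality preserving iff it is
orthogonality preserving on self-adjoint elements, iff it is orthogonality preserving on
positive elements. -/
theorem orthogonality_preserving_tfae {A B : Type*}
    [NonUnitalCStarAlgebra A] [NonUnitalCStarAlgebra B] (T : A →L[ℂ] B) :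
    List.TFAE [
      ∀ a b : A, IsOrthogonal a b → IsOrthogonal (T a) (T b),
      ∀ a b : A, IsSelfAdjoint a → IsSelfAdjoint b →
        IsOrthogonal a b → IsOrthogonal (T a) (T b),
      ∀ a b : A, (∃ c : A, a = star c * c) → (∃ d : A, b = star d * d) →
        IsOrthogonal a b → IsOrthogonal (T a) (T b)] := by
  tfae_have 1 → 2 := fun h a b _ _ hab => h a b hab
  tfae_have 2 → 3 := by
    rintro h a b ⟨c, rfl⟩ ⟨d, rfl⟩ hab
    exact h _ _ (IsSelfAdjoint.star_mul_self c) (IsSelfAdjoint.star_mul_self d) hab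
  tfae_have 3 → 2 := fun h => op_three_two T h
  tfae_have 2 → 1 := fun h => op_two_one T h
  tfae_finish
end

section
/- Let T : A → B be an orthogonality preserving bounded linear operator between C*-algebras. Then the kernel of T is a norm-closed two-sided ideal of A which is self-adjoint, i.e., x ∈ ker T implies x* ∈ ker T. -/
open Filter Topology in
/-- pointwise description of clamped pieces -/
theorem piece_eq (p : ℝ → ℝ) (θ δ : ℝ) (hδ : 0 < δ) (hp : ∀ k : ℤ, p (θ + δ * k) = 0)
    (x : ℝ) (m k : ℤ) (h1 : θ + δ * m ≤ x) (h2 : x ≤ θ + δ * (m + 1)) :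
    p (max (θ + δ * k) (min x (θ + δ * (k + 1)))) = if k = m then p x else 0 := by
  split_ifs with h
  · subst h
    rw [min_eq_left h2, max_eq_right h1]
  · rcases lt_or_gt_of_ne h with h | h
    · have h3 : ((k : ℝ) + 1) ≤ m := by exact_mod_cast h
      have h4 : θ + δ * (k + 1) ≤ x := by nlinarith
      rw [min_eq_right h4, max_eq_right (by nlinarith)]
      have := hp (k + 1)
      push_cast at this
      exact this
    · have h3 : ((m : ℝ) + 1) ≤ k := by exact_mod_cast h
      have h4 : x ≤ θ + δ * k := by nlinarith
      rw [max_eq_left ((min_le_left _ _).trans h4)]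
      exact hp k

theorem exists_cell (θ δ : ℝ) (hδ : 0 < δ) (x : ℝ) :
    ∃ m : ℤ, θ + δ * m ≤ x ∧ x < θ + δ * (m + 1) := by
  refine ⟨⌊(x - θ) / δ⌋, ?_, ?_⟩
  · have := Int.floor_le ((x - θ) / δ)
    rw [le_div_iff₀ hδ] at this
    linarith
  · have := Int.lt_floor_add_one ((x - θ) / δ)
    rw [div_lt_iff₀ hδ] at this
    linarith

theorem lattice_estimate {U E : Type*} [CStarAlgebra U] [NormedAddCommGroup E] [NormedSpace ℂ E]
    (ψ : U →L[ℂ] U →L[ℂ] E) (a : U) (ha : IsSelfAdjoint a)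
    (h : ∀ f g : U, Commute f a → Commute g a → f * g = 0 → g * f = 0 → ψ f g = 0)
    (θ δ : ℝ) (hδ : 0 < δ) (p q : ℝ → ℝ) (hpc : Continuous p) (hqc : Continuous q)
    (hp1 : ∀ x, |p x| ≤ 1) (hq1 : ∀ x, |q x| ≤ 1)
    (hp : ∀ k : ℤ, p (θ + δ * k) = 0) (hq : ∀ k : ℤ, q (θ + δ * k) = 0) :
    ‖ψ (cfc (fun x : ℝ => x * p x) a) (cfc q a) - ψ (cfc p a) (cfc (fun x : ℝ => x * q x) a)‖
      ≤ 2 * ‖ψ‖ * δ := by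
  -- a finite range of cells covering the spectrum
  obtain ⟨N, hN⟩ : ∃ N : ℕ, ‖a‖ * ‖(1 : U)‖ + |θ| ≤ δ * N := by
    obtain ⟨N, hN⟩ := exists_nat_ge ((‖a‖ * ‖(1 : U)‖ + |θ|) / δ)
    exact ⟨N, by rw [div_le_iff₀ hδ] at hN; linarith⟩
  set S : Finset ℤ := Finset.Icc (-(N : ℤ) - 1) N with hS
  have hcell : ∀ x ∈ spectrum ℝ a, ∃ m ∈ S, θ + δ * (m : ℤ) ≤ x ∧ x < θ + δ * ((m : ℤ) + 1) := by
    intro x hx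
    obtain ⟨m, h1, h2⟩ := exists_cell θ δ hδ x
    refine ⟨m, ?_, h1, h2⟩
    have hxn : |x| ≤ ‖a‖ * ‖(1 : U)‖ := spectrum.norm_le_norm_mul_of_mem hx
    have h3 := abs_le.mp hxn
    have h4 := abs_le.mp (le_refl |θ|)
    rw [hS, Finset.mem_Icc]
    constructor
    · have : (-(N : ℝ)) < m + 1 := by
        by_contra hcon
        push Not at hcon
        nlinarith
      have : (-(N : ℤ)) < m + 1 := by exact_mod_cast this
      omega
    · have : (m : ℝ) ≤ N := by
        by_contra hcon
        push Not at hcon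
        nlinarith
      exact_mod_cast this
  let pc : (ℝ → ℝ) → ℤ → ℝ → ℝ := fun p k x => p (max (θ + δ * k) (min x (θ + δ * (k + 1))))
  have pcc : ∀ p, Continuous p → ∀ k, Continuous (pc p k) := by
    intro p hpc k
    exact hpc.comp (by fun_prop)
  -- decomposition
  have hsum : ∀ p : ℝ → ℝ, Continuous p → (∀ k : ℤ, p (θ + δ * k) = 0) →
      cfc p a = ∑ k ∈ S, cfc (pc p k) a := by
    intro p hpc hp
    rw [← cfc_sum (fun k => pc p k) a S (fun k _ => (pcc p hpc k).continuousOn)]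
    apply cfc_congr
    intro x hx
    obtain ⟨m, hm, h1, h2⟩ := hcell x hx
    rw [Finset.sum_apply, Finset.sum_congr rfl
      (fun k _ => piece_eq p θ δ hδ hp x m k h1 h2.le)]
    simp [hm]
  have hdiff : ∀ p : ℝ → ℝ, Continuous p → (∀ x, |p x| ≤ 1) → (∀ k : ℤ, p (θ + δ * k) = 0) →
      ‖cfc (fun x : ℝ => x * p x) a - ∑ k ∈ S, ((θ + δ * k : ℝ) : ℂ) • cfc (pc p k) a‖ ≤ δ := by
    intro p hpc hp1 hp
    have e1 : ∀ k ∈ S, ((θ + δ * k : ℝ) : ℂ) • cfc (pc p k) a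
        = cfc (fun x => (θ + δ * k : ℝ) * pc p k x) a := by
      intro k _
      rw [cfc_const_mul _ _ a (pcc p hpc k).continuousOn]
      exact (RCLike.real_smul_eq_coe_smul (K := ℂ) _ _).symm
    rw [Finset.sum_congr rfl e1, ← cfc_sum (fun (k : ℤ) x => (θ + δ * k : ℝ) * pc p k x) a S
      (fun k _ => (continuous_const.mul (pcc p hpc k)).continuousOn)]
    rw [← cfc_sub _ _ a (by fun_prop) (by
      apply Continuous.continuousOn
      have : ∀ k ∈ S, Continuous (fun x => (θ + δ * (k : ℤ) : ℝ) * pc p k x) :=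
        fun k _ => continuous_const.mul (pcc p hpc k)
      convert continuous_finsetSum S this using 1
      ext x
      simp)]
    apply norm_cfc_le hδ.le
    intro x hx
    obtain ⟨m, hm, h1, h2⟩ := hcell x hx
    rw [Finset.sum_apply, Finset.sum_congr rfl
      (fun k _ => by
        show _ = (θ + δ * k) * (if k = m then p x else 0)
        rw [← piece_eq p θ δ hδ hp x m k h1 h2.le])]
    simp only [mul_ite, mul_zero, Finset.sum_ite_eq', hm, if_true]
    rw [← sub_mul, Real.norm_eq_abs, abs_mul]
    have : |x - (θ + δ * m)| ≤ δ := by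
      rw [abs_le]; constructor <;> nlinarith
    calc _ ≤ δ * 1 := mul_le_mul this (hp1 x) (abs_nonneg _) hδ.le
      _ = δ := mul_one _
  have hcomm : ∀ f : ℝ → ℝ, Commute (cfc f a) a := by
    intro f
    have := cfc_commute_cfc f (id : ℝ → ℝ) a
    rwa [cfc_id ℝ a] at this
  have hoff : ∀ k j : ℤ, k ≠ j → ψ (cfc (pc p k) a) (cfc (pc q j) a) = 0 := by
    intro k j hkj
    suffices hz : cfc (pc p k) a * cfc (pc q j) a = 0 from
      h _ _ (hcomm _) (hcomm _) hz (by rw [(cfc_commute_cfc _ _ a).eq, hz])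
    rw [← cfc_mul _ _ a (pcc p hpc k).continuousOn (pcc q hqc j).continuousOn]
    rw [← cfc_zero (R := ℝ) a]
    apply cfc_congr
    intro x hx
    obtain ⟨m, hm, h1, h2⟩ := hcell x hx
    have e1 : pc p k x = if k = m then p x else 0 := piece_eq p θ δ hδ hp x m k h1 h2.le
    have e2 : pc q j x = if j = m then q x else 0 := piece_eq q θ δ hδ hq x m j h1 h2.le
    simp only [e1, e2]
    by_cases hk : k = m
    · have : j ≠ m := fun hj => hkj (hk.trans hj.symm)
      simp [this]
    · simp [hk]
  have hmid : ψ (∑ k ∈ S, ((θ + δ * k : ℝ) : ℂ) • cfc (pc p k) a) (cfc q a)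
      = ψ (cfc p a) (∑ k ∈ S, ((θ + δ * k : ℝ) : ℂ) • cfc (pc q k) a) := by
    rw [hsum p hpc hp, hsum q hqc hq]
    simp only [map_sum, sum_apply, map_smul, smul_apply]
    apply Finset.sum_congr rfl
    intro j hj
    rw [Finset.smul_sum]
    apply Finset.sum_congr rfl
    intro k hk
    by_cases hkj : k = j
    · rw [hkj]
    · rw [hoff k j hkj, smul_zero, smul_zero]
  have hn : ∀ p : ℝ → ℝ, (∀ x, |p x| ≤ 1) → ‖cfc p a‖ ≤ 1 := fun p hp1 =>
    norm_cfc_le zero_le_one (fun x _ => hp1 x)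
  set X := cfc (fun x : ℝ => x * p x) a
  set Y := cfc (fun x : ℝ => x * q x) a
  set X' := ∑ k ∈ S, ((θ + δ * k : ℝ) : ℂ) • cfc (pc p k) a
  set Y' := ∑ k ∈ S, ((θ + δ * k : ℝ) : ℂ) • cfc (pc q k) a
  have key : ψ X (cfc q a) - ψ (cfc p a) Y = ψ (X - X') (cfc q a) - ψ (cfc p a) (Y - Y') := by
    rw [map_sub, map_sub, sub_apply, hmid]
    abel
  rw [key]
  have b1 : ‖ψ (X - X') (cfc q a)‖ ≤ ‖ψ‖ * δ * 1 := by
    refine (ψ.le_opNorm₂ _ _).trans ?_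
    gcongr
    · exact hdiff p hpc hp1 hp
    · exact hn q hq1
  have b2 : ‖ψ (cfc p a) (Y - Y')‖ ≤ ‖ψ‖ * 1 * δ := by
    refine (ψ.le_opNorm₂ _ _).trans ?_
    gcongr
    · exact hn p hp1
    · exact hdiff q hqc hq1 hq
  refine (norm_sub_le _ _).trans ?_
  linarith

/-- the three trigonometric interpolation functions -/
noncomputable def trig3 (n : ℕ) (c : Fin 3) (x : ℝ) : ℝ :=
  (1 + 2 * Real.cos (2 * Real.pi * ((n + 1) * x - (c : ℕ)) / 3)) / 3

theorem cos_third : Real.cos (2 * Real.pi / 3) = -1 / 2 := by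
  rw [show 2 * Real.pi / 3 = Real.pi - Real.pi / 3 by ring, Real.cos_pi_sub, Real.cos_pi_div_three]
  norm_num

theorem trig3_abs (n : ℕ) (c : Fin 3) (x : ℝ) : |trig3 n c x| ≤ 1 := by
  unfold trig3
  have h1 := Real.cos_le_one (2 * Real.pi * ((n + 1) * x - (c : ℕ)) / 3)
  have h2 := Real.neg_one_le_cos (2 * Real.pi * ((n + 1) * x - (c : ℕ)) / 3)
  rw [abs_le]; constructor <;> linarith

theorem trig3_cont (n : ℕ) (c : Fin 3) : Continuous (trig3 n c) := by
  unfold trig3; fun_prop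

theorem trig3_sum (n : ℕ) (x : ℝ) : ∑ c, trig3 n c x = 1 := by
  have hs : Real.sin (2 * Real.pi / 3 * 2) = - Real.sin (2 * Real.pi / 3) := by
    rw [show 2 * Real.pi / 3 * 2 = 2 * Real.pi - 2 * Real.pi / 3 by ring, Real.sin_two_pi_sub]
  have hc : Real.cos (2 * Real.pi / 3 * 2) = -1 / 2 := by
    rw [show 2 * Real.pi / 3 * 2 = 2 * Real.pi - 2 * Real.pi / 3 by ring, Real.cos_two_pi_sub,
      cos_third]
  rw [Fin.sum_univ_three]
  unfold trig3
  set t := 2 * Real.pi * ((n + 1) * x) / 3 with ht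
  have e0 : 2 * Real.pi * ((n + 1) * x - ((0 : Fin 3) : ℕ)) / 3 = t := by simp [ht]
  have e1 : 2 * Real.pi * ((n + 1) * x - ((1 : Fin 3) : ℕ)) / 3 = t - 2 * Real.pi / 3 := by
    simp [ht]; ring
  have e2 : 2 * Real.pi * ((n + 1) * x - ((2 : Fin 3) : ℕ)) / 3 = t - 2 * Real.pi / 3 * 2 := by
    simp [ht]; ring
  rw [e0, e1, e2, Real.cos_sub, Real.cos_sub, hs, hc, cos_third]
  ring

theorem trig3_zero (n : ℕ) (c r : Fin 3) (h : c ≠ r) (k : ℤ) :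
    trig3 n c ((r : ℕ) / (n + 1 : ℝ) + (3 / (n + 1 : ℝ)) * k) = 0 := by
  have hn : (n + 1 : ℝ) ≠ 0 := by positivity
  have e : 2 * Real.pi * ((n + 1) * (((r : ℕ) : ℝ) / (n + 1 : ℝ) + (3 / (n + 1 : ℝ)) * k)
      - ((c : ℕ) : ℝ)) / 3 = 2 * Real.pi / 3 * (((r : ℕ) : ℝ) - ((c : ℕ) : ℝ)) + k * (2 * Real.pi) := by
    field_simp
    ring
  unfold trig3
  rw [e, Real.cos_add_int_mul_two_pi]
  have hc : Real.cos (2 * Real.pi / 3 * 2) = -1 / 2 := by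
    rw [show 2 * Real.pi / 3 * 2 = 2 * Real.pi - 2 * Real.pi / 3 by ring, Real.cos_two_pi_sub,
      cos_third]
  have key : Real.cos (2 * Real.pi / 3 * (((r : ℕ) : ℝ) - ((c : ℕ) : ℝ))) = -1 / 2 := by
    have : (((r : ℕ) : ℝ) - ((c : ℕ) : ℝ)) = 1 ∨ (((r : ℕ) : ℝ) - ((c : ℕ) : ℝ)) = -1 ∨
        (((r : ℕ) : ℝ) - ((c : ℕ) : ℝ)) = 2 ∨ (((r : ℕ) : ℝ) - ((c : ℕ) : ℝ)) = -2 := by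
      fin_cases c <;> fin_cases r <;> simp at h ⊢ <;> norm_num
    rcases this with h | h | h | h <;> rw [h]
    · rw [mul_one, cos_third]
    · rw [mul_neg, Real.cos_neg, mul_one, cos_third]
    · exact hc
    · rw [mul_neg, Real.cos_neg, hc]
  rw [key]; norm_num

theorem lemma_D {U E : Type*} [CStarAlgebra U] [NormedAddCommGroup E] [NormedSpace ℂ E]
    (ψ : U →L[ℂ] U →L[ℂ] E) (a : U) (ha : IsSelfAdjoint a)
    (h : ∀ f g : U, Commute f a → Commute g a → f * g = 0 → g * f = 0 → ψ f g = 0) :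
    ψ a 1 = ψ 1 a := by
  have bound : ∀ n : ℕ, ‖ψ a 1 - ψ 1 a‖ ≤ 54 * ‖ψ‖ * (1 / ((n : ℝ) + 1)) := by
    intro n
    have h1 : (1 : U) = ∑ c, cfc (trig3 n c) a := by
      rw [← cfc_sum (fun c => trig3 n c) a _ (fun c _ => (trig3_cont n c).continuousOn)]
      rw [← cfc_one ℝ a]
      apply cfc_congr
      intro x _
      rw [Finset.sum_apply, trig3_sum]; rfl
    have h2 : a = ∑ c, cfc (fun x => x * trig3 n c x) a := by
      rw [← cfc_sum (fun c x => x * trig3 n c x) a _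
        (fun c _ => (continuous_id.mul (trig3_cont n c)).continuousOn)]
      nth_rw 1 [← cfc_id ℝ a]
      apply cfc_congr
      intro x _
      rw [Finset.sum_apply, ← Finset.mul_sum, trig3_sum]; simp
    have e : ψ a 1 - ψ 1 a = ∑ c, ∑ d,
        (ψ (cfc (fun x => x * trig3 n c x) a) (cfc (trig3 n d) a)
          - ψ (cfc (trig3 n c) a) (cfc (fun x => x * trig3 n d x) a)) := by
      have e1 : ψ a 1 = ∑ c, ∑ d, ψ (cfc (fun x => x * trig3 n c x) a) (cfc (trig3 n d) a) := by
        conv_lhs => rw [h2, h1]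
        simp only [map_sum, sum_apply]
        exact Finset.sum_comm
      have e2 : ψ 1 a = ∑ c, ∑ d, ψ (cfc (trig3 n c) a) (cfc (fun x => x * trig3 n d x) a) := by
        conv_lhs => rw [h2, h1]
        simp only [map_sum, sum_apply]
        exact Finset.sum_comm
      rw [e1, e2]
      simp only [Finset.sum_sub_distrib]
    rw [e]
    refine (norm_sum_le _ _).trans ?_
    have b : ∀ c d : Fin 3, ‖ψ (cfc (fun x => x * trig3 n c x) a) (cfc (trig3 n d) a)
          - ψ (cfc (trig3 n c) a) (cfc (fun x => x * trig3 n d x) a)‖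
          ≤ 2 * ‖ψ‖ * (3 / ((n : ℝ) + 1)) := by
      intro c d
      obtain ⟨r, hr1, hr2⟩ : ∃ r : Fin 3, c ≠ r ∧ d ≠ r := by
        revert c d; decide
      exact lattice_estimate ψ a ha h _ _ (by positivity) _ _ (trig3_cont n c) (trig3_cont n d)
        (trig3_abs n c) (trig3_abs n d) (trig3_zero n c r hr1) (trig3_zero n d r hr2)
    calc _ ≤ ∑ c : Fin 3, ∑ d : Fin 3, 2 * ‖ψ‖ * (3 / ((n : ℝ) + 1)) :=
          Finset.sum_le_sum fun c _ => (norm_sum_le _ _).trans (Finset.sum_le_sum fun d _ => b c d)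
      _ = _ := by simp; ring
  have lim : Filter.Tendsto (fun n : ℕ => 54 * ‖ψ‖ * (1 / ((n : ℝ) + 1))) Filter.atTop (nhds 0) := by
    simpa using tendsto_one_div_add_atTop_nhds_zero_nat.const_mul (54 * ‖ψ‖)
  have := ge_of_tendsto' lim bound
  exact sub_eq_zero.mp (norm_le_zero_iff.mp this)
theorem lemma_D_all {U E : Type*} [CStarAlgebra U] [NormedAddCommGroup E] [NormedSpace ℂ E]
    (ψ : U →L[ℂ] U →L[ℂ] E)
    (h : ∀ f g : U, f * g = 0 → g * f = 0 → ψ f g = 0) (a : U) :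
    ψ a 1 = ψ 1 a := by
  have hs : ∀ a : U, IsSelfAdjoint a → ψ a 1 = ψ 1 a := fun a ha =>
    lemma_D ψ a ha (fun f g _ _ h1 h2 => h f g h1 h2)
  rw [← realPart_add_I_smul_imaginaryPart a]
  simp only [map_add, map_smul, add_apply, smul_apply]
  rw [hs _ (realPart a).2, hs _ (imaginaryPart a).2]

section unitization

variable {A : Type*} [NonUnitalCStarAlgebra A]

/-- second projection of the unitization -/
noncomputable def sndL (A : Type*) [NonUnitalCStarAlgebra A] : Unitization ℂ A →L[ℂ] A where
  toFun := fun x => x.snd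
  map_add' := fun _ _ => rfl
  map_smul' := fun _ _ => rfl
  cont := Unitization.continuous_snd

/-- right action: f maps to x f -/
noncomputable def actR (x : A) : Unitization ℂ A →L[ℂ] A :=
  (sndL A).comp (ContinuousLinearMap.mul ℂ (Unitization ℂ A) (x : Unitization ℂ A))

/-- left action: f maps to f x -/
noncomputable def actL (x : A) : Unitization ℂ A →L[ℂ] A :=
  (sndL A).comp ((ContinuousLinearMap.mul ℂ (Unitization ℂ A)).flip (x : Unitization ℂ A))

theorem inr_actR (x : A) (f : Unitization ℂ A) :
    ((actR x f : A) : Unitization ℂ A) = (x : Unitization ℂ A) * f := by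
  ext
  · simp
  · rfl

theorem inr_actL (x : A) (f : Unitization ℂ A) :
    ((actL x f : A) : Unitization ℂ A) = f * (x : Unitization ℂ A) := by
  ext
  · simp
  · rfl

theorem actR_inr (x y : A) : actR x (y : Unitization ℂ A) = x * y :=
  Unitization.inr_injective (R := ℂ) (by rw [inr_actR, Unitization.inr_mul])

theorem actL_inr (x y : A) : actL x (y : Unitization ℂ A) = y * x :=
  Unitization.inr_injective (R := ℂ) (by rw [inr_actL, Unitization.inr_mul])

theorem actR_one (x : A) : actR x (1 : Unitization ℂ A) = x :=
  Unitization.inr_injective (R := ℂ) (by rw [inr_actR, mul_one])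

theorem actL_one (x : A) : actL x (1 : Unitization ℂ A) = x :=
  Unitization.inr_injective (R := ℂ) (by rw [inr_actL, one_mul])

variable {E : Type*} [NormedAddCommGroup E] [NormedSpace ℂ E]

theorem comm_identity (W : A →L[ℂ] A →L[ℂ] E) (hW : ∀ a b : A, a * b = 0 → b * a = 0 → W a b = 0)
    (s : A) (hs : IsSelfAdjoint s) (x y : A)
    (hx' : ∀ f : Unitization ℂ A, Commute f s → Commute f x)
    (hy' : ∀ f : Unitization ℂ A, Commute f s → Commute f y) :
    W (x * s) y = W x (y * s) := by
  have hs' : IsSelfAdjoint (s : Unitization ℂ A) := by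
    rw [isSelfAdjoint_iff, ← Unitization.inr_star, hs.star_eq]
  have key := lemma_D (W.bilinearComp (actR x) (actR y)) (s : Unitization ℂ A) hs' ?_
  · simpa only [ContinuousLinearMap.bilinearComp_apply, actR_inr, actR_one] using key
  · intro f g hf hg hfg hgf
    rw [ContinuousLinearMap.bilinearComp_apply]
    apply hW
    · apply Unitization.inr_injective (R := ℂ)
      rw [Unitization.inr_mul, inr_actR, inr_actR, Unitization.inr_zero, mul_assoc, ← mul_assoc f,
        (hy' f hf).eq, mul_assoc, hfg, mul_zero, mul_zero]
    · apply Unitization.inr_injective (R := ℂ)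
      rw [Unitization.inr_mul, inr_actR, inr_actR, Unitization.inr_zero, mul_assoc, ← mul_assoc g,
        (hx' g hg).eq, mul_assoc, hgf, mul_zero, mul_zero]

theorem four_identity (W : A →L[ℂ] A →L[ℂ] E)
    (hW : ∀ a b : A, a * b = 0 → b * a = 0 → W a b = 0) (u v x y : A) :
    W (u * x * v) y + W x (v * y * u) = W (u * x) (v * y) + W (x * v) (y * u) := by
  -- first step
  have step1 : ∀ f g : Unitization ℂ A, f * g = 0 → g * f = 0 →
      W (actL x f * v) (actR y g) = W (actL x f) (v * actR y g) := by
    intro f g hfg hgf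
    have key := lemma_D_all (W.bilinearComp (actR (actL x f)) (actL (actR y g))) ?_
      (v : Unitization ℂ A)
    · simpa only [ContinuousLinearMap.bilinearComp_apply, actR_inr, actR_one, actL_inr, actL_one]
        using key
    · intro p q hpq hqp
      rw [ContinuousLinearMap.bilinearComp_apply]
      apply hW
      · apply Unitization.inr_injective (R := ℂ)
        simp only [Unitization.inr_mul, inr_actR, inr_actL, Unitization.inr_zero]
        calc f * (x : Unitization ℂ A) * p * (q * ((y : Unitization ℂ A) * g))
            = f * (x : Unitization ℂ A) * (p * q) * ((y : Unitization ℂ A) * g) := by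
              simp only [mul_assoc]
          _ = 0 := by rw [hpq, mul_zero, zero_mul]
      · apply Unitization.inr_injective (R := ℂ)
        simp only [Unitization.inr_mul, inr_actR, inr_actL, Unitization.inr_zero]
        calc q * ((y : Unitization ℂ A) * g) * (f * (x : Unitization ℂ A) * p)
            = q * (y : Unitization ℂ A) * (g * f) * ((x : Unitization ℂ A) * p) := by
              simp only [mul_assoc]
          _ = 0 := by rw [hgf, mul_zero, zero_mul]
  let M := ContinuousLinearMap.mul ℂ A
  have key := lemma_D_all (W.bilinearComp ((M.flip v).comp (actL x)) (actR y)
      - W.bilinearComp (actL x) ((M v).comp (actR y))) ?_ (u : Unitization ℂ A)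
  · have key2 : W (u * x * v) y - W (u * x) (v * y) = W (x * v) (y * u) - W x (v * (y * u)) := by
      simpa [actR_inr, actR_one, actL_inr, actL_one, M] using key
    rw [← mul_assoc] at key2
    rw [sub_eq_sub_iff_add_eq_add] at key2
    rw [key2, add_comm]
  · intro f g hfg hgf
    have := step1 f g hfg hgf
    simpa [M, sub_eq_zero] using this

end unitization
section limits

open Filter Topology

variable {A : Type*} [NonUnitalCStarAlgebra A] {E : Type*} [NormedAddCommGroup E] [NormedSpace ℂ E]

theorem tendsto_bilin (W : A →L[ℂ] A →L[ℂ] E) {l : Filter A} {f g : A → A} {a b : A}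
    (hf : Tendsto f l (𝓝 a)) (hg : Tendsto g l (𝓝 b)) :
    Tendsto (fun e => W (f e) (g e)) l (𝓝 (W a b)) :=
  (W.continuous₂.tendsto (a, b)).comp (hf.prodMk_nhds hg)

theorem exists_lim_pow (W : A →L[ℂ] A →L[ℂ] E)
    (hW : ∀ a b : A, a * b = 0 → b * a = 0 → W a b = 0) (l : Filter A)
    (hl1 : ∀ m : A, Tendsto (m * ·) l (𝓝 m)) (hl2 : ∀ m : A, Tendsto (· * m) l (𝓝 m))
    (s : A) (hs : IsSelfAdjoint s) :
    Tendsto (fun e => W (s * (s * s) * s) e) l (𝓝 (W (s * s) (s * s))) ∧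
    Tendsto (fun e => W e (s * (s * s) * s)) l (𝓝 (W (s * s) (s * s))) := by
  have hsf : ∀ f : Unitization ℂ A, Commute f s → Commute f ((s * s : A) : Unitization ℂ A) := by
    intro f hf
    rw [Unitization.inr_mul]
    exact hf.mul_right hf
  have c1 : W (s * s * s) s = W (s * s) (s * s) :=
    comm_identity W hW s hs (s * s) s hsf (fun _ h => h)
  have c2 : W (s * s) (s * s) = W s (s * s * s) :=
    comm_identity W hW s hs s (s * s) (fun _ h => h) hsf
  have hses : Tendsto (fun e => s * e * s) l (𝓝 (s * s)) := (hl1 s).mul_const s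
  constructor
  · have e1 : ∀ e, W (s * (s * s) * s) e
        = W (s * (s * s)) (s * e) + W (s * s * s) (e * s) - W (s * s) (s * e * s) := fun e =>
      eq_sub_of_add_eq (four_identity W hW s s (s * s) e)
    have t := ((tendsto_bilin W (tendsto_const_nhds (x := s * (s * s))) (hl1 s)).add
      (tendsto_bilin W (tendsto_const_nhds (x := s * s * s)) (hl2 s))).sub
      (tendsto_bilin W (tendsto_const_nhds (x := s * s)) hses)
    rw [← mul_assoc s s s, c1, add_sub_cancel_right] at t
    refine t.congr fun e => ?_
    rw [e1, ← mul_assoc s s s]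
  · have e1 : ∀ e, W e (s * (s * s) * s)
        = W (s * e) (s * (s * s)) + W (e * s) (s * s * s) - W (s * e * s) (s * s) := fun e =>
      eq_sub_of_add_eq' (four_identity W hW s s e (s * s))
    have t := ((tendsto_bilin W (hl1 s) (tendsto_const_nhds (x := s * (s * s)))).add
      (tendsto_bilin W (hl2 s) (tendsto_const_nhds (x := s * s * s)))).sub
      (tendsto_bilin W hses (tendsto_const_nhds (x := s * s)))
    rw [← mul_assoc s s s, ← c2, add_sub_cancel_right] at t
    refine t.congr fun e => ?_
    rw [e1, ← mul_assoc s s s]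

theorem exists_lim (W : A →L[ℂ] A →L[ℂ] E)
    (hW : ∀ a b : A, a * b = 0 → b * a = 0 → W a b = 0) (l : Filter A)
    (hl1 : ∀ m : A, Tendsto (m * ·) l (𝓝 m)) (hl2 : ∀ m : A, Tendsto (· * m) l (𝓝 m)) (a : A) :
    ∃ p, Tendsto (fun e => W a e) l (𝓝 p) ∧ Tendsto (fun e => W e a) l (𝓝 p) := by
  let _ := CStarAlgebra.spectralOrder A
  have := CStarAlgebra.spectralOrderedRing A
  have ha : a ∈ Submodule.span ℂ {a : A | 0 ≤ a} := by
    rw [CStarAlgebra.span_nonneg]; trivial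
  induction ha using Submodule.span_induction with
  | mem x hx =>
    have hx0 : (0 : A) ≤ x := hx
    have h1 := CFC.sqrt_mul_sqrt_self x hx0
    have h2 := CFC.sqrt_mul_sqrt_self (CFC.sqrt x) (CFC.sqrt_nonneg x)
    set s := CFC.sqrt (CFC.sqrt x) with hs
    have hsa : IsSelfAdjoint s := IsSelfAdjoint.of_nonneg (CFC.sqrt_nonneg _)
    have h3 : s * (s * s) * s = x := by
      rw [← h1, ← h2]; simp only [mul_assoc]
    have := exists_lim_pow W hW l hl1 hl2 s hsa
    rw [h3] at this
    exact ⟨_, this⟩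
  | zero => exact ⟨0, by simpa using tendsto_const_nhds⟩
  | add x y _ _ hx hy =>
    obtain ⟨p, hp1, hp2⟩ := hx
    obtain ⟨q, hq1, hq2⟩ := hy
    exact ⟨p + q, by simpa using hp1.add hq1, by simpa using hp2.add hq2⟩
  | smul c x _ hx =>
    obtain ⟨p, hp1, hp2⟩ := hx
    exact ⟨c • p, by simpa using hp1.const_smul c, by simpa using hp2.const_smul c⟩

theorem tendsto_move (W : A →L[ℂ] A →L[ℂ] E) {l : Filter A} (hb : ∀ᶠ e in l, ‖e‖ ≤ 1)
    {f : A → A} {a : A} (hf : Tendsto f l (𝓝 a)) {p : E}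
    (hp : Tendsto (fun e => W a e) l (𝓝 p)) : Tendsto (fun e => W (f e) e) l (𝓝 p) := by
  have h0 : Tendsto (fun e => W (f e - a) e) l (𝓝 0) := by
    have h1 : Tendsto (fun e => ‖W‖ * ‖f e - a‖) l (𝓝 0) := by
      have := (tendsto_iff_norm_sub_tendsto_zero.mp hf).const_mul ‖W‖
      simpa using this
    apply squeeze_zero_norm' _ h1
    filter_upwards [hb] with e he
    refine (W.le_opNorm₂ _ _).trans ?_
    calc _ ≤ ‖W‖ * ‖f e - a‖ * 1 := by gcongr
      _ = _ := mul_one _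
  have := h0.add hp
  simpa using this

theorem jordan_lim (W : A →L[ℂ] A →L[ℂ] E)
    (hW : ∀ a b : A, a * b = 0 → b * a = 0 → W a b = 0) (l : Filter A) [NeBot l]
    (hl1 : ∀ m : A, Tendsto (m * ·) l (𝓝 m)) (hl2 : ∀ m : A, Tendsto (· * m) l (𝓝 m))
    (hb : ∀ᶠ e in l, ‖e‖ ≤ 1) (u v : A) {p q : E}
    (hp : Tendsto (fun e => W (u * v) e) l (𝓝 p)) (hq : Tendsto (fun e => W e (v * u)) l (𝓝 q)) :
    p + q = W u v + W v u := by
  have t1 := tendsto_move W hb ((hl1 u).mul_const v) hp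
  have t2 := tendsto_move W.flip hb ((hl1 v).mul_const u) hq
  have t3 := (tendsto_bilin W (hl1 u) (hl1 v)).add (tendsto_bilin W (hl2 v) (hl2 u))
  refine tendsto_nhds_unique (t1.add t2) (t3.congr fun e => ?_)
  exact (four_identity W hW u v e e).symm

end limits

section final

open Filter Topology

variable {A B : Type*} [NonUnitalCStarAlgebra A] [NonUnitalCStarAlgebra B]

/-- star conjugate of T -/
noncomputable def starConj (T : A →L[ℂ] B) : A →L[ℂ] B where
  toFun := fun b => star (T (star b))
  map_add' := fun _ _ => by simp
  map_smul' := fun _ _ => by simp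
  cont := by fun_prop

theorem starConj_apply (T : A →L[ℂ] B) (b : A) : starConj T b = star (T (star b)) := rfl

theorem exists_P (T : A →L[ℂ] B)
    (hT : ∀ a b : A, IsOrthogonal a b → IsOrthogonal (T a) (T b)) :
    ∃ P P' : A →ₗ[ℂ] B,
      (∀ a, P (star a) = star (P a)) ∧ (∀ a, P' (star a) = star (P' a)) ∧
      (∀ a, T a = 0 → P a = 0 ∧ P' a = 0) ∧
      (∀ u v, P (u * v) + P (v * u) = T u * starConj T v + T v * starConj T u) ∧
      (∀ u v, P' (u * v) + P' (v * u) = starConj T v * T u + starConj T u * T v) ∧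
      (∀ u v, P u * T v = T u * P' v) := by
  let W : A →L[ℂ] A →L[ℂ] B := (ContinuousLinearMap.mul ℂ B).bilinearComp T (starConj T)
  let W' : A →L[ℂ] A →L[ℂ] B := (ContinuousLinearMap.mul ℂ B).flip.bilinearComp T (starConj T)
  have Wa : ∀ a b, W a b = T a * starConj T b := fun _ _ => rfl
  have Wa' : ∀ a b, W' a b = starConj T b * T a := fun _ _ => rfl
  have hWW : ∀ a b : A, a * b = 0 → b * a = 0 → W a b = 0 ∧ W' a b = 0 := by
    intro a b hab hba
    exact hT a (star b) ⟨by rwa [star_star], by rwa [star_star]⟩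
  have hW := fun a b h1 h2 => (hWW a b h1 h2).1
  have hW' := fun a b h1 h2 => (hWW a b h1 h2).2
  obtain ⟨l, hne, hl1, hl2, hb, hsa⟩ : ∃ l : Filter A, NeBot l ∧ (∀ m : A, Tendsto (m * ·) l (𝓝 m)) ∧
      (∀ m : A, Tendsto (· * m) l (𝓝 m)) ∧ (∀ᶠ e in l, ‖e‖ ≤ 1) ∧ (∀ᶠ e in l, star e = e) := by
    let _ := CStarAlgebra.spectralOrder A
    have := CStarAlgebra.spectralOrderedRing A
    have h := CStarAlgebra.increasingApproximateUnit A
    exact ⟨_, h.neBot, h.tendsto_mul_left, h.tendsto_mul_right, h.eventually_norm,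
      h.eventually_star_eq⟩
  have mk : ∀ V : A →L[ℂ] A →L[ℂ] B, (∀ a b : A, a * b = 0 → b * a = 0 → V a b = 0) →
      ∃ P : A →ₗ[ℂ] B, (∀ a, Tendsto (fun e => V a e) l (𝓝 (P a))) ∧
        (∀ a, Tendsto (fun e => V e a) l (𝓝 (P a))) := by
    intro V hV
    choose P h1 h2 using exists_lim V hV l hl1 hl2
    refine ⟨⟨⟨P, fun x y => ?_⟩, fun c x => ?_⟩, h1, h2⟩
    · exact tendsto_nhds_unique (h1 (x + y)) (by simpa using (h1 x).add (h1 y))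
    · exact tendsto_nhds_unique (h1 (c • x)) (by simpa using (h1 x).const_smul c)
  obtain ⟨P, hP1, hP2⟩ := mk W hW
  obtain ⟨P', hP1', hP2'⟩ := mk W' hW'
  refine ⟨P, P', ?_, ?_, ?_, ?_, ?_, ?_⟩
  · intro a
    refine tendsto_nhds_unique (hP2 (star a)) ((hP1 a).star.congr' ?_)
    filter_upwards [hsa] with e he
    simp [Wa, starConj_apply, he]
  · intro a
    refine tendsto_nhds_unique (hP2' (star a)) ((hP1' a).star.congr' ?_)
    filter_upwards [hsa] with e he
    simp [Wa', starConj_apply, he]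
  · intro a ha
    constructor
    · refine tendsto_nhds_unique (hP1 a) ?_
      simp [Wa, ha]
    · refine tendsto_nhds_unique (hP1' a) ?_
      simp [Wa', ha]
  · intro u v
    exact jordan_lim W hW l hl1 hl2 hb u v (hP1 _) (hP2 _)
  · intro u v
    exact jordan_lim W' hW' l hl1 hl2 hb u v (hP1' _) (hP2' _)
  · intro u v
    refine tendsto_nhds_unique ((hP1 u).mul_const (T v)) (((hP1' v).const_mul (T u)).congr fun e => ?_)
    simp [Wa, Wa', mul_assoc]

theorem sa_split (T : A →L[ℂ] B) (x : A) (h1 : T (realPart x : A) = 0)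
    (h2 : T (imaginaryPart x : A) = 0) : T x = 0 := by
  rw [← realPart_add_I_smul_imaginaryPart x, map_add, map_smul, h1, h2]; simp

end final

theorem ker_of_orthogonality_preserving {A B : Type*}
    [NonUnitalCStarAlgebra A] [NonUnitalCStarAlgebra B] (T : A →L[ℂ] B)
    (hT : ∀ a b : A, IsOrthogonal a b → IsOrthogonal (T a) (T b)) :
    IsClosed {x : A | T x = 0} ∧
      (∀ x a : A, T x = 0 → T (a * x) = 0 ∧ T (x * a) = 0) ∧
      (∀ x : A, T x = 0 → T (star x) = 0) := by
  obtain ⟨P, P', hPs, hPs', hker, hJ, hJ', hass⟩ := exists_P T hT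
  -- a self-adjoint element killed by the second limit map is killed by T
  have c0 : ∀ z : A, IsSelfAdjoint z → P' z = 0 → T z = 0 := by
    intro z hz hz0
    have h1 : P (z * z) = T z * star (T z) := by
      have h := hJ z z
      rw [starConj_apply, hz.star_eq, ← two_smul ℂ, ← two_smul ℂ] at h
      exact smul_right_injective B (two_ne_zero (α := ℂ)) h
    have h2 : P (z * z) * P (z * z) = 0 := by
      nth_rw 2 [h1]
      rw [← mul_assoc, hass, hz0, mul_zero, zero_mul]
    have h3 : star (P (z * z)) = P (z * z) := by rw [← hPs, star_mul, hz.star_eq]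
    have h4 : P (z * z) = 0 := by
      rw [← CStarRing.star_mul_self_eq_zero_iff, h3, h2]
    rw [← CStarRing.mul_star_self_eq_zero_iff, ← h1, h4]
  have c1 : ∀ z : A, P' z = 0 → T z = 0 := by
    intro z hz
    have hzs : P' (star z) = 0 := by rw [hPs', hz, star_zero]
    apply sa_split
    · apply c0 _ (realPart z).2
      rw [realPart_apply_coe, ← Complex.coe_smul, map_smul, map_add, hz, hzs]; simp
    · apply c0 _ (imaginaryPart z).2
      rw [imaginaryPart_apply_coe, ← Complex.coe_smul, map_smul, map_smul, map_sub, hz, hzs]; simp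
  have hstar : ∀ x : A, T x = 0 → T (star x) = 0 := by
    intro x hx
    apply c1
    rw [hPs', (hker x hx).2, star_zero]
  have hjord : ∀ x v : A, T x = 0 → T (x * v + v * x) = 0 := by
    intro x v hx
    apply c1
    rw [map_add, hJ', hx, starConj_apply, starConj_apply, hstar x hx]
    simp
  have hsq : ∀ x : A, T x = 0 → T (x * x) = 0 := by
    intro x hx
    have := hjord x x hx
    rw [← two_smul ℂ, map_smul] at this
    simpa using this
  have hquad : ∀ x a : A, T x = 0 → T (x * a * x) = 0 := by
    intro x a hx
    have h1 := hjord x (x * a + a * x) hx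
    have h2 := hjord (x * x) a (hsq x hx)
    have h3 : (2 : ℂ) • (x * a * x) = (x * (x * a + a * x) + (x * a + a * x) * x)
        - (x * x * a + a * (x * x)) := by
      rw [two_smul]; simp only [mul_add, add_mul, mul_assoc]; abel
    have h4 : T ((2 : ℂ) • (x * a * x)) = 0 := by rw [h3, map_sub, h1, h2, sub_zero]
    simpa using h4
  have hquad' : ∀ x a : A, T x = 0 → T (a * x * a) = 0 := by
    intro x a hx
    have h1 := hjord (x * a + a * x) a (hjord x a hx)
    have h2 := hjord x (a * a) hx
    have h3 : (2 : ℂ) • (a * x * a) = ((x * a + a * x) * a + a * (x * a + a * x))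
        - (x * (a * a) + a * a * x) := by
      rw [two_smul]; simp only [mul_add, add_mul, mul_assoc]; abel
    have h4 : T ((2 : ℂ) • (a * x * a)) = 0 := by rw [h3, map_sub, h1, h2, sub_zero]
    simpa using h4
  have hcomm0 : ∀ x a : A, IsSelfAdjoint x → IsSelfAdjoint a → T x = 0 →
      T (x * a - a * x) = 0 := by
    intro x a hxs has hx
    set w := x * a - a * x with hw
    have hws : star w = -w := by
      rw [hw, star_sub, star_mul, star_mul, hxs.star_eq, has.star_eq, neg_sub]
    have hw2 : T (w * w) = 0 := by
      have e : w * w = (x * a * x * a + a * (x * a * x)) - x * (a * a) * x - a * (x * x) * a := by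
        rw [hw]; simp only [mul_sub, sub_mul, mul_assoc]; abel
      rw [e, map_sub, map_sub, hjord _ a (hquad x a hx), hquad x _ hx, hquad' _ a (hsq x hx)]
      simp
    have h := hJ w w
    rw [(hker _ hw2).1, starConj_apply, hws, map_neg, star_neg, add_zero, ← two_smul ℂ] at h
    have h5 : T w * star (T w) = 0 := by simpa using h.symm
    exact (CStarRing.mul_star_self_eq_zero_iff _).mp h5
  have hre : ∀ x : A, T x = 0 → T (realPart x : A) = 0 ∧ T (imaginaryPart x : A) = 0 := by
    intro x hx
    constructor
    · rw [realPart_apply_coe, ← Complex.coe_smul, map_smul, map_add, hx, hstar x hx]; simp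
    · rw [imaginaryPart_apply_coe, ← Complex.coe_smul, map_smul, map_smul, map_sub, hx,
        hstar x hx]; simp
  have hcomm1 : ∀ x a : A, IsSelfAdjoint x → T x = 0 → T (x * a - a * x) = 0 := by
    intro x a hxs hx
    have h1 := hcomm0 x _ hxs (realPart a).2 hx
    have h2 := hcomm0 x _ hxs (imaginaryPart a).2 hx
    have e : x * a - a * x = (x * (realPart a : A) - (realPart a : A) * x)
        + Complex.I • (x * (imaginaryPart a : A) - (imaginaryPart a : A) * x) := by
      conv_lhs => rw [← realPart_add_I_smul_imaginaryPart a]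
      simp only [mul_add, add_mul, smul_sub, mul_smul_comm, smul_mul_assoc]; abel
    rw [e, map_add, map_smul, h1, h2]; simp
  have hcomm2 : ∀ x a : A, T x = 0 → T (x * a - a * x) = 0 := by
    intro x a hx
    have h1 := hcomm1 _ a (realPart x).2 (hre x hx).1
    have h2 := hcomm1 _ a (imaginaryPart x).2 (hre x hx).2
    have e : x * a - a * x = ((realPart x : A) * a - a * (realPart x : A))
        + Complex.I • ((imaginaryPart x : A) * a - a * (imaginaryPart x : A)) := by
      conv_lhs => rw [← realPart_add_I_smul_imaginaryPart x]
      simp only [mul_add, add_mul, smul_sub, mul_smul_comm, smul_mul_assoc]; abel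
    rw [e, map_add, map_smul, h1, h2]; simp
  refine ⟨isClosed_eq T.continuous continuous_const, fun x a hx => ?_, hstar⟩
  have h1 := hjord x a hx
  have h2 := hcomm2 x a hx
  rw [map_add] at h1
  rw [map_sub, sub_eq_zero] at h2
  have h3 : T (a * x) = 0 := by
    rw [h2, ← two_smul ℂ] at h1
    simpa using h1
  exact ⟨h3, h2.trans h3⟩
end

section
/- Let T : A → B be a continuous surjective orthogonality preserving linear operator between C*-algebras. Then for all x, y ∈ A such that x y* ∈ ker T and y* x ∈ ker T, one has T(x) ⊥ T(y). (Equivalently, the induced bijective bounded linear map on the quotient A/ker T is orthogonality preserving.) -/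
/-- The clamp of a real number to the unit interval. -/
noncomputable def opClamp (x : ℝ) : ℝ := max 0 (min 1 x)

lemma opClamp_continuous : Continuous opClamp := by
  unfold opClamp; fun_prop

lemma opClamp_mono {x y : ℝ} (h : x ≤ y) : opClamp x ≤ opClamp y := by
  unfold opClamp; gcongr

lemma opClamp_sum (N : ℕ) (x : ℝ) :
    ∑ i ∈ Finset.range N, opClamp (x - i) = max 0 (min (N : ℝ) x) := by
  induction N with
  | zero => simp
  | succ n ih =>
    rw [Finset.sum_range_succ, ih]
    unfold opClamp
    have hn : (0 : ℝ) ≤ n := Nat.cast_nonneg n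
    push_cast
    rcases le_total x n with h | h
    · rw [min_eq_right h, min_eq_right (by linarith : x ≤ (n : ℝ) + 1),
        min_eq_right (by linarith : x - n ≤ 1), max_eq_left (by linarith : x - n ≤ 0), add_zero]
    · rw [min_eq_left h, max_eq_right hn]
      rcases le_total x (n + 1) with h' | h'
      · rw [min_eq_right h', min_eq_right (by linarith : x - n ≤ 1),
          max_eq_right (by linarith : 0 ≤ x - n), max_eq_right (by linarith : 0 ≤ x)]
        ring
      · rw [min_eq_left h', min_eq_left (by linarith : 1 ≤ x - n),
          max_eq_right (by linarith : (0 : ℝ) ≤ 1), max_eq_right (by linarith : (0 : ℝ) ≤ n + 1)]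

/-- A steep ramp around `i + c`. -/
noncomputable def opRamp (c : ℝ) (i : ℕ) (x : ℝ) : ℝ := opClamp (4 * (x - i - c) + 1 / 2)

lemma opRamp_continuous (c : ℝ) (i : ℕ) : Continuous (opRamp c i) := by
  unfold opRamp; exact opClamp_continuous.comp (by fun_prop)

lemma opRamp_le (c : ℝ) (hc : 0 ≤ c) (i : ℕ) (x : ℝ) :
    opRamp c i x ≤ opClamp (x + 1 - i) := by
  unfold opRamp opClamp
  simp only [max_def, min_def]
  split_ifs <;> linarith

lemma le_opRamp (c : ℝ) (hc : c ≤ 1 / 2) (i : ℕ) (x : ℝ) :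
    opClamp (x - 1 - i) ≤ opRamp c i x := by
  unfold opRamp opClamp
  simp only [max_def, min_def]
  split_ifs <;> linarith

lemma opRamp_sum (c : ℝ) (hc : 0 ≤ c) (hc' : c ≤ 1 / 2) (N : ℕ) (x : ℝ) (hx : 0 ≤ x)
    (hxN : x ≤ N) : |x - ∑ i ∈ Finset.range N, opRamp c i x| ≤ 1 := by
  have h1 : ∑ i ∈ Finset.range N, opRamp c i x ≤ ∑ i ∈ Finset.range N, opClamp (x + 1 - i) :=
    Finset.sum_le_sum fun i _ => opRamp_le c hc i x
  have h2 : ∑ i ∈ Finset.range N, opClamp (x - 1 - i) ≤ ∑ i ∈ Finset.range N, opRamp c i x :=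
    Finset.sum_le_sum fun i _ => le_opRamp c hc' i x
  rw [opClamp_sum] at h1 h2
  have h3 : max 0 (min (N : ℝ) (x + 1)) ≤ x + 1 := max_le (by linarith) (min_le_right _ _)
  have h4 : x - 1 ≤ max 0 (min (N : ℝ) (x - 1)) :=
    le_max_of_le_right (le_min (by linarith) le_rfl)
  rw [abs_le]; constructor <;> linarith

lemma opRamp_not (c : ℝ) (i : ℕ) (x : ℝ) (h : opRamp c i x * (1 - opRamp c i x) ≠ 0) :
    1 / 2 < Real.cos (2 * Real.pi * (x - c)) := by
  have h1 : |x - i - c| < 1 / 8 := by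
    by_contra hcon
    apply h
    rw [not_lt, le_abs] at hcon
    unfold opRamp opClamp
    rcases hcon with h' | h'
    · rw [min_eq_left (by linarith), max_eq_right zero_le_one]; ring
    · rw [min_eq_right (by linarith), max_eq_left (by linarith)]; ring
  have h2 : Real.cos (2 * Real.pi * (x - c)) = Real.cos (2 * Real.pi * (x - i - c)) := by
    rw [← Real.cos_sub_nat_mul_two_pi _ i]; congr 1; ring
  rw [h2]
  refine lt_of_lt_of_le ?_ (Real.one_sub_sq_div_two_le_cos)
  have h3 : (x - i - c) ^ 2 ≤ (1 / 8) ^ 2 := by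
    rw [← sq_abs]; gcongr
  have h4 : Real.pi ^ 2 ≤ 3.15 ^ 2 := by
    have := Real.pi_lt_d2; have := Real.pi_pos; gcongr
  have : (2 * Real.pi * (x - i - c)) ^ 2 ≤ 4 * 3.15 ^ 2 * (1 / 8) ^ 2 := by
    calc (2 * Real.pi * (x - i - c)) ^ 2 = 4 * Real.pi ^ 2 * (x - i - c) ^ 2 := by ring
      _ ≤ _ := by gcongr
  norm_num at this ⊢
  linarith

/-- The cutoff function. -/
noncomputable def opCut (x : ℝ) : ℝ := opClamp (1 / 2 - Real.cos (2 * Real.pi * x))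

lemma opCut_continuous : Continuous opCut := by
  unfold opCut; exact opClamp_continuous.comp (by fun_prop)

lemma opCut_zero (i : ℕ) (x : ℝ) : opRamp 0 i x * (1 - opRamp 0 i x) * opCut x = 0 := by
  by_cases h : opRamp 0 i x * (1 - opRamp 0 i x) = 0
  · rw [h, zero_mul]
  · have := opRamp_not 0 i x h
    rw [sub_zero] at this
    have : opCut x = 0 := by
      unfold opCut opClamp
      rw [min_eq_right (by linarith), max_eq_left (by linarith)]
    rw [this, mul_zero]

lemma opCut_one (i : ℕ) (x : ℝ) :
    opRamp (1 / 2) i x * (1 - opRamp (1 / 2) i x) * (1 - opCut x) = 0 := by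
  by_cases h : opRamp (1 / 2) i x * (1 - opRamp (1 / 2) i x) = 0
  · rw [h, zero_mul]
  · have := opRamp_not (1 / 2) i x h
    have h2 : 2 * Real.pi * (x - 1 / 2) = 2 * Real.pi * x - Real.pi := by ring
    rw [h2, Real.cos_sub_pi] at this
    have : opCut x = 1 := by
      unfold opCut opClamp
      rw [min_eq_left (by linarith), max_eq_right (by linarith)]
    rw [this, sub_self, mul_zero]

lemma opCut_mem (x : ℝ) : 0 ≤ opCut x ∧ opCut x ≤ 1 := by
  unfold opCut opClamp
  exact ⟨le_max_left _ _, max_le zero_le_one (min_le_left _ _)⟩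

set_option linter.unusedSectionVars false

section comm

variable {K E : Type*} [TopologicalSpace K] [CompactSpace K] [NormedAddCommGroup E]
  [NormedSpace ℝ E]

/-- Idempotent-like multipliers pass through a disjointness preserving bilinear map. -/
lemma op_ramp_pass (V : C(K, ℝ) →ₗ[ℝ] C(K, ℝ) →ₗ[ℝ] E)
    (hV : ∀ f g : C(K, ℝ), f * g = 0 → V f g = 0) (r f g : C(K, ℝ))
    (h : r * (1 - r) * f = 0) : V (r * f) g = V f (r * g) := by
  have h1 : V (r * f) ((1 - r) * g) = 0 := hV _ _ (by
    calc r * f * ((1 - r) * g) = r * (1 - r) * f * g := by ring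
      _ = 0 := by rw [h, zero_mul])
  have h2 : V ((1 - r) * f) (r * g) = 0 := hV _ _ (by
    calc (1 - r) * f * (r * g) = r * (1 - r) * f * g := by ring
      _ = 0 := by rw [h, zero_mul])
  have e1 : g = r * g + (1 - r) * g := by ring
  have e2 : f = r * f + (1 - r) * f := by ring
  calc V (r * f) g = V (r * f) (r * g + (1 - r) * g) := by rw [← e1]
    _ = V (r * f) (r * g) := by rw [map_add, h1, add_zero]
    _ = V (r * f + (1 - r) * f) (r * g) := by
      rw [map_add, LinearMap.add_apply, h2, add_zero]
    _ = V f (r * g) := by rw [← e2]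

lemma op_half_bound (V : C(K, ℝ) →ₗ[ℝ] C(K, ℝ) →ₗ[ℝ] E) (C : ℝ)
    (hC : ∀ f g, ‖V f g‖ ≤ C * ‖f‖ * ‖g‖) (hC0 : 0 ≤ C)
    (hV : ∀ f g : C(K, ℝ), f * g = 0 → V f g = 0) (x f g : C(K, ℝ)) (hx : ∀ t, 0 ≤ x t)
    (c : ℝ) (hc : 0 ≤ c) (hc' : c ≤ 1 / 2)
    (h : ∀ (i : ℕ) (t : K), opRamp c i (x t) * (1 - opRamp c i (x t)) * f t = 0) :
    ‖V (x * f) g - V f (x * g)‖ ≤ 2 * C * ‖f‖ * ‖g‖ := by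
  obtain ⟨N, hN⟩ := exists_nat_ge ‖x‖
  let r : ℕ → C(K, ℝ) := fun i => ⟨fun t => opRamp c i (x t), (opRamp_continuous c i).comp x.continuous⟩
  set s : C(K, ℝ) := ∑ i ∈ Finset.range N, r i with hs
  have hpass : V (s * f) g = V f (s * g) := by
    rw [hs, Finset.sum_mul, Finset.sum_mul, map_sum, map_sum, LinearMap.sum_apply]
    refine Finset.sum_congr rfl fun i _ => op_ramp_pass V hV _ _ _ ?_
    ext t
    exact h i t
  have hd : ‖x - s‖ ≤ 1 := by
    rw [ContinuousMap.norm_le _ zero_le_one]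
    intro t
    have hxt : x t ≤ N := le_trans (le_trans (le_abs_self _) (x.norm_coe_le_norm t)) hN
    have := opRamp_sum c hc hc' N (x t) (hx t) hxt
    simpa [hs, r, ContinuousMap.sum_apply] using this
  have e : V (x * f) g - V f (x * g) = V ((x - s) * f) g - V f ((x - s) * g) := by
    rw [sub_mul, sub_mul, map_sub, map_sub, LinearMap.sub_apply, hpass]; abel
  rw [e]
  have b1 : ‖V ((x - s) * f) g‖ ≤ C * ‖f‖ * ‖g‖ := by
    refine (hC _ _).trans ?_
    gcongr
    calc ‖(x - s) * f‖ ≤ ‖x - s‖ * ‖f‖ := norm_mul_le _ _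
      _ ≤ 1 * ‖f‖ := by gcongr
      _ = _ := one_mul _
  have b2 : ‖V f ((x - s) * g)‖ ≤ C * ‖f‖ * ‖g‖ := by
    refine (hC _ _).trans ?_
    gcongr
    calc ‖(x - s) * g‖ ≤ ‖x - s‖ * ‖g‖ := norm_mul_le _ _
      _ ≤ 1 * ‖g‖ := by gcongr
      _ = _ := one_mul _
  calc _ ≤ _ := norm_sub_le _ _
    _ ≤ _ := by linarith

lemma op_bound (V : C(K, ℝ) →ₗ[ℝ] C(K, ℝ) →ₗ[ℝ] E) (C : ℝ)
    (hC : ∀ f g, ‖V f g‖ ≤ C * ‖f‖ * ‖g‖) (hC0 : 0 ≤ C)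
    (hV : ∀ f g : C(K, ℝ), f * g = 0 → V f g = 0) (x f g : C(K, ℝ)) (hx : ∀ t, 0 ≤ x t) :
    ‖V (x * f) g - V f (x * g)‖ ≤ 4 * C * ‖f‖ * ‖g‖ := by
  let θ : C(K, ℝ) := ⟨fun t => opCut (x t), opCut_continuous.comp x.continuous⟩
  have h1 := op_half_bound V C hC hC0 hV x (θ * f) g hx 0 le_rfl (by norm_num) (fun i t => by
    change _ * (opCut (x t) * f t) = 0
    rw [← mul_assoc, opCut_zero, zero_mul])
  have h2 := op_half_bound V C hC hC0 hV x ((1 - θ) * f) g hx (1 / 2) (by norm_num) le_rfl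
    (fun i t => by
      change _ * ((1 - opCut (x t)) * f t) = 0
      rw [← mul_assoc, opCut_one, zero_mul])
  have n1 : ‖θ * f‖ ≤ ‖f‖ := by
    refine (norm_mul_le _ _).trans (mul_le_of_le_one_left (norm_nonneg _) ?_)
    rw [ContinuousMap.norm_le _ zero_le_one]
    intro t
    change |opCut (x t)| ≤ 1
    have := opCut_mem (x t)
    rw [abs_le]; constructor <;> linarith
  have n2 : ‖(1 - θ) * f‖ ≤ ‖f‖ := by
    refine (norm_mul_le _ _).trans (mul_le_of_le_one_left (norm_nonneg _) ?_)
    rw [ContinuousMap.norm_le _ zero_le_one]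
    intro t
    change |1 - opCut (x t)| ≤ 1
    have := opCut_mem (x t)
    rw [abs_le]; constructor <;> linarith
  have e2 : f = θ * f + (1 - θ) * f := by ring
  have e : V (x * f) g - V f (x * g) = (V (x * (θ * f)) g - V (θ * f) (x * g)) +
      (V (x * ((1 - θ) * f)) g - V ((1 - θ) * f) (x * g)) := by
    have e3 : x * f = x * (θ * f) + x * ((1 - θ) * f) := by ring
    have e4 : V f (x * g) = V (θ * f) (x * g) + V ((1 - θ) * f) (x * g) := by
      rw [← LinearMap.add_apply, ← map_add, ← e2]
    rw [e3, e4, map_add, LinearMap.add_apply]; abel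
  rw [e]
  have c1 : 2 * C * ‖θ * f‖ * ‖g‖ ≤ 2 * C * ‖f‖ * ‖g‖ := by gcongr
  have c2 : 2 * C * ‖(1 - θ) * f‖ * ‖g‖ ≤ 2 * C * ‖f‖ * ‖g‖ := by gcongr
  calc _ ≤ _ := norm_add_le _ _
    _ ≤ _ := by linarith

/-- A bounded disjointness preserving bilinear map on `C(K)` is balanced. -/
lemma op_balanced (V : C(K, ℝ) →ₗ[ℝ] C(K, ℝ) →ₗ[ℝ] E) (C : ℝ)
    (hC : ∀ f g, ‖V f g‖ ≤ C * ‖f‖ * ‖g‖) (hC0 : 0 ≤ C)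
    (hV : ∀ f g : C(K, ℝ), f * g = 0 → V f g = 0) (u f g : C(K, ℝ)) :
    V (u * f) g = V f (u * g) := by
  let v : C(K, ℝ) := u + ‖u‖ • (1 : C(K, ℝ))
  have hv : ∀ t, 0 ≤ v t := by
    intro t
    have := (abs_le.mp (u.norm_coe_le_norm t)).1
    simp [v]; linarith
  have key : ∀ n : ℕ, n * ‖V (v * f) g - V f (v * g)‖ ≤ 4 * C * ‖f‖ * ‖g‖ := by
    intro n
    have := op_bound V C hC hC0 hV ((n : ℝ) • v) f g (fun t => by
      have := hv t
      simp only [ContinuousMap.smul_apply, smul_eq_mul]; positivity)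
    rw [smul_mul_assoc, smul_mul_assoc, map_smul, map_smul, LinearMap.smul_apply, ← smul_sub,
      norm_smul] at this
    simpa using this
  have hz : ‖V (v * f) g - V f (v * g)‖ = 0 := by
    by_contra hne
    have hpos : 0 < ‖V (v * f) g - V f (v * g)‖ := lt_of_le_of_ne (norm_nonneg _) (Ne.symm hne)
    obtain ⟨n, hn⟩ := exists_nat_gt (4 * C * ‖f‖ * ‖g‖ / ‖V (v * f) g - V f (v * g)‖)
    rw [div_lt_iff₀ hpos] at hn
    exact absurd (key n) (not_le.mpr hn)
  have hz' := sub_eq_zero.mp (norm_eq_zero.mp hz)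
  simp only [v, add_mul, smul_mul_assoc, one_mul, map_add, map_smul, LinearMap.add_apply,
    LinearMap.smul_apply] at hz'
  exact add_right_cancel hz'

end comm
section alg

variable {A C : Type*} [NonUnitalRing A] [StarRing A] [Module ℂ A] [StarModule ℂ A]
  [IsScalarTower ℂ A A] [SMulCommClass ℂ A A] [CStarAlgebra C]

lemma op_zero_of_sa (T : A →ₗ[ℂ] C) (b : C)
    (h : ∀ a : A, IsSelfAdjoint a → star (T a) * b = 0) (a : A) : star (T a) * b = 0 := by
  rw [← realPart_add_I_smul_imaginaryPart a, map_add, map_smul, star_add, star_smul, add_mul,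
    smul_mul_assoc, h _ (realPart a).2, h _ (imaginaryPart a).2]
  simp

/-- The algebraic heart of the argument. -/
lemma op_algebra (T : A →ₗ[ℂ] C) (h : C)
    (hid : ∀ (m : C) (a : A), ∃ c, m * T a = T c) (hstar : ∀ a, ∃ c, star (T a) = T c)
    (h1 : ∀ a, T a * star h = h * star (T (star a)))
    (h2 : ∀ a, star h * T a = star (T (star a)) * h)
    (h3 : ∀ a, T (a * a) * star h = T a * star (T (star a)))
    (x y : A) (hxy : T (x * star y) = 0) (hyx : T (star y * x) = 0) :
    T x * star (T y) = 0 ∧ star (T y) * T x = 0 := by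
  have hmul : ∀ a b, ∃ c, T a * T b = T c := fun a b => hid (T a) b
  -- elements of the range killed by the range vanish
  have nondeg : ∀ d : C, (∀ a, d * T a = 0) → (∃ c, d = T c) → d = 0 := by
    rintro d hd ⟨c, rfl⟩
    obtain ⟨c', hc'⟩ := hstar c
    have := hd c'
    rw [← hc'] at this
    exact (CStarRing.mul_star_self_eq_zero_iff _).mp this
  have nondeg' : ∀ d : C, (∀ a, T a * d = 0) → (∃ c, d = T c) → d = 0 := by
    rintro d hd ⟨c, rfl⟩
    obtain ⟨c', hc'⟩ := hstar c
    have := hd c'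
    rw [← hc'] at this
    exact (CStarRing.star_mul_self_eq_zero_iff _).mp this
  -- `k = h h*`
  have e1 : ∀ a, h * star h * T a = T a * (star h * h) := by
    intro a
    rw [mul_assoc, h2, ← mul_assoc, ← h1, mul_assoc]
  have e2 : ∀ a, h * star h * T a = T a * (h * star h) := by
    intro a
    have hk : ∀ b, (h * star h * T a - T a * (h * star h)) * T b = 0 := by
      intro b
      obtain ⟨c, hc⟩ := hmul a b
      rw [sub_mul, sub_eq_zero, mul_assoc, hc, e1, ← hc, mul_assoc, mul_assoc, e1]
    have : (h * star h * T a - T a * (h * star h)) *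
        star (h * star h * T a - T a * (h * star h)) = 0 := by
      obtain ⟨c, hc⟩ := hstar a
      have s1 : star (h * star h * T a - T a * (h * star h))
          = T c * (h * star h) - T c * (star h * h) := by
        rw [← e1 c, ← hc]
        simp [mul_assoc]
      rw [s1, mul_sub, ← mul_assoc, ← mul_assoc _ (T c), hk]
      simp
    exact sub_eq_zero.mp ((CStarRing.mul_star_self_eq_zero_iff _).mp this)
  have e3 : ∀ a, star h * h * T a = T a * (h * star h) := by
    intro a
    obtain ⟨c, hc⟩ := hstar a
    have hc' : T a = star (T c) := by rw [← hc, star_star]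
    rw [hc']
    have := congrArg star (e1 c)
    simp only [star_mul, star_star] at this
    exact this.symm
  -- injectivity
  have inj1 : ∀ c, star h * T c = 0 → T c = 0 := by
    intro c hc
    have hall := op_zero_of_sa T (T c) (fun a ha => by
      rw [← CStarRing.star_mul_self_eq_zero_iff]
      have h3a := h3 a
      rw [ha.star_eq] at h3a
      rw [star_mul, star_star]
      calc star (T c) * T a * (star (T a) * T c) = star (T c) * (T a * star (T a)) * T c := by
            simp only [mul_assoc]
        _ = star (T c) * T (a * a) * (star h * T c) := by rw [← h3a]; simp only [mul_assoc]
        _ = 0 := by rw [hc, mul_zero]) c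
    exact (CStarRing.star_mul_self_eq_zero_iff _).mp hall
  have injk : ∀ c, h * star h * T c = 0 → T c = 0 := by
    intro c hc
    apply inj1
    rw [← CStarRing.star_mul_self_eq_zero_iff, star_mul, star_star]
    calc star (T c) * h * (star h * T c) = star (T c) * (h * star h * T c) := by
          simp only [mul_assoc]
      _ = 0 := by rw [hc, mul_zero]
  have inj2 : ∀ c, h * T c = 0 → T c = 0 := by
    intro c hc
    apply injk
    rw [e2, ← e3, mul_assoc, hc, mul_zero]
  -- the kernel is self-adjoint
  have kstar : ∀ j, T j = 0 → T (star j) = 0 := by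
    intro j hj
    obtain ⟨c, hc⟩ := hstar (star j)
    have := h1 j
    rw [hj, zero_mul, hc] at this
    have := inj2 c this.symm
    rw [← hc] at this
    exact star_eq_zero.mp this
  -- Jordan identity
  have jor : ∀ a, T a * star h * T a = h * star h * T (a * a) := by
    intro a
    rw [mul_assoc, h2, ← mul_assoc, ← h3, mul_assoc, ← e1]
  have jor2 : ∀ a b, T a * star h * T b + T b * star h * T a = h * star h * T (a * b + b * a) := by
    intro a b
    have hab := jor (a + b)
    have e : (a + b) * (a + b) = a * a + b * b + (a * b + b * a) := by noncomm_ring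
    rw [e, map_add, map_add T (a * a + b * b), map_add T (a * a), mul_add (h * star h),
      mul_add (h * star h) (T (a * a)), ← jor, ← jor] at hab
    rw [← sub_eq_zero] at hab ⊢
    rw [← hab]
    noncomm_ring
  have kjor : ∀ j a, T j = 0 → T (j * a + a * j) = 0 := by
    intro j a hj
    apply injk
    rw [← jor2, hj]
    simp
  have two : ∀ a : A, T (a + a) = 0 → T a = 0 := by
    intro a ha
    rw [map_add, ← two_smul ℂ] at ha
    simpa using ha
  have ksq : ∀ j, T j = 0 → T (j * j) = 0 := fun j hj => two _ (kjor j j hj)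
  have ktri1 : ∀ j a, T j = 0 → T (j * a * j) = 0 := by
    intro j a hj
    apply two
    have t1 := kjor j (j * a + a * j) hj
    have t2 := kjor (j * j) a (ksq j hj)
    have e : j * a * j + j * a * j =
      (j * (j * a + a * j) + (j * a + a * j) * j) - (j * j * a + a * (j * j)) := by noncomm_ring
    rw [e, map_sub, t1, t2, sub_zero]
  have ktri2 : ∀ j a, T j = 0 → T (a * j * a) = 0 := by
    intro j a hj
    apply two
    have t1 := kjor (j * a + a * j) a (kjor j a hj)
    have t2 := kjor j (a * a) hj
    have e : a * j * a + a * j * a =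
      ((j * a + a * j) * a + a * (j * a + a * j)) - (j * (a * a) + a * a * j) := by noncomm_ring
    rw [e, map_sub, t1, t2, sub_zero]
  -- the kernel is an ideal
  have kid1 : ∀ j a, IsSelfAdjoint j → IsSelfAdjoint a → T j = 0 → T (j * a) = 0 := by
    intro j a hjs has hj
    have hs : star (j * a) = a * j := by rw [star_mul, hjs.star_eq, has.star_eq]
    have t := jor2 (j * a) (a * j)
    have e : j * a * (a * j) + a * j * (j * a) = j * (a * a) * j + a * (j * j) * a := by
      noncomm_ring
    rw [e, map_add, ktri1 j _ hj, ktri2 (j * j) a (ksq j hj), add_zero, mul_zero, h1, h1, hs,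
      ← hs, star_star, hs, mul_assoc, mul_assoc, ← mul_add] at t
    have hsum : star (T (a * j)) * T (a * j) + star (T (j * a)) * T (j * a) = 0 := by
      obtain ⟨c1, hc1⟩ := hstar (a * j)
      obtain ⟨c2, hc2⟩ := hstar (j * a)
      obtain ⟨c3, hc3⟩ := hmul c1 (a * j)
      obtain ⟨c4, hc4⟩ := hmul c2 (j * a)
      rw [hc1, hc2, hc3, hc4, ← map_add] at t ⊢
      exact inj2 _ t
    let _ := CStarAlgebra.spectralOrder C
    have _ := CStarAlgebra.spectralOrderedRing C
    have := (add_eq_zero_iff_of_nonneg (star_mul_self_nonneg (T (a * j)))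
      (star_mul_self_nonneg (T (j * a)))).mp hsum
    exact (CStarRing.star_mul_self_eq_zero_iff _).mp this.2
  have kid2 : ∀ j a, IsSelfAdjoint j → T j = 0 → T (j * a) = 0 := by
    intro j a hjs hj
    rw [← realPart_add_I_smul_imaginaryPart a, mul_add, mul_smul_comm, map_add, map_smul,
      kid1 j _ hjs (realPart a).2 hj, kid1 j _ hjs (imaginaryPart a).2 hj]
    simp
  have kid : ∀ j a, T j = 0 → T (j * a) = 0 := by
    intro j a hj
    have hr : T (realPart j : A) = 0 := by
      rw [realPart_apply_coe]
      simp [hj, kstar j hj, ← Complex.coe_smul]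
    have hi : T (imaginaryPart j : A) = 0 := by
      rw [imaginaryPart_apply_coe]
      simp [hj, kstar j hj, ← Complex.coe_smul]
    rw [← realPart_add_I_smul_imaginaryPart j, add_mul, smul_mul_assoc, map_add, map_smul,
      kid2 _ a (realPart j).2 hr, kid2 _ a (imaginaryPart j).2 hi]
    simp
  have kid' : ∀ j a, T j = 0 → T (a * j) = 0 := by
    intro j a hj
    have := kstar _ (kid (star j) (star a) (kstar j hj))
    simpa using this
  -- triple identity
  have hk : ∀ c, h * star h * (T c * star h) = T c * star h * (h * star h) := by
    intro c
    obtain ⟨c', hc'⟩ := hstar (star c)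
    rw [h1, hc']
    calc h * star h * (h * T c') = h * (star h * h * T c') := by simp only [mul_assoc]
      _ = h * T c' * (h * star h) := by rw [e3, mul_assoc]
  have tri : ∀ x y, T x * star (T (star y)) * T x = h * star h * T (x * y * x) := by
    intro x y
    obtain ⟨c1, hc1⟩ := hstar (star y)
    obtain ⟨c2, hc2⟩ := hmul x c1
    obtain ⟨c3, hc3⟩ := hmul c2 x
    have a1 := jor2 x (x * y + y * x)
    have a2 := jor2 (x * x) y
    have a3 := jor2 x y
    have a4 := jor x
    have hxyx : x * (x * y + y * x) + (x * y + y * x) * x - (x * x * y + y * (x * x))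
      = (2 : ℂ) • (x * y * x) := by rw [two_smul]; noncomm_ring
    -- abbreviations
    have key : h * star h * (h * star h * T (x * y * x)) =
        h * star h * (T x * star (T (star y)) * T x) := by
      have l1 : (2 : ℂ) • (h * star h * (h * star h * T (x * y * x))) =
          h * star h * (T x * star h * T (x * y + y * x) + T (x * y + y * x) * star h * T x) -
          h * star h * (T (x * x) * star h * T y + T y * star h * T (x * x)) := by
        rw [a1, a2, ← mul_sub, ← mul_sub, ← map_sub, hxyx, map_smul]
        simp only [mul_smul_comm]
      have l2 : h * star h * (T x * star h * T (x * y + y * x)) =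
          T x * star h * (T x * star h * T y + T y * star h * T x) := by
        rw [a3, ← mul_assoc, hk, mul_assoc]
      have l3 : h * star h * (T (x * y + y * x) * star h * T x) =
          (T x * star h * T y + T y * star h * T x) * star h * T x := by
        rw [a3]; simp only [mul_assoc]
      have l4 : h * star h * (T (x * x) * star h * T y) =
          T x * star h * T x * star h * T y := by
        rw [a4]; simp only [mul_assoc]
      have l5 : h * star h * (T y * star h * T (x * x)) =
          T y * star h * (T x * star h * T x) := by
        rw [a4, ← mul_assoc, hk, mul_assoc]
      have l6 : h * star h * (T x * star (T (star y)) * T x) =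
          T x * star h * T y * star h * T x := by
        rw [hc1, hc2, hc3, e2, ← hc3, ← hc2, mul_assoc, ← e2, ← hc1]
        calc T x * star (T (star y)) * (h * star h * T x)
            = T x * (star (T (star y)) * h) * star h * T x := by simp only [mul_assoc]
          _ = _ := by rw [← h2]; simp only [mul_assoc]
      rw [mul_add, mul_add, l2, l3, l4, l5] at l1
      rw [l6]
      have : (2 : ℂ) • (h * star h * (h * star h * T (x * y * x))) =
          (2 : ℂ) • (T x * star h * T y * star h * T x) := by
        rw [l1, two_smul]; noncomm_ring
      exact smul_right_injective C (two_ne_zero : (2 : ℂ) ≠ 0) this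
    -- cancel k
    have d0 : h * star h * (h * star h * T (x * y * x) - T x * star (T (star y)) * T x) = 0 := by
      rw [mul_sub, key, sub_self]
    obtain ⟨c4, hc4⟩ := hid (h * star h) (x * y * x)
    rw [hc1, hc2, hc3, hc4] at d0 ⊢
    rw [← map_sub] at d0
    have := injk _ d0
    rw [map_sub, sub_eq_zero] at this
    exact this.symm
  have tri2 : ∀ x y z, T x * star (T (star y)) * T z + T z * star (T (star y)) * T x =
      h * star h * T (x * y * z + z * y * x) := by
    intro x y z
    have t := tri (x + z) y
    have e : (x + z) * y * (x + z) = x * y * x + z * y * z + (x * y * z + z * y * x) := by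
      noncomm_ring
    rw [e, map_add, map_add T (x * y * x + z * y * z), map_add T (x * y * x),
      mul_add (h * star h), mul_add (h * star h) (T (x * y * x)), ← tri, ← tri] at t
    rw [← sub_eq_zero] at t ⊢
    rw [← t]
    noncomm_ring
  have hz : ∀ z, T x * star (T y) * T z + T z * star (T y) * T x = 0 := by
    intro z
    have t := tri2 x (star y) z
    rw [star_star, map_add, kid _ z hxy, mul_assoc z, kid' _ z hyx] at t
    simpa using t
  obtain ⟨y', hy'⟩ := hstar y
  obtain ⟨p, hp⟩ := hmul x y'
  obtain ⟨q, hq⟩ := hmul y' x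
  have hz' : ∀ z, T p * T z = - (T z * T q) := by
    intro z
    rw [eq_neg_iff_add_eq_zero, ← hp, ← hq, ← hy', ← mul_assoc, hz]
  have pc : ∀ z, T p * T z = T z * T p := by
    intro z
    rw [← sub_eq_zero]
    apply nondeg
    · intro w
      obtain ⟨v, hv⟩ := hmul z w
      rw [sub_mul, mul_assoc, hv, hz', ← hv, mul_assoc, mul_assoc, hz' w]
      simp
    · obtain ⟨c1, hc1⟩ := hmul p z
      obtain ⟨c2, hc2⟩ := hmul z p
      exact ⟨c1 - c2, by rw [map_sub, hc1, hc2]⟩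
  have px : T p * T x = 0 := by
    obtain ⟨v, hv⟩ := hmul p x
    have := hz x
    rw [hy', hp, hv, ← map_add] at this
    rw [hv]; exact two _ this
  have pp : T p * T p = 0 := by
    rw [← hp, ← mul_assoc, hp, px, zero_mul]
  have p0 : T p = 0 := by
    obtain ⟨p', hp'⟩ := hstar p
    rw [← CStarRing.star_mul_self_eq_zero_iff, ← CStarRing.star_mul_self_eq_zero_iff]
    rw [star_mul, star_star, hp', ← pc p']
    calc T p * T p' * (T p * T p') = T p * (T p' * T p) * T p' := by simp only [mul_assoc]
      _ = T p * T p * T p' * T p' := by rw [← pc p']; simp only [mul_assoc]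
      _ = 0 := by rw [pp]; simp
  have q0 : T q = 0 := by
    apply nondeg' _ _ ⟨q, rfl⟩
    intro a
    have := hz' a
    rw [p0, zero_mul] at this
    exact neg_eq_zero.mp this.symm
  rw [hy', hp, hq]
  exact ⟨p0, q0⟩

end alg
section limits

open Filter Topology

variable {A B : Type*} [NonUnitalCStarAlgebra A] [NonUnitalCStarAlgebra B]

open scoped ContinuousMapZero in
/-- Power identities on a single self-adjoint element. -/
lemma op_powers (T : A →L[ℂ] B)
    (hT : ∀ a b : A, IsSelfAdjoint a → IsSelfAdjoint b → a * b = 0 → T a * star (T b) = 0)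
    (a : A) (ha : IsSelfAdjoint a) :
    T (a * a) * star (T a) = T a * star (T (a * a)) ∧
    T (a * a * a) * star (T a) = T (a * a) * star (T (a * a)) := by
  let ι : C(quasispectrum ℝ a, ℝ)₀ := ContinuousMapZero.id (quasispectrum ℝ a)
  let S : C(quasispectrum ℝ a, ℝ) → C(quasispectrum ℝ a, ℝ)₀ := fun f =>
    ⟨f * (ι : C(quasispectrum ℝ a, ℝ)), by
      change f 0 * ι 0 = 0
      rw [map_zero ι, mul_zero]⟩
  have hSn : ∀ f, ‖S f‖ ≤ ‖f‖ * ‖(ι : C(quasispectrum ℝ a, ℝ))‖ := fun f =>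
    norm_mul_le f (ι : C(quasispectrum ℝ a, ℝ))
  let Ψ : C(quasispectrum ℝ a, ℝ) →ₗ[ℝ] A :=
    { toFun := fun f => cfcₙHom ha (S f)
      map_add' := fun f g => by
        rw [← map_add]; congr 1; ext t; exact add_mul _ _ _
      map_smul' := fun c f => by
        rw [RingHom.id_apply, ← map_smul]; congr 1; ext t; exact mul_assoc _ _ _ }
  have hΨn : ∀ f, ‖Ψ f‖ ≤ ‖f‖ * ‖(ι : C(quasispectrum ℝ a, ℝ))‖ := fun f => by
    change ‖cfcₙHom ha (S f)‖ ≤ _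
    rw [norm_cfcₙHom a _ ha]; exact hSn f
  have hΨsa : ∀ f, IsSelfAdjoint (Ψ f) := fun f => cfcₙHom_predicate ha _
  have hΨmul : ∀ f g, f * g = 0 → Ψ f * Ψ g = 0 := fun f g hfg => by
    change cfcₙHom ha (S f) * cfcₙHom ha (S g) = 0
    rw [← map_mul]
    have : S f * S g = 0 := by
      ext t
      have h := DFunLike.congr_fun hfg t
      change f t * g t = 0 at h
      change (f t * ι t) * (g t * ι t) = 0
      linear_combination (ι t * ι t) * h
    rw [this, map_zero]
  let u : C(quasispectrum ℝ a, ℝ) := ι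
  have hid : cfcₙHom ha ι = a := cfcₙHom_id ha
  have hΨ1 : Ψ 1 = a := by
    change cfcₙHom ha (S 1) = a
    have e : S 1 = ι := by ext t; exact one_mul _
    rw [e]; exact hid
  have hΨ2 : Ψ u = a * a := by
    change cfcₙHom ha (S u) = a * a
    have e : S u = ι * ι := by ext t; rfl
    rw [e, map_mul]
    exact congrArg₂ (· * ·) hid hid
  have hΨ3 : Ψ (u * u) = a * a * a := by
    change cfcₙHom ha (S (u * u)) = a * a * a
    have e : S (u * u) = ι * ι * ι := by ext t; rfl
    rw [e, map_mul, map_mul]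
    exact congrArg₂ (· * ·) (congrArg₂ (· * ·) hid hid) hid
  have hTr : ∀ (c : ℝ) (x : A), T (c • x) = c • T x := fun c x => by
    rw [← Complex.coe_smul, map_smul, Complex.coe_smul]
  let V : C(quasispectrum ℝ a, ℝ) →ₗ[ℝ] C(quasispectrum ℝ a, ℝ) →ₗ[ℝ] B :=
    LinearMap.mk₂ ℝ (fun f g => T (Ψ f) * star (T (Ψ g)))
      (fun f f' g => by rw [map_add, map_add, add_mul])
      (fun c f g => by rw [map_smul, hTr, smul_mul_assoc])
      (fun f g g' => by rw [map_add, map_add, star_add, mul_add])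
      (fun c f g => by
        rw [map_smul, hTr, star_smul, star_trivial, mul_smul_comm])
  have hV : ∀ f g, V f g = T (Ψ f) * star (T (Ψ g)) := fun f g => rfl
  set c := ‖(ι : C(quasispectrum ℝ a, ℝ))‖ with hc
  have hTn : ∀ f, ‖T (Ψ f)‖ ≤ ‖T‖ * c * ‖f‖ := fun f => by
    calc ‖T (Ψ f)‖ ≤ ‖T‖ * ‖Ψ f‖ := T.le_opNorm _
      _ ≤ ‖T‖ * (‖f‖ * c) := by gcongr; exact hΨn f
      _ = _ := by ring
  have hb := op_balanced V ((‖T‖ * c) ^ 2) (fun f g => by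
      rw [hV]
      calc _ ≤ ‖T (Ψ f)‖ * ‖star (T (Ψ g))‖ := norm_mul_le _ _
        _ ≤ (‖T‖ * c * ‖f‖) * (‖T‖ * c * ‖g‖) := by
          rw [norm_star]; gcongr <;> exact hTn _
        _ = _ := by ring) (by positivity)
    (fun f g hfg => hT _ _ (hΨsa f) (hΨsa g) (hΨmul f g hfg))
  constructor
  · have := hb u 1 1
    rwa [mul_one, hV, hV, hΨ1, hΨ2] at this
  · have := hb u u 1
    rwa [mul_one, hV, hV, hΨ1, hΨ2, hΨ3] at this

lemma op_six {b : B} (h : (6 : ℕ) • b = 0) : b = 0 := by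
  rw [← Nat.cast_smul_eq_nsmul ℂ] at h
  simpa using h

/-- Linearised degree three identity. -/
lemma op_lin3 (T : A →L[ℂ] B)
    (hT : ∀ a b : A, IsSelfAdjoint a → IsSelfAdjoint b → a * b = 0 → T a * star (T b) = 0)
    (y e : A) (hy : IsSelfAdjoint y) (he : IsSelfAdjoint e) :
    T (y * y * y) * star (T e) = T (y * y) * star (T (y * e + e * y))
      + T (y * e + e * y) * star (T (y * y))
      - T (y * y * e + y * e * y + e * y * y) * star (T y) := by
  have F : ∀ a, IsSelfAdjoint a →
      T (a * a * a) * star (T a) - T (a * a) * star (T (a * a)) = 0 :=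
    fun a ha => sub_eq_zero.mpr (op_powers T hT a ha).2
  have f0 := F y hy
  have f4 := F e he
  have f1 := F (y + e) (hy.add he)
  have f2 := F (y - e) (hy.sub he)
  have f3 := F (y + (e + e)) (hy.add (he.add he))
  rw [← sub_eq_zero]
  apply op_six
  have : (0 : B) = (6 : ℕ) • (T ((y + e) * (y + e) * (y + e)) * star (T (y + e)) -
      T ((y + e) * (y + e)) * star (T ((y + e) * (y + e))))
      - (2 : ℕ) • (T ((y - e) * (y - e) * (y - e)) * star (T (y - e)) -
      T ((y - e) * (y - e)) * star (T ((y - e) * (y - e))))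
      - (T ((y + (e + e)) * (y + (e + e)) * (y + (e + e))) * star (T (y + (e + e))) -
      T ((y + (e + e)) * (y + (e + e))) * star (T ((y + (e + e)) * (y + (e + e)))))
      - (3 : ℕ) • (T (y * y * y) * star (T y) - T (y * y) * star (T (y * y)))
      + (12 : ℕ) • (T (e * e * e) * star (T e) - T (e * e) * star (T (e * e))) := by
    rw [f0, f1, f2, f3, f4]; simp
  rw [this]
  simp only [add_mul, mul_add, sub_mul, mul_sub, map_add, map_sub, star_add, star_sub,
    ← mul_assoc]
  abel

variable [PartialOrder A] [StarOrderedRing A]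

lemma op_cube (T : A →L[ℂ] B)
    (hT : ∀ a b : A, IsSelfAdjoint a → IsSelfAdjoint b → a * b = 0 → T a * star (T b) = 0)
    {l : Filter A} (hl : l.IsIncreasingApproximateUnit) (y : A) (hy : IsSelfAdjoint y) :
    Tendsto (fun e => T (y * y * y) * star (T e)) l (𝓝 (T (y * y) * star (T y))) := by
  have hL : ∀ m : A, Tendsto (fun e => m * e) l (𝓝 m) := hl.tendsto_mul_left
  have hR : ∀ m : A, Tendsto (fun e => e * m) l (𝓝 m) := hl.tendsto_mul_right
  have hM : Tendsto (fun e => y * e * y) l (𝓝 (y * y)) := (hL y).mul_const y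
  have hR2 : Tendsto (fun e => e * y * y) l (𝓝 (y * y)) := (hR y).mul_const y
  have hs : Tendsto (fun e => y * e + e * y) l (𝓝 (y + y)) := (hL y).add (hR y)
  have ht : Tendsto (fun e => y * y * e + y * e * y + e * y * y) l (𝓝 (y * y + y * y + y * y)) :=
    ((hL (y * y)).add hM).add hR2
  have hTs := (T.continuous.tendsto _).comp hs
  have hTt := (T.continuous.tendsto _).comp ht
  have key := ((hTs.star.const_mul (T (y * y))).add (hTs.mul_const (star (T (y * y))))).sub
    (hTt.mul_const (star (T y)))
  have lim : T (y * y) * star (T (y + y)) + T (y + y) * star (T (y * y)) -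
      T (y * y + y * y + y * y) * star (T y) = T (y * y) * star (T y) := by
    have := (op_powers T hT y hy).1
    simp only [map_add, star_add, mul_add, add_mul, ← this]
    abel
  rw [lim] at key
  refine key.congr' ?_
  filter_upwards [hl.eventually_isSelfAdjoint] with e he
  exact (op_lin3 T hT y e hy he).symm

lemma op_lim_exists (T : A →L[ℂ] B)
    (hT : ∀ a b : A, IsSelfAdjoint a → IsSelfAdjoint b → a * b = 0 → T a * star (T b) = 0)
    {l : Filter A} (hl : l.IsIncreasingApproximateUnit) (x : A) :
    ∃ r, Tendsto (fun e => T x * star (T e)) l (𝓝 r) ∧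
      Tendsto (fun e => T e * star (T (star x))) l (𝓝 r) := by
  have hx : x ∈ Submodule.span ℂ {a : A | 0 ≤ a} := by
    rw [CStarAlgebra.span_nonneg]; trivial
  induction hx using Submodule.span_induction with
  | mem x hx =>
    have hx : 0 ≤ x := hx
    obtain ⟨y, hy, rfl⟩ : ∃ y : A, 0 ≤ y ∧ y * y * y = x := by
      refine ⟨x ^ ((3 : NNReal)⁻¹), CFC.nnrpow_nonneg, ?_⟩
      rw [← CFC.nnrpow_three _ CFC.nnrpow_nonneg, CFC.nnrpow_inv_nnrpow _ (by norm_num) hx]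
    have hys : IsSelfAdjoint y := .of_nonneg hy
    have h := op_cube T hT hl y hys
    refine ⟨_, h, ?_⟩
    have h' := h.star
    have hs : star (y * y * y) = y * y * y := by simp [hys.star_eq, mul_assoc]
    simp only [star_mul, star_star] at h'
    rw [← (op_powers T hT y hys).1] at h'
    simpa only [hs] using h'
  | zero => exact ⟨0, by simp [tendsto_const_nhds], by simp [tendsto_const_nhds]⟩
  | add x y _ _ hx hy =>
    obtain ⟨r, h1, h2⟩ := hx
    obtain ⟨s, h3, h4⟩ := hy
    refine ⟨r + s, ?_, ?_⟩
    · simpa [add_mul] using h1.add h3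
    · simpa [mul_add] using h2.add h4
  | smul c x _ hx =>
    obtain ⟨r, h1, h2⟩ := hx
    refine ⟨c • r, ?_, ?_⟩
    · simpa [smul_mul_assoc] using h1.const_smul c
    · simpa [mul_smul_comm] using h2.const_smul c

/-- Pointwise limits of bounded families of continuous linear maps. -/
lemma op_lim_clm {I X Y : Type*} [NormedAddCommGroup X] [NormedSpace ℂ X]
    [NormedAddCommGroup Y] [NormedSpace ℂ Y] {l : Filter I} [l.NeBot] (F : I → X →L[ℂ] Y)
    (M : ℝ) (hM : ∀ᶠ i in l, ‖F i‖ ≤ M) (h : ∀ x, ∃ r, Tendsto (fun i => F i x) l (𝓝 r)) :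
    ∃ G : X →L[ℂ] Y, ∀ x, Tendsto (fun i => F i x) l (𝓝 (G x)) := by
  choose g hg using h
  let G₀ : X →ₗ[ℂ] Y :=
    { toFun := g
      map_add' := fun x y => tendsto_nhds_unique (hg (x + y)) (by simpa using (hg x).add (hg y))
      map_smul' := fun c x => tendsto_nhds_unique (hg (c • x))
        (by simpa using (hg x).const_smul c) }
  refine ⟨G₀.mkContinuous M fun x => ?_, fun x => hg x⟩
  refine le_of_tendsto (hg x).norm ?_
  filter_upwards [hM] with i hi
  exact (F i).le_of_opNorm_le hi x

lemma op_square (T : A →L[ℂ] B)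
    (hT : ∀ a b : A, IsSelfAdjoint a → IsSelfAdjoint b → a * b = 0 → T a * star (T b) = 0)
    {l : Filter A} (hl : l.IsIncreasingApproximateUnit) (a : A) :
    Tendsto (fun e => T (a * a) * star (T e)) l (𝓝 (T a * star (T (star a)))) := by
  have := hl.neBot
  obtain ⟨R, hR⟩ := op_lim_clm (l := l)
    (fun e : A => ((ContinuousLinearMap.mul ℂ B).flip (star (T e))).comp T)
    (‖T‖ * ‖T‖) (by
      filter_upwards [hl.eventually_norm] with e he
      refine ContinuousLinearMap.opNorm_le_bound _ (by positivity) fun x => ?_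
      calc ‖T x * star (T e)‖ ≤ ‖T x‖ * ‖star (T e)‖ := norm_mul_le _ _
        _ ≤ (‖T‖ * ‖x‖) * (‖T‖ * 1) := by
          rw [norm_star]
          gcongr
          · exact T.le_opNorm x
          · exact (T.le_opNorm e).trans (by gcongr)
        _ = _ := by ring)
    (fun x => (op_lim_exists T hT hl x).imp fun r hr => hr.1)
  have hR : ∀ x, Tendsto (fun e => T x * star (T e)) l (𝓝 (R x)) := hR
  have cube : ∀ y, IsSelfAdjoint y → R (y * y * y) - T (y * y) * star (T y) = 0 := fun y hy =>
    sub_eq_zero.mpr (tendsto_nhds_unique (hR _) (op_cube T hT hl y hy))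
  have lin : ∀ y e, IsSelfAdjoint y → IsSelfAdjoint e →
      R (y * y * e + y * e * y + e * y * y) =
        T (y * y) * star (T e) + T (y * e + e * y) * star (T y) := by
    intro y e hy he
    have f1 := cube (y + e) (hy.add he)
    have f2 := cube (y - e) (hy.sub he)
    have f3 := cube e he
    rw [← sub_eq_zero]
    apply op_six
    have : (0 : B) = (3 : ℕ) • (R ((y + e) * (y + e) * (y + e)) -
        T ((y + e) * (y + e)) * star (T (y + e)))
        - (3 : ℕ) • (R ((y - e) * (y - e) * (y - e)) -
        T ((y - e) * (y - e)) * star (T (y - e)))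
        - (6 : ℕ) • (R (e * e * e) - T (e * e) * star (T e)) := by
      rw [f1, f2, f3]; simp
    rw [this]
    simp only [add_mul, mul_add, sub_mul, mul_sub, map_add, map_sub, star_add, star_sub,
      ← mul_assoc]
    abel
  have sq : ∀ y, IsSelfAdjoint y → R (y * y) = T y * star (T y) := by
    intro y hy
    have hLm : ∀ m : A, Tendsto (fun e => m * e) l (𝓝 m) := hl.tendsto_mul_left
    have hRm : ∀ m : A, Tendsto (fun e => e * m) l (𝓝 m) := hl.tendsto_mul_right
    have ht : Tendsto (fun e => y * y * e + y * e * y + e * y * y) l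
        (𝓝 (y * y + y * y + y * y)) :=
      ((hLm (y * y)).add ((hLm y).mul_const y)).add ((hRm y).mul_const y)
    have hs : Tendsto (fun e => y * e + e * y) l (𝓝 (y + y)) := (hLm y).add (hRm y)
    have t1 := (R.continuous.tendsto _).comp ht
    have t2 := (hR (y * y)).add (((T.continuous.tendsto _).comp hs).mul_const (star (T y)))
    have t3 := tendsto_nhds_unique_of_eventuallyEq t1 t2 (by
      filter_upwards [hl.eventually_isSelfAdjoint] with e he
      exact lin y e hy he)
    rw [← sub_eq_zero] at t3 ⊢
    apply op_six
    have : (0 : B) = (3 : ℕ) • (R (y * y + y * y + y * y) -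
      (R (y * y) + T (y + y) * star (T y))) := by rw [t3]; simp
    rw [this]
    simp only [map_add, add_mul]
    abel
  have sq2 : ∀ y z, IsSelfAdjoint y → IsSelfAdjoint z →
      R (y * z + z * y) = T y * star (T z) + T z * star (T y) := by
    intro y z hy hz
    have f1 := sub_eq_zero.mpr (sq (y + z) (hy.add hz))
    have f2 := sub_eq_zero.mpr (sq y hy)
    have f3 := sub_eq_zero.mpr (sq z hz)
    rw [← sub_eq_zero]
    have : (0 : B) = (R ((y + z) * (y + z)) - T (y + z) * star (T (y + z))) -
      (R (y * y) - T y * star (T y)) - (R (z * z) - T z * star (T z)) := by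
      rw [f1, f2, f3]; simp
    rw [this]
    simp only [map_add, star_add, add_mul, mul_add]
    abel
  have final : R (a * a) = T a * star (T (star a)) := by
    obtain ⟨y, z, hy, hz, rfl⟩ : ∃ y z : A, IsSelfAdjoint y ∧ IsSelfAdjoint z ∧
        a = y + Complex.I • z :=
      ⟨_, _, (realPart a).2, (imaginaryPart a).2, (realPart_add_I_smul_imaginaryPart a).symm⟩
    have e1 : (y + Complex.I • z) * (y + Complex.I • z) =
        y * y - z * z + Complex.I • (y * z + z * y) := by
      simp only [add_mul, mul_add, smul_mul_assoc, mul_smul_comm, smul_smul, Complex.I_mul_I,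
        smul_add, neg_smul, one_smul]
      abel
    rw [e1, map_add, map_sub, map_smul, sq y hy, sq z hz, sq2 y z hy hz]
    simp only [map_add, map_smul, star_add, star_smul, hy.star_eq, hz.star_eq, add_mul, mul_add,
      smul_mul_assoc, mul_smul_comm, smul_smul, smul_add, star_star, Complex.I_mul_I, neg_smul,
      one_smul]
    abel
  rw [← final]
  exact hR _

end limits
section final

open Filter Topology
open scoped MultiplierAlgebra

variable {B : Type*} [NonUnitalCStarAlgebra B]

lemma op_mul_coe (m : 𝓜(ℂ, B)) (b : B) : m * (b : 𝓜(ℂ, B)) = ((m.fst b : B) : 𝓜(ℂ, B)) := by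
  refine DoubleCentralizer.ext _ _ _ _ (Prod.ext ?_ ?_)
  · ext c
    change m.fst (b * c) = m.fst b * c
    letI := CStarAlgebra.spectralOrder B
    have key : ∀ z, z * (m.fst (b * c) - m.fst b * c) = 0 := by
      intro z
      rw [mul_sub, ← m.central, ← mul_assoc, ← mul_assoc, ← m.central, sub_self]
    have := key (star (m.fst (b * c) - m.fst b * c))
    exact sub_eq_zero.mp ((CStarRing.star_mul_self_eq_zero_iff _).mp this)
  · ext c
    exact m.central c b

lemma op_star_coe (b : B) : star (b : 𝓜(ℂ, B)) = ((star b : B) : 𝓜(ℂ, B)) :=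
  ((DoubleCentralizer.coeHom (𝕜 := ℂ) (A := B)).map_star' b).symm

lemma op_coe_mul (m : 𝓜(ℂ, B)) (b : B) : (b : 𝓜(ℂ, B)) * m = ((m.snd b : B) : 𝓜(ℂ, B)) := by
  have := congrArg star (op_mul_coe (star m) (star b))
  rw [star_mul, star_star, op_star_coe, op_star_coe, star_star] at this
  rw [this]
  simp

lemma op_coe_inj (b : B) (h : (b : 𝓜(ℂ, B)) = 0) : b = 0 := by
  have h' : (b : 𝓜(ℂ, B)).fst (star b) = 0 := by rw [h]; rfl
  exact (CStarRing.mul_star_self_eq_zero_iff _).mp h'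

end final

open Filter Topology
open scoped MultiplierAlgebra

/-- If `T` is a continuous surjective orthogonality preserving linear operator between
C*-algebras, then whenever `x y* ∈ ker T` and `y* x ∈ ker T` one has `T x ⊥ T y`;
equivalently, the induced bijection on the quotient `A / ker T` is orthogonality
preserving. -/
theorem quotient_of_surjective_orthogonality_preserving {A B : Type*}
    [NonUnitalCStarAlgebra A] [NonUnitalCStarAlgebra B] (T : A →L[ℂ] B)
    (hsurj : Function.Surjective T)
    (hT : ∀ a b : A, IsOrthogonal a b → IsOrthogonal (T a) (T b)) :
    ∀ x y : A, T (x * star y) = 0 → T (star y * x) = 0 → IsOrthogonal (T x) (T y) := by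
  intro x y hxy hyx
  let _ := CStarAlgebra.spectralOrder A
  have _ := CStarAlgebra.spectralOrderedRing A
  have orth : ∀ a b : A, IsSelfAdjoint a → IsSelfAdjoint b → a * b = 0 →
      IsOrthogonal (T a) (T b) := by
    intro a b ha hb hab
    apply hT
    refine ⟨by rw [hb.star_eq, hab], ?_⟩
    have := congrArg star hab
    rw [star_mul, ha.star_eq, star_zero] at this
    exact this
  -- the adjoint operator
  let T' : A →L[ℂ] B := ((starL ℂ : B ≃L⋆[ℂ] B) : B →L⋆[ℂ] B).comp
    (T.comp ((starL ℂ : A ≃L⋆[ℂ] A) : A →L⋆[ℂ] A))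
  have hT'a : ∀ a, T' a = star (T (star a)) := fun a => rfl
  have hTl : ∀ a b : A, IsSelfAdjoint a → IsSelfAdjoint b → a * b = 0 →
      T a * star (T b) = 0 := fun a b ha hb hab => (orth a b ha hb hab).1
  have hTr : ∀ a b : A, IsSelfAdjoint a → IsSelfAdjoint b → a * b = 0 →
      T' a * star (T' b) = 0 := by
    intro a b ha hb hab
    rw [hT'a, hT'a, ha.star_eq, hb.star_eq, star_star]
    have h0 : b * a = 0 := by
      have := congrArg star hab
      rwa [star_mul, ha.star_eq, hb.star_eq, star_zero] at this
    exact (orth b a hb ha h0).2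
  have hl := CStarAlgebra.increasingApproximateUnit A
  set l := CStarAlgebra.approximateUnit A with hldef
  have := hl.neBot
  have hstarE : ∀ᶠ e in l, star e = e := hl.eventually_star_eq
  have hnorm : ∀ᶠ e in l, ‖T e‖ ≤ ‖T‖ := by
    filter_upwards [hl.eventually_norm] with e he
    exact (T.le_opNorm e).trans (mul_le_of_le_one_right (norm_nonneg _) he)
  have lim1 := fun x => op_lim_exists T hTl hl x
  have lim2 : ∀ x, ∃ r, Tendsto (fun e => star (T (star x)) * T e) l (𝓝 r) ∧
      Tendsto (fun e => star (T e) * T x) l (𝓝 r) := by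
    intro x
    obtain ⟨r, h1, h2⟩ := op_lim_exists T' hTr hl x
    refine ⟨r, h1.congr' ?_, h2.congr' ?_⟩
    · filter_upwards [hstarE] with e he
      rw [hT'a, hT'a, he, star_star]
    · filter_upwards [hstarE] with e he
      rw [hT'a, hT'a, he, star_star, star_star]
  obtain ⟨L, hL⟩ := op_lim_clm (l := l) (fun e : A => ContinuousLinearMap.mul ℂ B (T e)) ‖T‖
    (by
      filter_upwards [hnorm] with e he
      exact (ContinuousLinearMap.opNorm_mul_apply_le ℂ B (T e)).trans he)
    (fun b => by
      obtain ⟨w, hw⟩ := hsurj (star b)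
      obtain ⟨r, -, hr⟩ := lim1 (star w)
      rw [star_star, hw, star_star] at hr
      exact ⟨r, hr⟩)
  obtain ⟨R, hR⟩ := op_lim_clm (l := l) (fun e : A => (ContinuousLinearMap.mul ℂ B).flip (T e)) ‖T‖
    (by
      filter_upwards [hnorm] with e he
      refine (ContinuousLinearMap.opNorm_le_bound _ (norm_nonneg _) fun b => ?_).trans he
      rw [mul_comm]
      exact norm_mul_le b (T e))
    (fun b => by
      obtain ⟨w, hw⟩ := hsurj (star b)
      obtain ⟨r, hr, -⟩ := lim2 (star w)
      rw [star_star, hw, star_star] at hr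
      exact ⟨r, hr⟩)
  have hL : ∀ b, Tendsto (fun e => T e * b) l (𝓝 (L b)) := hL
  have hR : ∀ b, Tendsto (fun e => b * T e) l (𝓝 (R b)) := hR
  let h : 𝓜(ℂ, B) := ⟨(L, R), fun b c => by
    refine tendsto_nhds_unique ((hR b).mul_const c) ?_
    have := (hL c).const_mul b
    simpa only [mul_assoc] using this⟩
  let c : B →⋆ₙₐ[ℂ] 𝓜(ℂ, B) := DoubleCentralizer.coeHom
  let S : A →ₗ[ℂ] 𝓜(ℂ, B) :=
    { toFun := fun a => c (T a)
      map_add' := fun a b => by rw [map_add, map_add]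
      map_smul' := fun z a => by rw [map_smul, map_smul]; rfl }
  have hS : ∀ a, S a = ((T a : B) : 𝓜(ℂ, B)) := fun a => rfl
  have hstarL : ∀ b, Tendsto (fun e => star b * star (T e)) l (𝓝 (star (L b))) := fun b => by
    simpa only [star_mul] using (hL b).star
  have hstarR : ∀ b, Tendsto (fun e => star (T e) * star b) l (𝓝 (star (R b))) := fun b => by
    simpa only [star_mul] using (hR b).star
  have res := op_algebra S h
    (fun m a => by
      obtain ⟨w, hw⟩ := hsurj (m.fst (T a))
      exact ⟨w, by rw [hS, hS, op_mul_coe, hw]⟩)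
    (fun a => by
      obtain ⟨w, hw⟩ := hsurj (star (T a))
      exact ⟨w, by rw [hS, hS, op_star_coe, hw]⟩)
    (fun a => by
      rw [hS, hS, op_coe_mul, op_star_coe, op_mul_coe, DoubleCentralizer.star_snd]
      congr 1
      change star (L (star (T a))) = L (star (T (star a)))
      obtain ⟨r, h1, h2⟩ := lim1 a
      rw [tendsto_nhds_unique (hL _) h2]
      have := hstarL (star (T a))
      rw [star_star] at this
      exact tendsto_nhds_unique this h1)
    (fun a => by
      rw [hS, hS, op_mul_coe, op_star_coe, op_coe_mul, DoubleCentralizer.star_fst]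
      congr 1
      change star (R (star (T a))) = R (star (T (star a)))
      obtain ⟨r, h1, h2⟩ := lim2 a
      rw [tendsto_nhds_unique (hR _) h1]
      have := hstarR (star (T a))
      rw [star_star] at this
      exact tendsto_nhds_unique this h2)
    (fun a => by
      rw [hS, hS, hS, op_coe_mul, op_star_coe, op_mul_coe, DoubleCentralizer.star_snd]
      congr 1
      change star (L (star (T (a * a)))) = T a * star (T (star a))
      have := hstarL (star (T (a * a)))
      rw [star_star] at this
      exact tendsto_nhds_unique this (op_square T hTl hl a))
    x y (by rw [hS, hxy]; exact map_zero c) (by rw [hS, hyx]; exact map_zero c)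
  rw [hS, hS, op_star_coe, op_mul_coe, op_mul_coe] at res
  exact ⟨op_coe_inj _ res.1, op_coe_inj _ res.2⟩
end

section
/- Let T : A → B be a bijective bounded linear operator between C*-algebras. Then T is orthogonality preserving if and only if T is biorthogonality preserving, i.e., for all a, b ∈ A one has a ⊥ b if and only if T(a) ⊥ T(b). -/
/-- Hat function. -/
noncomputable def hat (i : ℤ) (t : ℝ) : ℝ := max 0 (1 - |t - i|)

lemma hat_continuous (i : ℤ) : Continuous (hat i) := by
  unfold hat; fun_prop

lemma hat_nonneg (i : ℤ) (t : ℝ) : 0 ≤ hat i t := le_max_left _ _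

lemma hat_mul (i j : ℤ) (h : 2 ≤ |i - j|) (t : ℝ) : hat i t * hat j t = 0 := by
  have h2 : (2 : ℝ) ≤ |(i : ℝ) - j| := by exact_mod_cast h
  have h3 : |(i : ℝ) - j| ≤ |t - i| + |t - j| := by
    have := abs_sub (t - j) (t - i)
    have e : (i : ℝ) - j = (t - j) - (t - i) := by ring
    rw [e]; linarith
  unfold hat
  by_cases h4 : 1 ≤ |t - i|
  · rw [max_eq_left (by linarith), zero_mul]
  · rw [max_eq_left (a := (0 : ℝ)) (b := 1 - |t - j|) (by push Not at h4; linarith), mul_zero]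

lemma hat_sum (N : ℤ) (t : ℝ) (ht : |t| ≤ N) (α : ℤ → ℝ) :
    ∑ i ∈ Finset.Icc (-(N + 1)) (N + 1), α i * hat i t =
      α ⌊t⌋ * (1 - Int.fract t) + α (⌊t⌋ + 1) * Int.fract t := by
  have h1 := Int.floor_le t
  have h2 := Int.lt_floor_add_one t
  have hf : t = ⌊t⌋ + Int.fract t := (Int.floor_add_fract t).symm
  have hf0 := Int.fract_nonneg t
  have hf1 := Int.fract_lt_one t
  have ht' := abs_le.1 ht
  have hsub : ({⌊t⌋, ⌊t⌋ + 1} : Finset ℤ) ⊆ Finset.Icc (-(N + 1)) (N + 1) := by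
    intro k hk
    have a1 : ⌊t⌋ ≤ N := by
      have : (⌊t⌋ : ℝ) ≤ N := by linarith
      exact_mod_cast this
    have a2 : -(N + 1) ≤ ⌊t⌋ := by
      have : (-(N + 1) : ℝ) ≤ ⌊t⌋ := by linarith
      exact_mod_cast this
    simp only [Finset.mem_insert, Finset.mem_singleton] at hk
    rw [Finset.mem_Icc]; omega
  rw [← Finset.sum_subset hsub, Finset.sum_pair (by omega)]
  · congr 1
    · congr 1
      unfold hat
      have : t - ⌊t⌋ = Int.fract t := rfl
      rw [this, abs_of_nonneg hf0, max_eq_right (by linarith)]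
    · congr 1
      unfold hat
      have : t - ((⌊t⌋ + 1 : ℤ) : ℝ) = Int.fract t - 1 := by push_cast; linarith
      rw [this, abs_of_nonpos (by linarith), max_eq_right (by linarith)]; ring
  · intro k _ hk
    simp only [Finset.mem_insert, Finset.mem_singleton, not_or] at hk
    have : hat k t = 0 := by
      unfold hat
      apply max_eq_left
      rcases lt_or_gt_of_ne hk.1 with h | h
      · have : (k : ℝ) + 1 ≤ ⌊t⌋ := by exact_mod_cast h
        have := le_abs_self (t - k)
        linarith
      · have h' : ⌊t⌋ + 2 ≤ k := by omega
        have : (⌊t⌋ : ℝ) + 2 ≤ k := by exact_mod_cast h'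
        have := neg_abs_le (t - k)
        linarith
    rw [this, mul_zero]

lemma cfc_hat_sum {E : Type*} [CStarAlgebra E] (b : E) (S : Finset ℤ)
    (α : ℤ → ℝ) :
    ∑ i ∈ S, ((α i : ℝ) : ℂ) • cfc (hat i) b = cfc (fun t => ∑ i ∈ S, α i * hat i t) b := by
  have hc (i : ℤ) : Continuous (hat i) := hat_continuous i
  have e : (fun t => ∑ i ∈ S, α i * hat i t) = ∑ i ∈ S, fun t => α i * hat i t := by
    ext t; simp
  rw [e, cfc_sum (fun i t => α i * hat i t) b S (fun i _ => by fun_prop)]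
  refine Finset.sum_congr rfl fun i _ => ?_
  rw [cfc_const_mul (α i) (hat i) b (hc i).continuousOn]
  simp

lemma bilin_sum {E X : Type*} [AddCommGroup E] [Module ℂ E] [AddCommGroup X] [Module ℂ X]
    (φ : E →ₗ[ℂ] E →ₗ[ℂ] X) (S : Finset ℤ) (H : ℤ → E) (α β : ℤ → ℝ) :
    φ (∑ i ∈ S, ((α i : ℝ) : ℂ) • H i) (∑ j ∈ S, ((β j : ℝ) : ℂ) • H j) =
      ∑ i ∈ S, ∑ j ∈ S, ((α i * β j : ℝ) : ℂ) • φ (H i) (H j) := by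
  simp only [map_sum, LinearMap.sum_apply, map_smul, LinearMap.smul_apply, Finset.smul_sum,
    smul_smul, Complex.ofReal_mul]
  rw [Finset.sum_comm]
  refine Finset.sum_congr rfl fun i _ => Finset.sum_congr rfl fun j _ => ?_
  rw [mul_comm]

/-- residue indicator -/
noncomputable def resi (r : ℤ) (i : ℤ) : ℝ := if i % 3 = r then 1 else 0

lemma balance_bound {E X : Type*} [CStarAlgebra E] [NormedAddCommGroup X] [NormedSpace ℂ X]
    (φ : E →ₗ[ℂ] E →ₗ[ℂ] X) (C : ℝ) (hC : ∀ F G, ‖φ F G‖ ≤ C * ‖F‖ * ‖G‖) (hC0 : 0 ≤ C)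
    (b : E) (hb : IsSelfAdjoint b)
    (h0 : ∀ f g : ℝ → ℝ, Continuous f → Continuous g → (∀ t, f t * g t = 0) →
      φ (cfc f b) (cfc g b) = 0) :
    ‖φ b 1 - φ 1 b‖ ≤ 6 * C := by
  obtain ⟨N, hN⟩ : ∃ N : ℤ, ‖b‖ * ‖(1 : E)‖ ≤ N := ⟨_, Int.le_ceil _⟩
  set S := Finset.Icc (-(N + 1)) (N + 1) with hS
  have hspec : ∀ t ∈ spectrum ℝ b, |t| ≤ N := fun t ht =>
    (spectrum.norm_le_norm_mul_of_mem ht).trans hN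
  have h1 : (1 : E) = ∑ i ∈ S, (((fun _ => 1 : ℤ → ℝ) i : ℝ) : ℂ) • cfc (hat i) b := by
    rw [cfc_hat_sum b, ← cfc_one ℝ b]
    refine cfc_congr fun t ht => ?_
    rw [hat_sum N t (hspec t ht) (fun _ => 1)]; simp
  have h2 : b = ∑ i ∈ S, (((fun i => i : ℤ → ℝ) i : ℝ) : ℂ) • cfc (hat i) b := by
    rw [cfc_hat_sum b]
    conv_lhs => rw [← cfc_id ℝ b]
    refine cfc_congr fun t ht => ?_
    rw [hat_sum N t (hspec t ht) (fun i => i)]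
    have := Int.floor_add_fract t
    push_cast
    simp only [id]
    linear_combination -this
  set P : ℤ → E := fun r => ∑ i ∈ S, ((resi r i : ℝ) : ℂ) • cfc (hat i) b with hP
  have hPn (r : ℤ) : ‖P r‖ ≤ 1 := by
    rw [hP]; simp only []
    rw [cfc_hat_sum b]
    refine norm_cfc_le zero_le_one fun t ht => ?_
    rw [hat_sum N t (hspec t ht)]
    have hr (i : ℤ) : 0 ≤ resi r i ∧ resi r i ≤ 1 := by unfold resi; split_ifs <;> simp
    have hf0 := Int.fract_nonneg t
    have hf1 := Int.fract_lt_one t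
    have a := hr ⌊t⌋
    have c := hr (⌊t⌋ + 1)
    rw [Real.norm_eq_abs, abs_of_nonneg (by
      have := mul_nonneg a.1 (by linarith : 0 ≤ 1 - Int.fract t)
      have := mul_nonneg c.1 hf0
      linarith)]
    nlinarith
  have key : φ b 1 - φ 1 b = φ (P 1) (P 0) + φ (P 2) (P 1) + φ (P 0) (P 2)
      - φ (P 0) (P 1) - φ (P 1) (P 2) - φ (P 2) (P 0) := by
    have e1 := bilin_sum φ S (fun i => cfc (hat i) b) (fun i => i) (fun _ => 1)
    have e2 := bilin_sum φ S (fun i => cfc (hat i) b) (fun _ => 1) (fun i => i)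
    rw [← h1, ← h2] at e1 e2
    rw [e1, e2]
    simp only [hP]
    simp only [bilin_sum φ S (fun i => cfc (hat i) b), ← Finset.sum_add_distrib,
      ← Finset.sum_sub_distrib, ← add_smul, ← sub_smul]
    refine Finset.sum_congr rfl fun i _ => Finset.sum_congr rfl fun j _ => ?_
    by_cases hij : 2 ≤ |i - j|
    · rw [h0 _ _ (hat_continuous i) (hat_continuous j) (hat_mul i j hij)]; simp
    · congr 1
      norm_cast
      have hcase : i = j ∨ i = j + 1 ∨ j = i + 1 := by
        push Not at hij
        have := abs_lt.1 hij
        omega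
      have hm : ∀ k : ℤ, (k % 3 = 0 ∧ (k + 1) % 3 = 1) ∨ (k % 3 = 1 ∧ (k + 1) % 3 = 2) ∨
          (k % 3 = 2 ∧ (k + 1) % 3 = 0) := by intro k; omega
      unfold resi
      rcases hcase with rfl | rfl | rfl
      · rcases hm i with h | h | h <;> simp [h.1]
      · rcases hm j with h | h | h <;> simp [h.1, h.2]
      · rcases hm i with h | h | h <;> simp [h.1, h.2]
  have bd (r s : ℤ) : ‖φ (P r) (P s)‖ ≤ C := by
    refine (hC _ _).trans ?_
    have := hPn r
    have := hPn s
    calc C * ‖P r‖ * ‖P s‖ ≤ C * 1 * 1 := by gcongr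
      _ = C := by ring
  rw [key]
  have t1 := norm_sub_le (φ (P 1) (P 0) + φ (P 2) (P 1) + φ (P 0) (P 2)
      - φ (P 0) (P 1) - φ (P 1) (P 2)) (φ (P 2) (P 0))
  have t2 := norm_sub_le (φ (P 1) (P 0) + φ (P 2) (P 1) + φ (P 0) (P 2)
      - φ (P 0) (P 1)) (φ (P 1) (P 2))
  have t3 := norm_sub_le (φ (P 1) (P 0) + φ (P 2) (P 1) + φ (P 0) (P 2)) (φ (P 0) (P 1))
  have t4 := norm_add₃_le (a := φ (P 1) (P 0)) (b := φ (P 2) (P 1)) (c := φ (P 0) (P 2))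
  linarith [bd 1 0, bd 2 1, bd 0 2, bd 0 1, bd 1 2, bd 2 0]

lemma balance {E X : Type*} [CStarAlgebra E] [NormedAddCommGroup X] [NormedSpace ℂ X]
    (φ : E →ₗ[ℂ] E →ₗ[ℂ] X) (C : ℝ) (hC : ∀ F G, ‖φ F G‖ ≤ C * ‖F‖ * ‖G‖) (hC0 : 0 ≤ C)
    (b : E) (hb : IsSelfAdjoint b)
    (h0 : ∀ f g : ℝ → ℝ, Continuous f → Continuous g → (∀ t, f t * g t = 0) →
      φ (cfc f b) (cfc g b) = 0) :
    φ b 1 = φ 1 b := by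
  rw [← sub_eq_zero, ← norm_eq_zero]
  by_contra hne
  have hpos : 0 < ‖φ b 1 - φ 1 b‖ := lt_of_le_of_ne (norm_nonneg _) (Ne.symm hne)
  obtain ⟨n, hn⟩ := exists_nat_gt (6 * C / ‖φ b 1 - φ 1 b‖)
  have hb' : IsSelfAdjoint ((n : ℝ) • b) := by
    rw [IsSelfAdjoint, star_smul, hb.star_eq]; simp
  have := balance_bound φ C hC hC0 ((n : ℝ) • b) hb' (by
    intro f g hf hg hfg
    rw [← cfc_comp_smul (n : ℝ) f b, ← cfc_comp_smul (n : ℝ) g b]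
    exact h0 _ _ (by fun_prop) (by fun_prop) fun t => hfg _)
  have e : φ ((n : ℝ) • b) 1 - φ 1 ((n : ℝ) • b) = (n : ℂ) • (φ b 1 - φ 1 b) := by
    have : (n : ℝ) • b = (n : ℂ) • b := by
      rw [← Complex.coe_smul]; simp
    rw [this]; simp [smul_sub]
  rw [e, norm_smul] at this
  rw [div_lt_iff₀ hpos] at hn
  simp at this
  linarith

section bilinear

open Filter Topology

variable {A X : Type*} [NonUnitalCStarAlgebra A] [NormedAddCommGroup X] [NormedSpace ℂ X]

/-- `F ↦ F u` from the unitization. -/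
noncomputable def lact (u : A) : Unitization ℂ A →ₗ[ℂ] A where
  toFun F := (F * (u : Unitization ℂ A)).snd
  map_add' F G := by simp [add_mul]
  map_smul' c F := by simp [smul_smul]

/-- `F ↦ u F` from the unitization. -/
noncomputable def ract (u : A) : Unitization ℂ A →ₗ[ℂ] A where
  toFun F := ((u : Unitization ℂ A) * F).snd
  map_add' F G := by simp [mul_add]
  map_smul' c F := by simp [smul_smul]

lemma coe_lact (u : A) (F : Unitization ℂ A) :
    ((lact u F : A) : Unitization ℂ A) = F * (u : Unitization ℂ A) := by
  ext <;> simp [lact]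

lemma coe_ract (u : A) (F : Unitization ℂ A) :
    ((ract u F : A) : Unitization ℂ A) = (u : Unitization ℂ A) * F := by
  ext <;> simp [ract]

lemma norm_lact (u : A) (F : Unitization ℂ A) : ‖lact u F‖ ≤ ‖u‖ * ‖F‖ := by
  rw [← Unitization.norm_inr (𝕜 := ℂ), coe_lact, ← Unitization.norm_inr (𝕜 := ℂ) u, mul_comm ‖_‖]
  exact norm_mul_le _ _

lemma norm_ract (u : A) (F : Unitization ℂ A) : ‖ract u F‖ ≤ ‖u‖ * ‖F‖ := by
  rw [← Unitization.norm_inr (𝕜 := ℂ), coe_ract, ← Unitization.norm_inr (𝕜 := ℂ) u]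
  exact norm_mul_le _ _

lemma lact_one (u : A) : lact u 1 = u := by simp [lact]

lemma ract_one (u : A) : ract u 1 = u := by simp [ract]

lemma lact_inr (u b : A) : lact u (b : Unitization ℂ A) = b * u := by simp [lact]

lemma ract_inr (u b : A) : ract u (b : Unitization ℂ A) = u * b := by simp [ract]

lemma inr_sa {b : A} (hb : IsSelfAdjoint b) : IsSelfAdjoint (b : Unitization ℂ A) := by
  rw [IsSelfAdjoint, ← Unitization.inr_star, hb.star_eq]

lemma inr_inj {a b : A} (h : (a : Unitization ℂ A) = b) : a = b := Unitization.inr_injective h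

lemma core (U : A →L[ℂ] A →L[ℂ] X) (g₁ g₂ : Unitization ℂ A →ₗ[ℂ] A) (c₁ c₂ : ℝ)
    (hc₁ : 0 ≤ c₁) (hc₂ : 0 ≤ c₂)
    (h₁ : ∀ F, ‖g₁ F‖ ≤ c₁ * ‖F‖) (h₂ : ∀ F, ‖g₂ F‖ ≤ c₂ * ‖F‖) (b : A) (hb : IsSelfAdjoint b)
    (h0 : ∀ F G : Unitization ℂ A, F * G = 0 → G * F = 0 →
      (∀ z, Commute (b : Unitization ℂ A) z → Commute F z) →
      (∀ z, Commute (b : Unitization ℂ A) z → Commute G z) → U (g₁ F) (g₂ G) = 0) :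
    U (g₁ b) (g₂ 1) = U (g₁ 1) (g₂ b) := by
  let φ : Unitization ℂ A →ₗ[ℂ] Unitization ℂ A →ₗ[ℂ] X :=
    LinearMap.mk₂ ℂ (fun F G => U (g₁ F) (g₂ G)) (by simp) (by simp) (by simp) (by simp)
  refine balance φ (‖U‖ * c₁ * c₂) ?_ (by positivity) (b : Unitization ℂ A) (inr_sa hb) ?_
  · intro F G
    calc ‖U (g₁ F) (g₂ G)‖ ≤ ‖U‖ * ‖g₁ F‖ * ‖g₂ G‖ := U.le_opNorm₂ _ _
      _ ≤ ‖U‖ * (c₁ * ‖F‖) * (c₂ * ‖G‖) := by gcongr <;> simp [h₁, h₂]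
      _ = _ := by ring
  · intro f g hf hg hfg
    refine h0 _ _ ?_ ?_ ?_ ?_
    · rw [← cfc_mul f g _ hf.continuousOn hg.continuousOn]
      simp [hfg]
    · rw [← cfc_mul g f _ hg.continuousOn hf.continuousOn]
      simp [hfg, mul_comm]
    · intro z hz; exact hz.cfc_real f
    · intro z hz; exact hz.cfc_real g

lemma sa_ext {P Q : A →L[ℂ] X} (h : ∀ a, IsSelfAdjoint a → P a = Q a) (a : A) : P a = Q a := by
  rw [← realPart_add_I_smul_imaginaryPart a]
  simp only [map_add, map_smul]
  rw [h _ (realPart a).2, h _ (imaginaryPart a).2]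

/-- Step A -/
lemma stepA (U : A →L[ℂ] A →L[ℂ] X) (hU : ∀ a b, a * b = 0 → b * a = 0 → U a b = 0)
    (u v : A) (huv : u * v = 0) (a : A) : U (a * u) v = U u (v * a) := by
  refine sa_ext (P := (U.flip v).comp ((ContinuousLinearMap.mul ℂ A).flip u))
    (Q := (U u).comp (ContinuousLinearMap.mul ℂ A v)) (fun a ha => ?_) a
  have := core U (lact u) (ract v) ‖u‖ ‖v‖ (norm_nonneg _) (norm_nonneg _) (norm_lact u)
    (norm_ract v) a ha (by
      intro F G hFG hGF _ _
      apply hU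
      · apply inr_inj
        rw [Unitization.inr_mul, coe_lact, coe_ract]
        have : (u : Unitization ℂ A) * v = 0 := by rw [← Unitization.inr_mul, huv]; simp
        rw [mul_assoc, ← mul_assoc (u : Unitization ℂ A), this]; simp
      · apply inr_inj
        rw [Unitization.inr_mul, coe_lact, coe_ract, mul_assoc, ← mul_assoc G, hGF]; simp)
  simpa [lact_one, ract_one, lact_inr, ract_inr] using this

/-- Step B -/
lemma stepB (W : A →L[ℂ] A →L[ℂ] X) (hW : ∀ a b, a * b = 0 → W a b = 0)
    (x y b : A) : W (x * b) y = W x (b * y) := by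
  refine sa_ext (P := (W.flip y).comp (ContinuousLinearMap.mul ℂ A x))
    (Q := (W x).comp ((ContinuousLinearMap.mul ℂ A).flip y)) (fun b hb => ?_) b
  have := core W (ract x) (lact y) ‖x‖ ‖y‖ (norm_nonneg _) (norm_nonneg _) (norm_ract x)
    (norm_lact y) b hb (by
      intro F G hFG hGF _ _
      apply hW
      apply inr_inj
      rw [Unitization.inr_mul, coe_lact, coe_ract, mul_assoc, ← mul_assoc F, hFG]; simp)
  simpa [lact_one, ract_one, lact_inr, ract_inr] using this

/-- The four term identity. -/
lemma fourTerm (U : A →L[ℂ] A →L[ℂ] X) (hU : ∀ a b, a * b = 0 → b * a = 0 → U a b = 0)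
    (a x b y : A) :
    U (a * (x * b)) y - U (x * b) (y * a) = U (a * x) (b * y) - U x (b * y * a) := by
  let W : A →L[ℂ] A →L[ℂ] X :=
    U.comp (ContinuousLinearMap.mul ℂ A a) -
      (U.flip.comp ((ContinuousLinearMap.mul ℂ A).flip a)).flip
  have hW (u v : A) : W u v = U (a * u) v - U u (v * a) := by simp [W]
  have := stepB W (fun u v huv => by rw [hW, stepA U hU u v huv, sub_self]) x y b
  simpa only [hW] using this

/-- Step C -/
lemma stepC (U : A →L[ℂ] A →L[ℂ] X) (hU : ∀ a b, a * b = 0 → b * a = 0 → U a b = 0)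
    (p : A) (hp : IsSelfAdjoint p) : U (p * (p * p)) p = U p (p * p * p) := by
  have := core U (ract p) (lact p) ‖p‖ ‖p‖ (norm_nonneg _) (norm_nonneg _) (norm_ract p)
    (norm_lact p) (p * p) (by rw [IsSelfAdjoint, star_mul, hp.star_eq]) (by
      intro F G hFG hGF hF hG
      have hpp : Commute ((p * p : A) : Unitization ℂ A) (p : Unitization ℂ A) := by
        rw [Unitization.inr_mul]; exact (Commute.refl _).mul_left (Commute.refl _)
      have hF' := hF _ hpp
      have hG' := hG _ hpp
      apply hU
      · apply inr_inj
        rw [Unitization.inr_mul, coe_lact, coe_ract, mul_assoc, ← mul_assoc F, hFG]; simp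
      · apply inr_inj
        rw [Unitization.inr_mul, coe_lact, coe_ract, hG'.eq, ← hF'.eq, mul_assoc,
          ← mul_assoc G, hGF]
        simp)
  simpa only [lact_one, ract_one, lact_inr, ract_inr] using this

lemma limSq (U : A →L[ℂ] A →L[ℂ] X) (hU : ∀ a b, a * b = 0 → b * a = 0 → U a b = 0)
    {l : Filter A} (hl : l.IsApproximateUnit) (p : A) (hp : IsSelfAdjoint p) :
    Tendsto (fun e => U ((p * p) * (p * p)) e) l (𝓝 (U (p * p) (p * p))) := by
  have h4 (e : A) : U ((p * p) * (p * p)) e =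
      U (p * p) (e * (p * p)) + (U (p * p * p) (p * e) - U p (p * e * (p * p))) := by
    rw [← fourTerm U hU (p * p) p p e]; abel
  simp_rw [h4]
  have t1 : Tendsto (fun e => e * (p * p)) l (𝓝 (p * p)) := hl.tendsto_mul_right _
  have t2 : Tendsto (fun e => p * e) l (𝓝 p) := hl.tendsto_mul_left _
  have t3 : Tendsto (fun e => p * e * (p * p)) l (𝓝 (p * (p * p))) := t2.mul_const _
  have key := (((U (p * p)).continuous.tendsto _).comp t1).add
    ((((U (p * p * p)).continuous.tendsto _).comp t2).sub (((U p).continuous.tendsto _).comp t3))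
  have hC := stepC U hU p hp
  have e : U (p * p) (p * p) = U (p * p) (p * p) + (U (p * p * p) p - U p (p * (p * p))) := by
    rw [mul_assoc] at hC ⊢; rw [hC]; simp
  rw [e]
  exact key

variable [PartialOrder A] [StarOrderedRing A]

lemma limSq' (U : A →L[ℂ] A →L[ℂ] X) (hU : ∀ a b, a * b = 0 → b * a = 0 → U a b = 0)
    {l : Filter A} (hl : l.IsApproximateUnit) (x : A) (hx : 0 ≤ x) :
    Tendsto (fun e => U (x * x) e) l (𝓝 (U x x)) := by
  have h := limSq U hU hl (CFC.sqrt x) (CFC.sqrt_nonneg x).isSelfAdjoint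
  rwa [CFC.sqrt_mul_sqrt_self x hx] at h

lemma limJordan (U : A →L[ℂ] A →L[ℂ] X) (hU : ∀ a b, a * b = 0 → b * a = 0 → U a b = 0)
    {l : Filter A} (hl : l.IsApproximateUnit) (a b : A) :
    Tendsto (fun e => U (a * b + b * a) e) l (𝓝 (U a b + U b a)) := by
  have hspan : ∀ x : A, x ∈ Submodule.span ℂ {a : A | 0 ≤ a} := by
    intro x; rw [CStarAlgebra.span_nonneg]; trivial
  induction hspan a using Submodule.span_induction with
  | mem x hx =>
    induction hspan b using Submodule.span_induction with
    | mem y hy =>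
      have t := ((limSq' U hU hl (x + y) (add_nonneg hx hy)).sub (limSq' U hU hl x hx)).sub
        (limSq' U hU hl y hy)
      convert t using 2
      · simp only [add_mul, mul_add, map_add, add_apply]; abel
      · simp only [map_add, add_apply]; abel
    | zero => simp [tendsto_const_nhds]
    | add y z _ _ hy hz =>
      convert hy.add hz using 2
      · simp only [add_mul, mul_add, map_add, add_apply]; abel
      · simp only [map_add, add_apply]; abel
    | smul c y _ hy =>
      convert hy.const_smul c using 2
      · simp [mul_smul_comm, smul_mul_assoc]
      · simp
  | zero => simp [tendsto_const_nhds]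
  | add y z _ _ hy hz =>
    convert hy.add hz using 2
    · simp only [add_mul, mul_add, map_add, add_apply]; abel
    · simp only [map_add, add_apply]; abel
  | smul c y _ hy =>
    convert hy.const_smul c using 2
    · simp [mul_smul_comm, smul_mul_assoc]
    · simp

lemma exLim (U : A →L[ℂ] A →L[ℂ] X) (hU : ∀ a b, a * b = 0 → b * a = 0 → U a b = 0)
    {l : Filter A} (hl : l.IsApproximateUnit) (c : A) :
    ∃ r, Tendsto (fun e => U c e) l (𝓝 r) ∧ Tendsto (fun e => U e c) l (𝓝 r) := by
  have hspan : c ∈ Submodule.span ℂ {a : A | 0 ≤ a} := by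
    rw [CStarAlgebra.span_nonneg]; trivial
  induction hspan using Submodule.span_induction with
  | mem x hx =>
    have h1 := limSq' U hU hl (CFC.sqrt x) (CFC.sqrt_nonneg x)
    have h2 := limSq' U.flip (fun a b h h' => hU b a h' h) hl (CFC.sqrt x) (CFC.sqrt_nonneg x)
    rw [CFC.sqrt_mul_sqrt_self x hx] at h1 h2
    exact ⟨_, h1, h2⟩
  | zero => exact ⟨0, by simp [tendsto_const_nhds], by simp [tendsto_const_nhds]⟩
  | add y z _ _ hy hz =>
    obtain ⟨r, h1, h2⟩ := hy
    obtain ⟨s, h3, h4⟩ := hz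
    exact ⟨r + s, by simpa using h1.add h3, by simpa using h2.add h4⟩
  | smul c y _ hy =>
    obtain ⟨r, h1, h2⟩ := hy
    exact ⟨c • r, by simpa using h1.const_smul c, by simpa using h2.const_smul c⟩

end bilinear

lemma orth_of_triple {A : Type*} [NonUnitalCStarAlgebra A] [PartialOrder A] [StarOrderedRing A]
    (a b : A) (h : a * star a * b + b * star a * a = 0) : star a * b = 0 := by
  have h1 : star (star a * b) * (star a * b) = -((star b * b) * (star a * a)) := by
    have := congrArg (star b * ·) h
    simp only [mul_add, mul_zero] at this
    rw [← sub_eq_zero, ← this]; simp only [star_mul, star_star]; noncomm_ring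
  have hc : Commute (star b * b) (star a * a) := by
    have h2 := congrArg star h1
    simp only [star_neg, star_mul, star_star] at h1 h2
    exact neg_injective (h1.symm.trans h2)
  have h3 := hc.mul_nonneg (star_mul_self_nonneg b) (star_mul_self_nonneg a)
  have h4 := star_mul_self_nonneg (star a * b)
  rw [← CStarRing.star_mul_self_eq_zero_iff]
  refine le_antisymm ?_ h4
  rw [h1]; simpa using h3

section main

open Filter Topology

variable {A B : Type*} [NonUnitalCStarAlgebra A] [NonUnitalCStarAlgebra B]

/-- `b ↦ (T b*)*`. -/
noncomputable def conjMap (T : A →L[ℂ] B) : A →L[ℂ] B :=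
  LinearMap.mkContinuous
    { toFun := fun b => star (T (star b))
      map_add' := by intro x y; simp
      map_smul' := by intro c x; simp } ‖T‖ (by
      intro x
      simpa using T.le_opNorm (star x))

lemma conjMap_apply (T : A →L[ℂ] B) (b : A) : conjMap T b = star (T (star b)) := rfl

lemma main_triple [PartialOrder A] [StarOrderedRing A] [PartialOrder B] [StarOrderedRing B]
    (T : A →L[ℂ] B)
    (hT : ∀ a b : A, IsOrthogonal a b → IsOrthogonal (T a) (T b)) (a b : A)
    (hab : IsOrthogonal (T a) (T b)) :
    T (a * star a * b + b * star a * a) = 0 := by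
  have hl := CStarAlgebra.increasingApproximateUnit A
  set l := CStarAlgebra.approximateUnit A
  have hl' := hl.toIsApproximateUnit
  haveI : l.NeBot := hl'.neBot
  set S := conjMap T with hS
  have hSs (c : A) : S (star c) = star (T c) := by rw [hS, conjMap_apply, star_star]
  let U₁ : A →L[ℂ] A →L[ℂ] B := (ContinuousLinearMap.mul ℂ B).bilinearComp T S
  let U₂ : A →L[ℂ] A →L[ℂ] B := (ContinuousLinearMap.mul ℂ B).flip.bilinearComp T S
  have hU₁ : ∀ a b, a * b = 0 → b * a = 0 → U₁ a b = 0 := fun a b h h' =>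
    (hT a (star b) ⟨by simpa using h, by simpa using h'⟩).1
  have hU₂ : ∀ a b, a * b = 0 → b * a = 0 → U₂ a b = 0 := fun a b h h' =>
    (hT a (star b) ⟨by simpa using h, by simpa using h'⟩).2
  have jR (x z : A) : Tendsto (fun e => T (x * z + z * x) * S e) l (𝓝 (T x * S z + T z * S x)) :=
    limJordan U₁ hU₁ hl' x z
  have jL (x z : A) : Tendsto (fun e => S e * T (x * z + z * x)) l (𝓝 (S z * T x + S x * T z)) :=
    limJordan U₂ hU₂ hl' x z
  have exR (c : A) : ∃ r, Tendsto (fun e => T c * S e) l (𝓝 r) ∧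
      Tendsto (fun e => T e * S c) l (𝓝 r) := exLim U₁ hU₁ hl' c
  have exL (c : A) : ∃ r, Tendsto (fun e => S e * T c) l (𝓝 r) ∧
      Tendsto (fun e => S c * T e) l (𝓝 r) := exLim U₂ hU₂ hl' c
  choose R hR₁ hR₂ using exR
  choose L hL₁ hL₂ using exL
  have Rj (x z : A) : R (x * z + z * x) = T x * S z + T z * S x :=
    tendsto_nhds_unique (hR₁ _) (jR x z)
  have Lj (x z : A) : L (x * z + z * x) = S z * T x + S x * T z :=
    tendsto_nhds_unique (hL₁ _) (jL x z)
  have Ladd (x z : A) : L (x + z) = L x + L z :=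
    tendsto_nhds_unique (hL₁ _) (by simpa [mul_add] using (hL₁ x).add (hL₁ z))
  have Lsub (x z : A) : L (x - z) = L x - L z :=
    tendsto_nhds_unique (hL₁ _) (by simpa [mul_sub] using (hL₁ x).sub (hL₁ z))
  have Lstar (c : A) : L (star c) = star (L c) := by
    refine tendsto_nhds_unique (hL₂ _) (((hL₁ c).star).congr' ?_)
    filter_upwards [hl.eventually_star_eq] with e he
    rw [star_mul, hSs]
    congr 1
    rw [hS, conjMap_apply, star_star, he]
  have RT (x z : A) : R x * T z = T x * L z := by
    refine tendsto_nhds_unique ((hR₁ x).mul_const (T z)) ?_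
    simpa [mul_assoc] using (hL₁ z).const_mul (T x)
  have LS (x z : A) : L x * S z = S x * R z := by
    refine tendsto_nhds_unique ((hL₂ x).mul_const (S z)) ?_
    simpa [mul_assoc] using (hR₂ z).const_mul (S x)
  have LL (u x z : A) : L u * L (x * z + z * x) = S u * (R x * T z + R z * T x) := by
    rw [Lj, mul_add, ← mul_assoc, ← mul_assoc, LS, LS]
    noncomm_ring
  set w := a * star a * b + b * star a * a with hw
  have hw2 : w + w = ((a * star a + star a * a) * b + b * (a * star a + star a * a))
      + ((star a * b + b * star a) * a + a * (star a * b + b * star a))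
      - ((a * b + b * a) * star a + star a * (a * b + b * a)) := by
    rw [hw]; noncomm_ring
  have z1 : star (T a) * T b = 0 := by
    have := congrArg star hab.2
    simpa using this
  have z2 : T b * star (T a) = 0 := by
    have := congrArg star hab.1
    simpa using this
  have hLL (u : A) : L u * L w = 0 := by
    have e : L u * L (w + w) = 0 := by
      rw [hw2, Lsub, Ladd, mul_sub, mul_add, LL, LL, LL, RT b, RT a, RT (star a), ← mul_add,
        ← mul_sub]
      rw [Rj, Rj, Rj, Lj, Lj, Lj]
      have : T a * S (star a) * T b + T b * S (star a) * T a = 0 := by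
        rw [hSs, mul_assoc, z1, z2]; simp
      have h2 := congrArg (fun q => S u * (q + q)) this
      simp only [add_zero, mul_zero] at h2
      rw [← h2]
      noncomm_ring
    rw [Ladd, mul_add, ← two_smul ℂ] at e
    exact (smul_eq_zero.1 e).resolve_left two_ne_zero
  have hLw : L w = 0 := by
    rw [← CStarRing.star_mul_self_eq_zero_iff, ← Lstar, hLL]
  have hSR (x : A) : star (T w) * R x = 0 := by
    rw [← hSs, ← LS, Lstar, hLw]; simp
  have h5 := congrArg (· * T w) (hSR (w * star w + star w * w))
  simp only [Rj, zero_mul] at h5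
  have hSw : S w = star (T (star w)) := rfl
  rw [hSs, hSw] at h5
  have h6 : star (star (T w) * T w) * (star (T w) * T w) +
      star (star (T (star w)) * T w) * (star (T (star w)) * T w) = 0 := by
    rw [← h5]; simp only [star_mul, star_star]; noncomm_ring
  have h7 := (add_eq_zero_iff_of_nonneg (star_mul_self_nonneg _) (star_mul_self_nonneg _)).1 h6
  have h8 := h7.1
  rw [CStarRing.star_mul_self_eq_zero_iff, CStarRing.star_mul_self_eq_zero_iff] at h8
  exact h8

end main

/-- A bijective bounded linear operator between C*-algebras is orthogonality preserving
if and only if it is biorthogonality preserving. -/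
theorem bijective_orthogonality_preserving_iff_biorthogonality_preserving {A B : Type*}
    [NonUnitalCStarAlgebra A] [NonUnitalCStarAlgebra B] (T : A →L[ℂ] B)
    (hbij : Function.Bijective T) :
    (∀ a b : A, IsOrthogonal a b → IsOrthogonal (T a) (T b)) ↔
      (∀ a b : A, IsOrthogonal a b ↔ IsOrthogonal (T a) (T b)) := by
  refine ⟨fun h a b => ⟨h a b, fun hab => ?_⟩, fun h a b => (h a b).1⟩
  letI : PartialOrder A := CStarAlgebra.spectralOrder A
  haveI : StarOrderedRing A := CStarAlgebra.spectralOrderedRing A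
  letI : PartialOrder B := CStarAlgebra.spectralOrder B
  haveI : StarOrderedRing B := CStarAlgebra.spectralOrderedRing B
  have hw : a * star a * b + b * star a * a = 0 :=
    hbij.1 (by rw [main_triple T h a b hab, map_zero])
  constructor
  · have := orth_of_triple (star a) (star b) (by
      have := congrArg star hw
      simpa [mul_assoc, add_comm] using this)
    simpa using this
  · have := congrArg star (orth_of_triple a b hw)
    simpa using this
end
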